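/- Let 13/14 < γ < 1 be fixed, let α be an irrational real number and β a real number, and let ε > 0. Then there exist infinitely many prime numbers p such that p = ⌊n^{1/γ}⌋ for some positive integer n and ‖αp² + β‖ < p^{(13−14γ)/29 + ε}, where ‖x‖ denotes the distance from x to the nearest integer. -/

import Mathlib

/-- `nint x` is the distance from the real number `x` to the nearest integer. -/
noncomputable def nint (x : ℝ) : ℝ := |x - round x|

/-- The additive character `x ↦ exp (2πix)`. -/
noncomputable def ee (x : ℝ) : ℂ := Complex.exp ((2 * Real.pi * x : ℝ) * Complex.I)

theorem ee_add (x y : ℝ) : ee (x + y) = ee x * ee y := by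
  rw [ee, ee, ee, ← Complex.exp_add]; congr 1; push_cast; ring

theorem norm_ee (x : ℝ) : ‖ee x‖ = 1 := Complex.norm_exp_ofReal_mul_I _

theorem ee_zero : ee 0 = 1 := by simp [ee]

theorem ee_neg (x : ℝ) : ee (-x) = (starRingEnd ℂ) (ee x) := by
  rw [ee, ee, ← Complex.exp_conj]; congr 1
  rw [map_mul, Complex.conj_I, Complex.conj_ofReal]; push_cast; ring

theorem ee_sub (x y : ℝ) : ee (x - y) = ee x * (starRingEnd ℂ) (ee y) := by
  rw [sub_eq_add_neg, ee_add, ee_neg]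

theorem ee_int (n : ℤ) : ee n = 1 := by
  rw [ee, Complex.exp_eq_one_iff]; exact ⟨n, by push_cast; ring⟩

theorem ee_add_int (x : ℝ) (n : ℤ) : ee (x + n) = ee x := by
  rw [ee_add, ee_int, mul_one]

theorem ee_sub_one (x : ℝ) :
    ee x - 1 = ee (x / 2) * (2 * Complex.I * (Real.sin (Real.pi * x) : ℝ)) := by
  have h1 : ee x = ee (x / 2) * ee (x / 2) := by rw [← ee_add]; congr 1; ring
  have h2 : ee (x / 2) * ee (-(x / 2)) = 1 := by rw [← ee_add]; simp [ee_zero]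
  have h3 : 2 * Complex.I * (Real.sin (Real.pi * x) : ℝ) = ee (x / 2) - ee (-(x / 2)) := by
    rw [ee, ee, Complex.ofReal_sin, Complex.sin]
    have e1 : (((2 * Real.pi * (x / 2) : ℝ)) : ℂ) * Complex.I = ((Real.pi * x : ℝ) : ℂ) * Complex.I := by
      push_cast; ring
    have e2 : (((2 * Real.pi * (-(x / 2)) : ℝ)) : ℂ) * Complex.I = -((Real.pi * x : ℝ) : ℂ) * Complex.I := by
      push_cast; ring
    rw [e1, e2]
    have := Complex.I_mul_I
    linear_combination (Complex.exp (-((Real.pi * x : ℝ) : ℂ) * Complex.I) -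
      Complex.exp (((Real.pi * x : ℝ) : ℂ) * Complex.I)) * this
  rw [h3, mul_sub, h2, ← h1]

theorem norm_ee_sub_one (x : ℝ) : ‖ee x - 1‖ = 2 * |Real.sin (Real.pi * x)| := by
  rw [ee_sub_one, norm_mul, norm_ee, norm_mul, norm_mul, Complex.norm_real]; simp

theorem two_mul_le_sin_pi_mul {δ x : ℝ} (h0 : 0 ≤ δ) (h1 : δ ≤ x) (h2 : x ≤ 1 - δ) :
    2 * δ ≤ Real.sin (Real.pi * x) := by
  have hpi := Real.pi_pos
  rcases le_total x (1 / 2) with h | h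
  · have hx : 0 ≤ x := h0.trans h1
    have := Real.mul_le_sin (x := Real.pi * x) (by positivity) (by nlinarith)
    have e : 2 / Real.pi * (Real.pi * x) = 2 * x := by field_simp
    linarith
  · have := Real.mul_le_sin (x := Real.pi * (1 - x)) (by apply mul_nonneg <;> linarith) (by nlinarith)
    have e : 2 / Real.pi * (Real.pi * (1 - x)) = 2 * (1 - x) := by field_simp
    have e2 : Real.sin (Real.pi * (1 - x)) = Real.sin (Real.pi * x) := by
      rw [mul_sub, mul_one, Real.sin_pi_sub]
    linarith

/-- Discrete Kusmin–Landau inequality for increasing first differences. -/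
theorem norm_sum_ee_le_of_monotone_aux (f : ℕ → ℝ) (a b : ℕ) (hab : a < b) (δ : ℝ) (hδ : 0 < δ)
    (h1 : ∀ n, a ≤ n → n < b → δ ≤ f (n + 1) - f n)
    (h2 : ∀ n, a ≤ n → n < b → f (n + 1) - f n ≤ 1 - δ)
    (hm : ∀ n, a ≤ n → n + 1 < b → f (n + 1) - f n ≤ f (n + 2) - f (n + 1)) :
    ‖∑ n ∈ Finset.Ico a b, ee (f n)‖ ≤ 1 / δ := by
  set d : ℕ → ℝ := fun n => f (n + 1) - f n with hd
  set s : ℕ → ℝ := fun n => Real.sin (Real.pi * d n) with hs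
  set c : ℕ → ℝ := fun n => Real.cos (Real.pi * d n) / s n with hc
  set g : ℕ → ℂ := fun n => 1 / (ee (d n) - 1) with hg
  have hspos : ∀ n, a ≤ n → n < b → 2 * δ ≤ s n := fun n hn hn' =>
    two_mul_le_sin_pi_mul hδ.le (h1 n hn hn') (h2 n hn hn')
  have hne : ∀ n, a ≤ n → n < b → ee (d n) - 1 ≠ 0 := by
    intro n hn hn' h
    have := norm_ee_sub_one (d n)
    rw [h, norm_zero] at this
    have h3 := hspos n hn hn'
    have : s n = 0 := by simpa using this.symm
    linarith
  have hgn : ∀ n, a ≤ n → n < b → ‖g n‖ ≤ 1 / (4 * δ) := by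
    intro n hn hn'
    have h3 := hspos n hn hn'
    simp only [hg, norm_div, norm_one, norm_ee_sub_one]
    apply one_div_le_one_div_of_le (by positivity)
    have := le_abs_self (s n)
    simp only [hs] at this h3 ⊢
    linarith
  have hcb : ∀ n, a ≤ n → n < b → |c n| ≤ 1 / (2 * δ) := by
    intro n hn hn'
    have h3 := hspos n hn hn'
    simp only [hc, abs_div]
    rw [abs_of_pos (by linarith : 0 < s n)]
    exact div_le_div₀ zero_le_one (Real.abs_cos_le_one _) (by positivity) h3
  have hgdiff : ∀ n, a ≤ n → n + 1 < b → ‖g n - g (n + 1)‖ ≤ (c n - c (n + 1)) / 2 := by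
    intro n hn hn'
    have p1 := hspos n hn (by omega)
    have p2 := hspos (n + 1) (by omega) hn'
    have q1 : 0 < s n := by linarith
    have q2 : 0 < s (n + 1) := by linarith
    have hmm := hm n hn hn'
    have e1 : g n - g (n + 1) = ee (d n) * (ee (d (n + 1) - d n) - 1) /
        ((ee (d n) - 1) * (ee (d (n + 1)) - 1)) := by
      have k1 := hne n hn (by omega)
      have k2 := hne (n + 1) (by omega) hn'
      have : ee (d (n + 1)) = ee (d n) * ee (d (n + 1) - d n) := by rw [← ee_add]; congr 1; ring
      simp only [hg]
      rw [mul_sub, ← this]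
      field_simp
      ring
    have e2 : c n - c (n + 1) = Real.sin (Real.pi * (d (n + 1) - d n)) / (s n * s (n + 1)) := by
      have : Real.sin (Real.pi * (d (n + 1) - d n)) = s (n + 1) * Real.cos (Real.pi * d n) -
          Real.cos (Real.pi * d (n + 1)) * s n := by rw [mul_sub, Real.sin_sub]
      rw [this]
      simp only [hc]
      field_simp
    rw [e1, e2, norm_div, norm_mul, norm_mul, norm_ee, norm_ee_sub_one, norm_ee_sub_one,
      norm_ee_sub_one, abs_of_pos q1, abs_of_pos q2]
    have r1 := h1 n hn (by omega)
    have r2 := h2 (n + 1) (by omega) hn'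
    have : 0 ≤ Real.sin (Real.pi * (d (n + 1) - d n)) := by
      apply Real.sin_nonneg_of_nonneg_of_le_pi
      · apply mul_nonneg Real.pi_pos.le; simp only [hd]; linarith
      · have : d (n + 1) - d n ≤ 1 := by simp only [hd] at r1 r2 ⊢; linarith
        nlinarith [Real.pi_pos]
    rw [abs_of_nonneg this]
    apply le_of_eq
    field_simp
  have key : ∀ k, a + k < b → ‖∑ n ∈ Finset.Ico a (a + k + 1), ee (f n) -
      ee (f (a + k + 1)) * g (a + k)‖ ≤ ‖g a‖ + (c a - c (a + k)) / 2 := by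
    have tel : ∀ n, a ≤ n → n < b → ee (f n) = ee (f (n + 1)) * g n - ee (f n) * g n := by
      intro n hn hn'
      have k1 := hne n hn hn'
      have : ee (f (n + 1)) = ee (f n) * ee (d n) := by rw [← ee_add]; congr 1; simp [hd]
      simp only [hg]; rw [this]; field_simp
    intro k
    induction k with
    | zero =>
      intro h
      simp only [add_zero, Nat.Ico_succ_singleton, Finset.sum_singleton, sub_self, zero_div]
      have := tel a le_rfl hab
      rw [show ee (f a) - ee (f (a + 1)) * g a = - (ee (f a) * g a) by linear_combination this, norm_neg, norm_mul, norm_ee, one_mul]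
    | succ k ih =>
      intro h
      have ih := ih (by omega)
      rw [Finset.sum_Ico_succ_top (by omega)]
      have t := tel (a + (k + 1)) (by omega) h
      have gd := hgdiff (a + k) (by omega) (by omega)
      rw [← add_assoc] at t ⊢
      have : ∑ n ∈ Finset.Ico a (a + k + 1), ee (f n) + ee (f (a + k + 1)) - ee (f (a + k + 1 + 1)) * g (a + k + 1)
        = (∑ n ∈ Finset.Ico a (a + k + 1), ee (f n) - ee (f (a + k + 1)) * g (a + k)) +
          ee (f (a + k + 1)) * (g (a + k) - g (a + k + 1)) := by linear_combination t
      rw [this]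
      refine (norm_add_le _ _).trans ?_
      rw [norm_mul, norm_ee, one_mul]
      linarith
  obtain ⟨k, rfl⟩ : ∃ k, b = a + k + 1 := ⟨b - a - 1, by omega⟩
  have h := key k (by omega)
  have g1 := hgn a le_rfl hab
  have g2 := hgn (a + k) (by omega) (by omega)
  have c1 := hcb a le_rfl hab
  have c2 := hcb (a + k) (by omega) (by omega)
  have n1 : ‖ee (f (a + k + 1)) * g (a + k)‖ ≤ 1 / (4 * δ) := by rwa [norm_mul, norm_ee, one_mul]
  have := norm_sub_norm_le (∑ n ∈ Finset.Ico a (a + k + 1), ee (f n)) (ee (f (a + k + 1)) * g (a + k))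
  have e : 1 / δ = 1 / (4 * δ) + 1 / (4 * δ) + (1 / (2 * δ) + 1 / (2 * δ)) / 2 := by field_simp; norm_num
  rw [e]
  have := abs_le.1 c1
  have := abs_le.1 c2
  linarith

/-- Discrete Kusmin–Landau inequality. -/
theorem norm_sum_ee_le_of_monotone (f : ℕ → ℝ) (a b : ℕ) (j : ℤ) (δ : ℝ) (hδ : 0 < δ)
    (h1 : ∀ n, a ≤ n → n < b → j + δ ≤ f (n + 1) - f n)
    (h2 : ∀ n, a ≤ n → n < b → f (n + 1) - f n ≤ j + 1 - δ)
    (hm : ∀ n, a ≤ n → n + 1 < b → f (n + 1) - f n ≤ f (n + 2) - f (n + 1)) :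
    ‖∑ n ∈ Finset.Ico a b, ee (f n)‖ ≤ 1 / δ := by
  rcases le_or_gt b a with h | hab
  · rw [Finset.Ico_eq_empty_of_le h]; simp; positivity
  have := norm_sum_ee_le_of_monotone_aux (fun n => f n - j * n) a b hab δ hδ
    (fun n hn hn' => by have := h1 n hn hn'; push_cast; linarith)
    (fun n hn hn' => by have := h2 n hn hn'; push_cast; linarith)
    (fun n hn hn' => by have := hm n hn hn'; push_cast; linarith)
  have e : ∀ n, ee (f n) = ee (f n - j * n) := fun n => by
    have := ee_add_int (f n - j * n) (j * n)
    rw [← this]; congr 1; push_cast; ring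
  simpa only [e] using this

theorem norm_sum_ee_le_card (f : ℕ → ℝ) (a b : ℕ) :
    ‖∑ n ∈ Finset.Ico a b, ee (f n)‖ ≤ ((b - a : ℕ) : ℝ) := by
  refine (norm_sum_le _ _).trans ?_
  simp [norm_ee]

theorem exists_threshold (d : ℕ → ℝ) (t : ℝ) (a b : ℕ) (hab : a ≤ b)
    (hm : ∀ n, a ≤ n → n + 1 < b → d n ≤ d (n + 1)) :
    ∃ c, a ≤ c ∧ c ≤ b ∧ (∀ n, a ≤ n → n < c → d n < t) ∧ (∀ n, c ≤ n → n < b → t ≤ d n) := by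
  induction b, hab using Nat.le_induction with
  | base => exact ⟨a, le_rfl, le_rfl, fun n h h' => by omega, fun n h h' => by omega⟩
  | succ b hab ih =>
    obtain ⟨c, hc1, hc2, hc3, hc4⟩ := ih fun n h h' => hm n h (by omega)
    by_cases h : c < b
    · refine ⟨c, hc1, by omega, hc3, fun n h1 h2 => ?_⟩
      rcases Nat.lt_succ_iff_lt_or_eq.1 h2 with h3 | rfl
      · exact hc4 n h1 h3
      · have := hc4 (n - 1) (by omega) (by omega)
        have h5 := hm (n - 1) (by omega) (by omega)
        rw [show n - 1 + 1 = n by omega] at h5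
        linarith
    · have hcb : c = b := by omega
      subst hcb
      by_cases ht : d c < t
      · refine ⟨c + 1, by omega, le_rfl, fun n h1 h2 => ?_, fun n h1 h2 => by omega⟩
        rcases Nat.lt_succ_iff_lt_or_eq.1 h2 with h3 | rfl
        · exact hc3 n h1 h3
        · exact ht
      · refine ⟨c, hc1, by omega, hc3, fun n h1 h2 => ?_⟩
        obtain rfl : n = c := by omega
        exact not_lt.1 ht

theorem add_mul_le_of_forall_add_le (d : ℕ → ℝ) (l : ℝ) (a k : ℕ)
    (hm : ∀ n, a ≤ n → n < a + k → d n + l ≤ d (n + 1)) : d a + k * l ≤ d (a + k) := by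
  induction k with
  | zero => simp
  | succ k ih =>
    have := ih fun n h h' => hm n h (by omega)
    have := hm (a + k) (by omega) (by omega)
    rw [← add_assoc]; push_cast; linarith

theorem sub_mul_le_of_range (d : ℕ → ℝ) (l u w : ℝ) (hl : 0 < l) (a b : ℕ) (hw : 0 ≤ w)
    (h : ∀ n, a ≤ n → n < b → u ≤ d n ∧ d n ≤ u + w)
    (hm : ∀ n, a ≤ n → n + 1 < b → d n + l ≤ d (n + 1)) :
    ((b - a : ℕ) : ℝ) ≤ w / l + 1 := by
  rcases le_or_gt b a with hab | hab
  · rw [Nat.sub_eq_zero_of_le hab]; simp; positivity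
  obtain ⟨k, rfl⟩ : ∃ k, b = a + k + 1 := ⟨b - a - 1, by omega⟩
  have := add_mul_le_of_forall_add_le d l a k fun n hn hn' => hm n hn (by omega)
  have h1 := (h a le_rfl hab).1
  have h2 := (h (a + k) (by omega) (by omega)).2
  have : (k : ℝ) ≤ w / l := by rw [le_div_iff₀ hl]; linarith
  have e : a + k + 1 - a = k + 1 := by omega
  rw [e]; push_cast; linarith

/-- Second difference test when the first differences stay in a unit interval. -/
theorem norm_sum_ee_le_of_unit (f : ℕ → ℝ) (a b : ℕ) (j : ℤ) (l : ℝ) (hl : 0 < l) (hl4 : l ≤ 1 / 4)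
    (h : ∀ n, a ≤ n → n < b → j ≤ f (n + 1) - f n ∧ f (n + 1) - f n ≤ j + 1)
    (hm : ∀ n, a ≤ n → n + 1 < b → f (n + 1) - f n + l ≤ f (n + 2) - f (n + 1)) :
    ‖∑ n ∈ Finset.Ico a b, ee (f n)‖ ≤ 5 / √l := by
  rcases le_or_gt b a with hba | hab
  · rw [Finset.Ico_eq_empty_of_le hba]; simp; positivity
  set s := √l with hs
  have hs0 : 0 < s := Real.sqrt_pos.2 hl
  have hss : s * s = l := Real.mul_self_sqrt hl.le
  have hs2 : s ≤ 1 / 2 := by nlinarith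
  set d : ℕ → ℝ := fun n => f (n + 1) - f n with hd
  have hm' : ∀ n, a ≤ n → n + 1 < b → d n + l ≤ d (n + 1) := hm
  obtain ⟨c, hc1, hc2, hc3, hc4⟩ := exists_threshold d (j + s) a b hab.le
    fun n h1 h2 => by have := hm' n h1 h2; linarith
  obtain ⟨c', hc1', hc2', hc3', hc4'⟩ := exists_threshold d (j + 1 - s) c b hc2
    fun n h1 h2 => by have := hm' n (by omega) h2; linarith
  have k1 := sub_mul_le_of_range d l j s hl a c hs0.le
    (fun n h1 h2 => ⟨(h n h1 (by omega)).1, (hc3 n h1 h2).le⟩) (fun n h1 h2 => hm' n h1 (by omega))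
  have k2 := sub_mul_le_of_range d l (j + 1 - s) s hl c' b hs0.le
    (fun n h1 h2 => ⟨hc4' n h1 h2, by linarith [(h n (by omega) h2).2]⟩)
    (fun n h1 h2 => hm' n (by omega) (by omega))
  have k3 := norm_sum_ee_le_of_monotone f c c' j s hs0 (fun n h1 h2 => hc4 n h1 (by omega))
    (fun n h1 h2 => (hc3' n h1 h2).le) (fun n h1 h2 => by
      have := hm' n (by omega) (by omega)
      change d n ≤ d (n + 1); linarith)
  have l1 := norm_sum_ee_le_card f a c
  have l2 := norm_sum_ee_le_card f c' b
  rw [← Finset.sum_Ico_consecutive _ hc1 hc2, ← Finset.sum_Ico_consecutive _ hc1' hc2']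
  have e : s / l = 1 / s := by rw [← hss]; field_simp
  have e1 : (1 : ℝ) ≤ 1 / s := by rw [le_div_iff₀ hs0]; linarith
  have e5 : 5 / s = 5 * (1 / s) := by ring
  have n1 := norm_add_le (∑ n ∈ Finset.Ico a c, ee (f n)) (∑ n ∈ Finset.Ico c c', ee (f n) + ∑ n ∈ Finset.Ico c' b, ee (f n))
  have n2 := norm_add_le (∑ n ∈ Finset.Ico c c', ee (f n)) (∑ n ∈ Finset.Ico c' b, ee (f n))
  rw [e] at k1 k2
  rw [e5]
  linarith

/-- Discrete second difference test. -/
theorem norm_sum_ee_le_of_second_diff (f : ℕ → ℝ) (a : ℕ) (j : ℤ) (l : ℝ) (hl : 0 < l)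
    (hl4 : l ≤ 1 / 4) (k b : ℕ)
    (h : ∀ n, a ≤ n → n < b → j ≤ f (n + 1) - f n ∧ f (n + 1) - f n ≤ j + k)
    (hm : ∀ n, a ≤ n → n + 1 < b → f (n + 1) - f n + l ≤ f (n + 2) - f (n + 1)) :
    ‖∑ n ∈ Finset.Ico a b, ee (f n)‖ ≤ (k + 1) * (5 / √l) := by
  have hs0 : 0 < √l := Real.sqrt_pos.2 hl
  rcases le_or_gt b a with hba | hab
  · rw [Finset.Ico_eq_empty_of_le hba]; simp; positivity
  induction k generalizing b with
  | zero =>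
    have := norm_sum_ee_le_of_unit f a b j l hl hl4 (fun n h1 h2 => by
      have := h n h1 h2; push_cast at this; exact ⟨this.1, by linarith⟩) hm
    simpa using this
  | succ k ih =>
    obtain ⟨c, hc1, hc2, hc3, hc4⟩ := exists_threshold (fun n => f (n + 1) - f n) (j + k) a b hab.le
      fun n h1 h2 => by have := hm n h1 h2; linarith
    have i1 : ‖∑ n ∈ Finset.Ico a c, ee (f n)‖ ≤ (k + 1) * (5 / √l) := by
      rcases le_or_gt c a with hca | hac
      · rw [Finset.Ico_eq_empty_of_le hca]; simp; positivity
      · exact ih c (fun n h1 h2 => ⟨(h n h1 (by omega)).1, (hc3 n h1 h2).le⟩)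
          (fun n h1 h2 => hm n h1 (by omega)) hac
    have i2 := norm_sum_ee_le_of_unit f c b (j + k) l hl hl4 (fun n h1 h2 => by
      have := (h n (by omega) h2).2; push_cast at this ⊢; exact ⟨hc4 n h1 h2, by linarith⟩)
      (fun n h1 h2 => hm n (by omega) h2)
    rw [← Finset.sum_Ico_consecutive _ hc1 hc2]
    refine (norm_add_le _ _).trans ?_
    push_cast
    linarith

theorem norm_sum_ee_neg (f : ℕ → ℝ) (s : Finset ℕ) :
    ‖∑ n ∈ s, ee (-f n)‖ = ‖∑ n ∈ s, ee (f n)‖ := by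
  simp only [ee_neg]; rw [← map_sum, RCLike.norm_conj]

theorem nint_neg (x : ℝ) : nint (-x) = nint x := by
  have h : ∀ y : ℝ, nint (-y) ≤ nint y := fun y => by
    have := round_le (-y) (-round y)
    rw [nint, nint]
    refine this.trans (le_of_eq ?_)
    push_cast
    rw [← abs_neg]; congr 1; ring
  exact le_antisymm (h x) (by simpa using h (-x))

theorem nint_le_half (x : ℝ) : nint x ≤ 1 / 2 := abs_sub_round x

theorem nint_nonneg (x : ℝ) : 0 ≤ nint x := abs_nonneg _

/-- The majorant of an exponential sum of length about `M` whose derivative is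
close to `θ`, as a function of `t = ‖θ‖`. -/
noncomputable def statBound (κ M R t : ℝ) : ℝ :=
  2 / t + if t ≤ 2 * R then 30 * √(κ * M / t) else 0

/-- An exponential sum with linear phase `θ m` and a perturbation having increasing small
differences. -/
theorem norm_sum_ee_le_statBound_of_increasing (θ : ℝ) (g : ℕ → ℝ) (a b : ℕ) (κ M R l ρ : ℝ)
    (hκ : 0 ≤ κ) (hM : 0 ≤ M) (hl : 0 ≤ l) (hl4 : l ≤ 1 / 4) (hρ : ρ ≤ R) (hρ4 : ρ ≤ 1 / 4)
    (hρl : ρ ≤ κ * M * l)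
    (h : ∀ n, a ≤ n → n < b → |g (n + 1) - g n| ≤ ρ)
    (hm : ∀ n, a ≤ n → n + 1 < b → g (n + 1) - g n + l ≤ g (n + 2) - g (n + 1))
    (t : ℝ) (ht : 0 < t) (htθ : t ≤ nint θ) :
    ‖∑ n ∈ Finset.Ico a b, ee (θ * n + g n)‖ ≤ statBound κ M R t := by
  have hd : ∀ n : ℕ, θ * ((n + 1 : ℕ) : ℝ) + g (n + 1) - (θ * n + g n) = θ + (g (n + 1) - g n) := by
    intro n; push_cast; ring
  have hd2 : ∀ n : ℕ, θ * ((n + 2 : ℕ) : ℝ) + g (n + 2) - (θ * ((n + 1 : ℕ) : ℝ) + g (n + 1)) =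
      θ + (g (n + 2) - g (n + 1)) := by
    intro n; push_cast; ring
  have hhalf := nint_le_half θ
  have hif : 0 ≤ if t ≤ 2 * R then 30 * √(κ * M / t) else 0 := by split_ifs <;> positivity
  rw [statBound]
  set r := round θ with hr
  have hn : nint θ = |θ - r| := rfl
  by_cases hfar : 2 * ρ ≤ t
  · have : ‖∑ n ∈ Finset.Ico a b, ee (θ * n + g n)‖ ≤ 1 / (t / 2) := by
      rcases le_total 0 (θ - r) with hs | hs
      · rw [abs_of_nonneg hs] at hn
        apply norm_sum_ee_le_of_monotone (fun n => θ * n + g n) a b r (t / 2) (by positivity)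
        · intro n h1 h2
          have := abs_le.1 (h n h1 h2); simp only [hd]; linarith
        · intro n h1 h2
          have := abs_le.1 (h n h1 h2); simp only [hd]; linarith
        · intro n h1 h2
          have := hm n h1 h2; simp only [hd]; linarith
      · rw [abs_of_nonpos hs] at hn
        apply norm_sum_ee_le_of_monotone (fun n => θ * n + g n) a b (r - 1) (t / 2) (by positivity)
        · intro n h1 h2
          have := abs_le.1 (h n h1 h2); simp only [hd]; push_cast; linarith
        · intro n h1 h2
          have := abs_le.1 (h n h1 h2); simp only [hd]; push_cast; linarith
        · intro n h1 h2
          have := hm n h1 h2; simp only [hd]; linarith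
    have e : 1 / (t / 2) = 2 / t := by field_simp
    linarith
  · push Not at hfar
    have hρ0 : 0 < ρ := by linarith
    have hl0 : 0 < l := by
      rcases hl.lt_or_eq with h0 | h0
      · exact h0
      · rw [← h0] at hρl; linarith
    have h3 := norm_sum_ee_le_of_second_diff (fun n => θ * n + g n) a ⌊θ - ρ⌋ l hl0 hl4 2 b
      (fun n h1 h2 => by
        have := abs_le.1 (h n h1 h2)
        have f1 := Int.floor_le (θ - ρ)
        have f2 := Int.lt_floor_add_one (θ - ρ)
        simp only [hd]; push_cast; constructor <;> linarith)
      (fun n h1 h2 => by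
        have := hm n h1 h2; simp only [hd]; linarith)
    have h4 : 1 / √l ≤ 2 * √(κ * M / t) := by
      rw [← Real.sqrt_one, ← Real.sqrt_div zero_le_one]
      apply Real.sqrt_le_iff.2
      refine ⟨by positivity, ?_⟩
      rw [mul_pow, Real.sq_sqrt (by positivity), div_le_iff₀ hl0]
      rw [show (2 : ℝ) ^ 2 * (κ * M / t) * l = 4 * (κ * M * l) / t by ring, le_div_iff₀ ht]
      linarith
    rw [if_pos (by linarith)]
    have h5 : 0 < 2 / t := by positivity
    have e : ((2 : ℕ) + 1 : ℝ) * (5 / √l) = 15 * (1 / √l) := by push_cast; ring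
    rw [e] at h3
    linarith

theorem statBound_nonneg {κ M R t : ℝ} (ht : 0 ≤ t) : 0 ≤ statBound κ M R t := by
  rw [statBound]
  split_ifs <;> positivity

theorem statBound_anti {κ M R s t : ℝ} (hκ : 0 ≤ κ) (hM : 0 ≤ M) (hs : 0 < s) (hst : s ≤ t) :
    statBound κ M R t ≤ statBound κ M R s := by
  rw [statBound, statBound]
  gcongr ?_ + ?_
  · gcongr
  · split_ifs with h1 h2 h2
    · gcongr
    · exact absurd (hst.trans h1) h2
    · positivity
    · exact le_rfl

/-- The majorant `statBound` also controls perturbations of either sign. -/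
theorem norm_sum_ee_le_statBound (θ B : ℝ) (g : ℕ → ℝ) (a b : ℕ) (κ M R l ρ : ℝ)
    (hκ : 0 ≤ κ) (hM : 0 ≤ M) (hl : 0 ≤ l) (hl4 : |B| * l ≤ 1 / 4) (hρ : |B| * ρ ≤ R)
    (hρ4 : |B| * ρ ≤ 1 / 4) (hρl : ρ ≤ κ * M * l)
    (h : ∀ n, a ≤ n → n < b → |g (n + 1) - g n| ≤ ρ)
    (hm : ∀ n, a ≤ n → n + 1 < b → g (n + 1) - g n + l ≤ g (n + 2) - g (n + 1))
    (t : ℝ) (ht : 0 < t) (htθ : t ≤ nint θ) :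
    ‖∑ n ∈ Finset.Ico a b, ee (θ * n + B * g n)‖ ≤ statBound κ M R t := by
  have key : ∀ θ C : ℝ, |C| = |B| → 0 ≤ C → t ≤ nint θ →
      ‖∑ n ∈ Finset.Ico a b, ee (θ * n + C * g n)‖ ≤ statBound κ M R t := by
    intro θ C hC hC0 htθ
    rw [← hC, abs_of_nonneg hC0] at hl4 hρ hρ4
    apply norm_sum_ee_le_statBound_of_increasing θ (fun n => C * g n) a b κ M R (C * l) (C * ρ)
      hκ hM (by positivity) hl4 hρ hρ4 _ _ _ t ht htθ
    · nlinarith [mul_le_mul_of_nonneg_left hρl hC0]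
    · intro n h1 h2
      rw [← mul_sub, abs_mul, abs_of_nonneg hC0]
      exact mul_le_mul_of_nonneg_left (h n h1 h2) hC0
    · intro n h1 h2
      have := mul_le_mul_of_nonneg_left (hm n h1 h2) hC0
      linarith
  rcases le_total 0 B with hB | hB
  · exact key θ B rfl hB htθ
  · rw [← norm_sum_ee_neg]
    have := key (-θ) (-B) (abs_neg B) (by linarith) (by rwa [nint_neg])
    convert this using 5
    ring

open ComplexConjugate in
/-- The van der Corput–Weyl differencing inequality. -/
theorem norm_sum_sq_le_vanDerCorput (z : ℕ → ℂ) (hz : ∀ n, ‖z n‖ ≤ 1) (a b H : ℕ) (hH : 1 ≤ H) :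
    H * ‖∑ n ∈ Finset.Ico a b, z n‖ ^ 2 ≤ ((b - a : ℕ) + H) * ((b - a : ℕ) +
      2 * ∑ h ∈ Finset.Ico 1 H, ‖∑ n ∈ Finset.Ico a (b - h), z (n + h) * conj (z n)‖) := by
  rcases le_or_gt b a with hba | hab
  · rw [Finset.Ico_eq_empty_of_le hba]; simp; positivity
  set L := b - a with hL
  set S := ∑ n ∈ Finset.Ico a b, z n with hS
  set c : ℕ → ℝ := fun h => ‖∑ n ∈ Finset.Ico a (b - h), z (n + h) * conj (z n)‖ with hc
  set w : ℕ → ℂ := fun t => if H ≤ t ∧ t < H + L then z (a + t - H) else 0 with hw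
  have hw0 : ∀ j, j < H → ∑ t ∈ Finset.range (L + H), w (t + j) = S := by
    intro j hj
    rw [hS, hw, ← Finset.sum_filter]
    refine Finset.sum_bij (fun t _ => a + (t + j) - H) ?_ ?_ ?_ ?_
    · intro t ht; simp at ht ⊢; omega
    · intro t ht t' ht' h; simp at ht ht' h; omega
    · intro n hn; simp at hn ⊢; exact ⟨n - a + H - j, by omega, by omega⟩
    · intro t ht; rfl
  have hcorr : ∀ j h, j + h < H →
      ∑ t ∈ Finset.range (L + H), w (t + (j + h)) * conj (w (t + j)) =
        ∑ n ∈ Finset.Ico a (b - h), z (n + h) * conj (z n) := by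
    intro j h hj
    have e : ∀ t, w (t + (j + h)) * conj (w (t + j)) =
        if H ≤ t + j ∧ t + j + h < H + L then z (a + (t + j) - H + h) * conj (z (a + (t + j) - H))
        else 0 := by
      intro t
      simp only [hw]
      by_cases h1 : H ≤ t + j ∧ t + j + h < H + L
      · rw [if_pos h1, if_pos (by omega), if_pos (by omega)]
        congr 2; omega
      · rw [if_neg h1]
        by_cases h2 : H ≤ t + j ∧ t + j < H + L
        · rw [if_neg (by omega), zero_mul]
        · rw [if_neg h2, map_zero, mul_zero]
    simp only [e]
    rw [← Finset.sum_filter]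
    refine Finset.sum_bij (fun t _ => a + (t + j) - H) ?_ ?_ ?_ ?_
    · intro t ht; simp at ht ⊢; omega
    · intro t ht t' ht' h; simp at ht ht' h; omega
    · intro n hn; simp at hn ⊢; exact ⟨n - a + H - j, by omega, by omega⟩
    · intro t ht; rfl
  have hcorr' : ∀ j k, j < H → k < H →
      ‖∑ t ∈ Finset.range (L + H), w (t + j) * conj (w (t + k))‖ = c ((j - k) + (k - j)) := by
    intro j k hj hk
    rcases le_total k j with h | h
    · obtain ⟨i, rfl⟩ := Nat.exists_eq_add_of_le h
      rw [hcorr k i hj, hc]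
      simp only
      congr! 1
      rw [show k + i - k + (k - (k + i)) = i by omega]
    · obtain ⟨i, rfl⟩ := Nat.exists_eq_add_of_le h
      have : conj (∑ t ∈ Finset.range (L + H), w (t + (j + i)) * conj (w (t + j))) =
        ∑ t ∈ Finset.range (L + H), w (t + j) * conj (w (t + (j + i))) := by
        rw [map_sum]; refine Finset.sum_congr rfl fun t _ => ?_
        rw [map_mul, Complex.conj_conj, mul_comm]
      rw [← this, RCLike.norm_conj, hcorr j i hk, hc]
      simp only
      rw [show j - (j + i) + (j + i - j) = i by omega]
  have hHS : (H : ℂ) * S = ∑ t ∈ Finset.range (L + H), ∑ j ∈ Finset.range H, w (t + j) := by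
    rw [Finset.sum_comm, Finset.sum_congr rfl fun j hj => hw0 j (Finset.mem_range.1 hj)]
    simp
  have hc0 : c 0 ≤ L := by
    simp only [hc]
    refine (norm_sum_le _ _).trans ?_
    have : ∀ n ∈ Finset.Ico a (b - 0), ‖z (n + 0) * conj (z n)‖ ≤ 1 := fun n _ => by
      rw [norm_mul, RCLike.norm_conj]; exact mul_le_one₀ (hz _) (norm_nonneg _) (hz _)
    refine (Finset.sum_le_sum this).trans ?_
    simp [hL]
  have hcn : ∀ h, 0 ≤ c h := fun h => norm_nonneg _
  have hrow : ∀ j, j < H → ∑ k ∈ Finset.range H, c ((j - k) + (k - j)) ≤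
      L + 2 * ∑ h ∈ Finset.Ico 1 H, c h := by
    intro j hj
    rw [← Finset.sum_range_add_sum_Ico _ (show j + 1 ≤ H by omega)]
    have h1 : ∑ k ∈ Finset.range (j + 1), c ((j - k) + (k - j)) ≤ L + ∑ h ∈ Finset.Ico 1 H, c h := by
      have : ∑ k ∈ Finset.range (j + 1), c ((j - k) + (k - j)) = ∑ h ∈ Finset.range (j + 1), c h := by
        rw [← Finset.sum_range_reflect]
        refine Finset.sum_congr rfl fun k hk => ?_
        have := Finset.mem_range.1 hk
        congr 1; omega
      rw [this, Finset.sum_range_succ', add_comm]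
      refine add_le_add hc0 ?_
      rw [Finset.sum_Ico_eq_sum_range]
      refine (Finset.sum_le_sum_of_subset_of_nonneg (t := Finset.range (H - 1)) ?_ fun i _ _ => hcn _).trans_eq ?_
      · intro i hi; simp at hi ⊢; omega
      · refine Finset.sum_congr rfl fun k _ => ?_
        rw [add_comm]
    have h2 : ∑ k ∈ Finset.Ico (j + 1) H, c ((j - k) + (k - j)) ≤ ∑ h ∈ Finset.Ico 1 H, c h := by
      rw [Finset.sum_Ico_eq_sum_range, Finset.sum_Ico_eq_sum_range]
      refine le_trans (le_of_eq ?_) (Finset.sum_le_sum_of_subset_of_nonneg (s := Finset.range (H - (j + 1))) ?_ fun i _ _ => hcn _)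
      · refine Finset.sum_congr rfl fun k _ => ?_
        congr 1; omega
      · intro i hi; simp at hi ⊢; omega
    linarith
  have hcs : ‖(H : ℂ) * S‖ ^ 2 ≤ (L + H : ℕ) *
      ∑ t ∈ Finset.range (L + H), ‖∑ j ∈ Finset.range H, w (t + j)‖ ^ 2 := by
    rw [hHS]
    have h1 := norm_sum_le (Finset.range (L + H)) fun t => ∑ j ∈ Finset.range H, w (t + j)
    have h2 := sq_sum_le_card_mul_sum_sq (s := Finset.range (L + H))
      (f := fun t => ‖∑ j ∈ Finset.range H, w (t + j)‖)
    rw [Finset.card_range] at h2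
    exact (pow_le_pow_left₀ (norm_nonneg _) h1 2).trans h2
  have hexp : ∑ t ∈ Finset.range (L + H), ‖∑ j ∈ Finset.range H, w (t + j)‖ ^ 2 ≤
      H * (L + 2 * ∑ h ∈ Finset.Ico 1 H, c h) := by
    have e : ((∑ t ∈ Finset.range (L + H), ‖∑ j ∈ Finset.range H, w (t + j)‖ ^ 2 : ℝ) : ℂ) =
        ∑ j ∈ Finset.range H, ∑ k ∈ Finset.range H,
          ∑ t ∈ Finset.range (L + H), w (t + j) * conj (w (t + k)) := by
      push_cast
      simp only [← Complex.mul_conj', map_sum, Finset.sum_mul_sum]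
      rw [Finset.sum_comm]
      refine Finset.sum_congr rfl fun j _ => ?_
      rw [Finset.sum_comm]
    have h0 : 0 ≤ ∑ t ∈ Finset.range (L + H), ‖∑ j ∈ Finset.range H, w (t + j)‖ ^ 2 :=
      Finset.sum_nonneg fun _ _ => by positivity
    rw [← abs_of_nonneg h0, ← Real.norm_eq_abs, ← Complex.norm_real, e]
    refine (norm_sum_le _ _).trans ?_
    have : ∀ j ∈ Finset.range H, ‖∑ k ∈ Finset.range H,
          ∑ t ∈ Finset.range (L + H), w (t + j) * conj (w (t + k))‖ ≤
          L + 2 * ∑ h ∈ Finset.Ico 1 H, c h := by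
      intro j hj
      refine (norm_sum_le _ _).trans (le_trans (le_of_eq ?_) (hrow j (Finset.mem_range.1 hj)))
      exact Finset.sum_congr rfl fun k hk =>
        hcorr' j k (Finset.mem_range.1 hj) (Finset.mem_range.1 hk)
    refine (Finset.sum_le_sum this).trans ?_
    rw [Finset.sum_const, Finset.card_range, nsmul_eq_mul]
  rw [norm_mul, Complex.norm_natCast, mul_pow] at hcs
  have hH0 : (0 : ℝ) < H := by exact_mod_cast hH
  have := hcs.trans (mul_le_mul_of_nonneg_left hexp (by positivity))
  push_cast at this
  have h2 : (H : ℝ) * (H * ‖S‖ ^ 2) ≤ H * ((L + H) * (L + 2 * ∑ h ∈ Finset.Ico 1 H, c h)) := by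
    nlinarith
  exact le_of_mul_le_mul_left h2 hH0

theorem sub_two_div_le_nint (q : ℕ) (hq : 0 < q) (s : ℤ) (x η : ℝ) (hη : |η| ≤ 2)
    (hx : q * x = s + η) (j : ℝ) (h1 : j ≤ (s % q : ℤ)) (h2 : j ≤ q - (s % q : ℤ)) :
    (j - 2) / q ≤ nint x := by
  have hq' : (0 : ℝ) < q := by exact_mod_cast hq
  set m := round x
  have hd : (s : ℝ) = (s % q : ℤ) + q * (s / q : ℤ) := by exact_mod_cast (Int.emod_add_mul_ediv s q).symm
  have key : j ≤ |(s : ℝ) - q * m| := by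
    rcases le_or_gt m (s / q) with h | h
    · have h' : (m : ℝ) ≤ (s / q : ℤ) := by exact_mod_cast h
      refine le_trans ?_ (le_abs_self _)
      nlinarith [mul_le_mul_of_nonneg_left h' hq'.le]
    · have h' : ((s / q : ℤ) : ℝ) + 1 ≤ m := by exact_mod_cast h
      refine le_trans ?_ (neg_le_abs _)
      nlinarith [mul_le_mul_of_nonneg_left h' hq'.le]
  rw [div_le_iff₀ hq']
  have e : nint x * q = |(s : ℝ) - q * m + η| := by
    rw [nint, ← abs_of_pos hq', ← abs_mul, abs_of_pos hq']
    congr 1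
    linear_combination hx
  rw [e]
  have := abs_sub_abs_le_abs_sub ((s : ℝ) - q * m) (-η)
  rw [sub_neg_eq_add, abs_neg] at this
  linarith

theorem injOn_add_mul_emod (q : ℕ) (a u : ℤ) (hcop : IsCoprime a (q : ℤ)) :
    Set.InjOn (fun i : ℕ => ((u + i * a) % q).toNat) (Finset.range q : Set ℕ) := by
  intro i hi j hj hij
  simp only [Finset.coe_range, Set.mem_Iio] at hi hj
  have hq : (q : ℤ) ≠ 0 := by have : 0 < q := by omega
                              exact_mod_cast this.ne'
  have h1 : (u + i * a) % q = (u + j * a) % q := by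
    have a1 := Int.emod_nonneg (u + i * a) hq
    have a2 := Int.emod_nonneg (u + j * a) hq
    have hij' : ((u + i * a) % q).toNat = ((u + j * a) % q).toNat := hij
    omega
  have h2 : (q : ℤ) ∣ ((i : ℤ) - j) * a := by
    have := Int.ModEq.dvd (show (u + j * a) ≡ (u + i * a) [ZMOD q] from h1.symm)
    convert this using 1; ring
  have h3 : (q : ℤ) ∣ (i : ℤ) - j := hcop.symm.dvd_of_dvd_mul_right h2
  have h4 : |(i : ℤ) - j| < q := by rw [abs_lt]; constructor <;> omega
  have := Int.eq_zero_of_abs_lt_dvd h3 h4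
  omega

theorem sum_block_le (α : ℝ) (a : ℤ) (q : ℕ) (hq : 0 < q) (hcop : IsCoprime a (q : ℤ))
    (hα : |α - a / q| ≤ 1 / (q : ℝ) ^ 2) (v : ℕ → ℝ) (V : ℝ) (G : ℝ → ℝ) (hv : ∀ c, v c ≤ V)
    (hV : 0 ≤ V) (hG0 : ∀ t, 0 < t → 0 ≤ G t)
    (hvG : ∀ (c : ℕ) (t : ℝ), 0 < t → t ≤ nint (c * α) → v c ≤ G t) (c₀ : ℕ) :
    ∑ i ∈ Finset.range q, v (c₀ + i) ≤ 6 * V + 2 * ∑ x ∈ Finset.range q, G ((x + 1 : ℕ) / q) := by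
  have hq' : (0 : ℝ) < q := by exact_mod_cast hq
  set u := ⌊(q : ℝ) * c₀ * α⌋ with hu
  set f : ℕ → ℝ := fun x => if x ≤ 2 then V else G ((x - 2 : ℕ) / q) with hf
  have hf0 : ∀ x, 0 ≤ f x := by
    intro x
    simp only [hf]
    split_ifs with h
    · exact hV
    · apply hG0
      have : 0 < x - 2 := by omega
      have : (0 : ℝ) < (x - 2 : ℕ) := by exact_mod_cast this
      positivity
  set ρ : ℕ → ℕ := fun i => ((u + i * a) % q).toNat with hρ
  have hρlt : ∀ i, ρ i < q := by
    intro i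
    have h1 := Int.emod_lt_of_pos (u + i * a) (show (0 : ℤ) < q by exact_mod_cast hq)
    have h2 := Int.emod_nonneg (u + i * a) (show (q : ℤ) ≠ 0 by exact_mod_cast hq.ne')
    simp only [hρ]; omega
  have hpt : ∀ i ∈ Finset.range q, v (c₀ + i) ≤ f (ρ i) + f (q - ρ i) := by
    intro i hi
    have hi' : (i : ℝ) ≤ q := by exact_mod_cast (Finset.mem_range.1 hi).le
    by_cases h1 : ρ i ≤ 2
    · have : f (ρ i) = V := by simp [hf, h1]
      linarith [hv (c₀ + i), hf0 (q - ρ i)]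
    by_cases h2 : q - ρ i ≤ 2
    · have : f (q - ρ i) = V := by simp [hf, h2]
      linarith [hv (c₀ + i), hf0 (ρ i)]
    have hemod : (((u + i * a) % q : ℤ) : ℝ) = ρ i := by
      have h2 := Int.emod_nonneg (u + i * a) (show (q : ℤ) ≠ 0 by exact_mod_cast hq.ne')
      have : (((ρ i : ℕ) : ℤ) : ℝ) = (((u + i * a) % q : ℤ) : ℝ) := by
        rw [hρ]; simp only [Int.toNat_of_nonneg h2]
      rw [← this]; simp
    have hlow : ∀ j : ℕ, 2 < j → j ≤ ρ i → j ≤ q - ρ i → v (c₀ + i) ≤ G ((j - 2 : ℕ) / q) := by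
      intro j hj hj1 hj2
      have hj' : ((j - 2 : ℕ) : ℝ) = j - 2 := by rw [Nat.cast_sub hj.le]; simp
      apply hvG
      · have : 0 < j - 2 := by omega
        have : (0 : ℝ) < (j - 2 : ℕ) := by exact_mod_cast this
        positivity
      rw [hj']
      refine sub_two_div_le_nint q hq (u + i * a) _
        (Int.fract ((q : ℝ) * c₀ * α) + i * (q * (α - a / q))) ?_ ?_ j ?_ ?_
      · have b1 := Int.fract_nonneg ((q : ℝ) * c₀ * α)
        have b2 := Int.fract_lt_one ((q : ℝ) * c₀ * α)
        have b3 : |i * (q * (α - a / q))| ≤ 1 := by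
          rw [abs_mul, abs_mul, abs_of_pos hq', abs_of_nonneg (Nat.cast_nonneg i)]
          calc (i : ℝ) * (q * |α - a / q|) ≤ q * (q * (1 / (q : ℝ) ^ 2)) := by gcongr
            _ = 1 := by field_simp
        have b4 := abs_le.1 b3
        rw [abs_le]; constructor <;> linarith
      · have : (u : ℝ) = (q : ℝ) * c₀ * α - Int.fract ((q : ℝ) * c₀ * α) := by
          rw [Int.self_sub_fract]
        push_cast
        rw [this]
        field_simp
        ring
      · rw [hemod]; exact_mod_cast hj1
      · rw [hemod, ← Nat.cast_sub (hρlt i).le]; exact_mod_cast hj2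
    rcases le_total (ρ i) (q - ρ i) with h | h
    · have := hlow (ρ i) (by omega) le_rfl h
      have e : f (ρ i) = G ((ρ i - 2 : ℕ) / q) := by simp only [hf]; rw [if_neg h1]
      linarith [hf0 (q - ρ i)]
    · have := hlow (q - ρ i) (by omega) h le_rfl
      have e : f (q - ρ i) = G ((q - ρ i - 2 : ℕ) / q) := by simp only [hf]; rw [if_neg h2]
      linarith [hf0 (ρ i)]
  have hinj := injOn_add_mul_emod q a u hcop
  have htot : ∑ x ∈ Finset.range (q + 1), f x ≤ 3 * V + ∑ x ∈ Finset.range q, G ((x + 1 : ℕ) / q) := by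
    refine (Finset.sum_le_sum_of_subset_of_nonneg (t := Finset.range (q + 1 + 1 + 1))
      (Finset.range_mono (by omega)) fun i _ _ => hf0 i).trans_eq ?_
    rw [Finset.sum_range_succ', Finset.sum_range_succ', Finset.sum_range_succ']
    simp [hf]
    ring
  have h1 : ∀ F : ℕ → ℝ, (∀ x, 0 ≤ F x) →
      ∑ i ∈ Finset.range q, F (ρ i) ≤ ∑ x ∈ Finset.range q, F x := by
    intro F hF
    rw [← Finset.sum_image hinj]
    refine Finset.sum_le_sum_of_subset_of_nonneg ?_ fun i _ _ => hF i
    intro x hx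
    obtain ⟨i, _, rfl⟩ := Finset.mem_image.1 hx
    exact Finset.mem_range.2 (hρlt i)
  have h2 : ∑ x ∈ Finset.range q, f x ≤ ∑ x ∈ Finset.range (q + 1), f x := by
    rw [Finset.sum_range_succ]; linarith [hf0 q]
  have h3 : ∑ x ∈ Finset.range q, f (q - x) ≤ ∑ x ∈ Finset.range (q + 1), f x := by
    rw [← Finset.sum_range_reflect f (q + 1), Finset.sum_range_succ]
    simp only [add_tsub_cancel_right]
    linarith [hf0 (q - q)]
  refine (Finset.sum_le_sum hpt).trans ?_
  rw [Finset.sum_add_distrib]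
  linarith [h1 f hf0, h1 (fun x => f (q - x)) fun x => hf0 _]

theorem sum_Ico_le_of_sum_block_le (v : ℕ → ℝ) (hv : ∀ c, 0 ≤ v c) (q : ℕ) (hq : 0 < q) (B : ℝ)
    (hB : ∀ c₀, ∑ i ∈ Finset.range q, v (c₀ + i) ≤ B) (n : ℕ) :
    ∑ c ∈ Finset.range n, v c ≤ ((n : ℝ) / q + 1) * B := by
  have hB0 : 0 ≤ B := (Finset.sum_nonneg fun i _ => hv _).trans (hB 0)
  have h : ∀ k : ℕ, ∑ c ∈ Finset.range (k * q), v c ≤ k * B := by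
    intro k
    induction k with
    | zero => simp
    | succ k ih =>
      rw [add_mul, one_mul, Finset.sum_range_add]
      push_cast
      linarith [hB (k * q)]
  refine (Finset.sum_le_sum_of_subset_of_nonneg (t := Finset.range ((n / q + 1) * q)) ?_
    fun i _ _ => hv i).trans ((h _).trans ?_)
  · refine Finset.range_mono ?_
    have := Nat.lt_div_mul_add (a := n) hq
    nlinarith
  · have : ((n / q : ℕ) : ℝ) ≤ (n : ℝ) / q := Nat.cast_div_le
    push_cast
    gcongr

theorem sum_inv_succ_le (n : ℕ) :
    ∑ x ∈ Finset.range n, ((x + 1 : ℕ) : ℝ)⁻¹ ≤ 1 + Real.log n := by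
  have := harmonic_le_one_add_log n
  simpa [harmonic] using this

theorem sum_inv_sqrt_succ_le (n : ℕ) :
    ∑ x ∈ Finset.range n, (√((x + 1 : ℕ) : ℝ))⁻¹ ≤ 2 * √n := by
  induction n with
  | zero => simp
  | succ n ih =>
    rw [Finset.sum_range_succ]
    have h1 : √(n : ℝ) ^ 2 = n := Real.sq_sqrt (by positivity)
    have h2 : √((n + 1 : ℕ) : ℝ) ^ 2 = n + 1 := by rw [Real.sq_sqrt (by positivity)]; simp
    have h3 : 0 < √((n + 1 : ℕ) : ℝ) := Real.sqrt_pos.2 (by positivity)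
    have h4 := Real.sqrt_nonneg (n : ℝ)
    have h5 : (√((n + 1 : ℕ) : ℝ))⁻¹ ≤ 2 * √((n + 1 : ℕ) : ℝ) - 2 * √(n : ℝ) := by
      rw [inv_le_iff_one_le_mul₀ h3]
      nlinarith [sq_nonneg (√((n + 1 : ℕ) : ℝ) - √(n : ℝ))]
    linarith

theorem sum_statBound_le (κ M R : ℝ) (hκ : 0 ≤ κ) (hM : 0 ≤ M) (hR : 0 ≤ R) (q : ℕ) (hq : 0 < q) :
    ∑ x ∈ Finset.range q, statBound κ M R ((x + 1 : ℕ) / q) ≤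
      2 * q * (1 + Real.log q) + 90 * q * √(κ * M * R) := by
  have hq' : (0 : ℝ) < q := by exact_mod_cast hq
  have h1 : ∑ x ∈ Finset.range q, 2 / (((x + 1 : ℕ) : ℝ) / q) ≤ 2 * q * (1 + Real.log q) := by
    refine le_trans (le_of_eq ?_) (mul_le_mul_of_nonneg_left (sum_inv_succ_le q) (by positivity))
    rw [Finset.mul_sum]
    refine Finset.sum_congr rfl fun x _ => ?_
    field_simp
  set n := ⌊2 * R * q⌋₊
  have h2 : ∑ x ∈ Finset.range q, (if ((x + 1 : ℕ) : ℝ) / q ≤ 2 * R then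
      30 * √(κ * M / (((x + 1 : ℕ) : ℝ) / q)) else 0) ≤ 90 * q * √(κ * M * R) := by
    have e : ∀ x : ℕ, 30 * √(κ * M / (((x + 1 : ℕ) : ℝ) / q)) =
        30 * √(κ * M * q) * (√((x + 1 : ℕ) : ℝ))⁻¹ := by
      intro x
      rw [div_div_eq_mul_div, Real.sqrt_div' _ (by positivity)]
      ring
    rw [← Finset.sum_filter]
    have hsub : (Finset.range q).filter (fun x => ((x + 1 : ℕ) : ℝ) / q ≤ 2 * R) ⊆ Finset.range n := by
      intro x hx
      have := (Finset.mem_filter.1 hx).2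
      rw [div_le_iff₀ hq'] at this
      have := Nat.le_floor this
      exact Finset.mem_range.2 (by omega)
    refine (Finset.sum_le_sum_of_subset_of_nonneg hsub fun i _ _ => by positivity).trans ?_
    simp_rw [e]
    rw [← Finset.mul_sum]
    refine (mul_le_mul_of_nonneg_left (sum_inv_sqrt_succ_le n) (by positivity)).trans ?_
    have h3 : √(n : ℝ) ≤ √(2 * R * q) := Real.sqrt_le_sqrt (Nat.floor_le (by positivity))
    have h4 : √(κ * M * q) * √(2 * R * q) = √2 * q * √(κ * M * R) := by
      rw [← Real.sqrt_mul (by positivity), show κ * M * q * (2 * R * q) = (q : ℝ) ^ 2 * (2 * (κ * M * R)) by ring,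
        Real.sqrt_mul (by positivity), Real.sqrt_sq hq'.le, Real.sqrt_mul (by norm_num)]
      ring
    have h5 : √2 ≤ 3 / 2 := by rw [Real.sqrt_le_left (by norm_num)]; norm_num
    calc 30 * √(κ * M * q) * (2 * √(n : ℝ)) ≤ 60 * (√(κ * M * q) * √(2 * R * q)) := by
          nlinarith [mul_le_mul_of_nonneg_left h3 (Real.sqrt_nonneg (κ * M * q))]
      _ = 60 * √2 * (q * √(κ * M * R)) := by rw [h4]; ring
      _ ≤ 60 * (3 / 2) * (q * √(κ * M * R)) := by gcongr
      _ = _ := by ring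
  simp only [statBound]
  rw [Finset.sum_add_distrib]
  exact add_le_add h1 h2

/-- Majorant of an exponential sum of length at most `V` with linear frequency `x`. -/
noncomputable def cappedBound (V κ M R x : ℝ) : ℝ :=
  if nint x = 0 then V else min V (statBound κ M R (nint x))

theorem cappedBound_le {V κ M R x : ℝ} : cappedBound V κ M R x ≤ V := by
  rw [cappedBound]; split_ifs
  · exact le_rfl
  · exact min_le_left _ _

theorem cappedBound_nonneg {V κ M R x : ℝ} (hV : 0 ≤ V) : 0 ≤ cappedBound V κ M R x := by
  rw [cappedBound]; split_ifs
  · exact hV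
  · exact le_min hV (statBound_nonneg (nint_nonneg _))

theorem le_cappedBound {S V κ M R x : ℝ} (h1 : S ≤ V)
    (h2 : ∀ t, 0 < t → t ≤ nint x → S ≤ statBound κ M R t) : S ≤ cappedBound V κ M R x := by
  rw [cappedBound]; split_ifs with h
  · exact h1
  · exact le_min h1 (h2 _ (lt_of_le_of_ne (nint_nonneg _) (Ne.symm h)) le_rfl)

theorem cappedBound_le_statBound {V κ M R x t : ℝ} (hκ : 0 ≤ κ) (hM : 0 ≤ M) (ht : 0 < t)
    (htx : t ≤ nint x) : cappedBound V κ M R x ≤ statBound κ M R t := by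
  rw [cappedBound, if_neg (by linarith)]
  exact (min_le_right _ _).trans (statBound_anti hκ hM ht htx)

theorem statBound_mono {κ M R M' R' t : ℝ} (hκ : 0 ≤ κ) (hM : M ≤ M') (hR : R ≤ R') (ht : 0 ≤ t) :
    statBound κ M R t ≤ statBound κ M' R' t := by
  rw [statBound, statBound]
  refine add_le_add le_rfl ?_
  split_ifs with h1 h2 h2
  · gcongr
  · exact absurd (by linarith) h2
  · positivity
  · exact le_rfl

theorem sum_cappedBound_le (α : ℝ) (a : ℤ) (q : ℕ) (hq : 0 < q) (hcop : IsCoprime a (q : ℤ))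
    (hα : |α - a / q| ≤ 1 / (q : ℝ) ^ 2) (V κ M R : ℝ) (hV : 0 ≤ V) (hκ : 0 ≤ κ) (hM : 0 ≤ M)
    (hR : 0 ≤ R) (n : ℕ) :
    ∑ c ∈ Finset.range n, cappedBound V κ M R (c * α) ≤
      ((n : ℝ) / q + 1) * (6 * V + 4 * q * (1 + Real.log q) + 180 * q * √(κ * M * R)) := by
  refine sum_Ico_le_of_sum_block_le _ (fun c => cappedBound_nonneg hV) q hq _ (fun c₀ => ?_) n
  refine (sum_block_le α a q hq hcop hα (fun c => cappedBound V κ M R (c * α)) V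
    (statBound κ M R) (fun c => cappedBound_le) hV (fun t ht => statBound_nonneg ht.le)
    (fun c t h1 h2 => cappedBound_le_statBound hκ hM h1 h2) c₀).trans ?_
  linarith [sum_statBound_le κ M R hκ hM hR q hq]

theorem add_one_le_mul_rpow {ε : ℝ} (hε : 0 < ε) (p a : ℕ) (hp : 2 ≤ p) :
    (a + 1 : ℝ) ≤ (1 + 1 / (ε * Real.log 2)) * ((p : ℝ) ^ a) ^ ε := by
  have hl : 0 < Real.log 2 := Real.log_pos (by norm_num)
  have h1 : (1 : ℝ) + a * (ε * Real.log 2) ≤ ((p : ℝ) ^ a) ^ ε := by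
    have h2 : ((2 : ℝ) ^ a) ^ ε ≤ ((p : ℝ) ^ a) ^ ε := by
      have : (2 : ℝ) ≤ p := by exact_mod_cast hp
      gcongr
    refine le_trans ?_ h2
    rw [← Real.rpow_natCast, ← Real.rpow_mul (by norm_num), Real.rpow_def_of_pos (by norm_num)]
    have := Real.add_one_le_exp (Real.log 2 * (a * ε))
    linarith
  have hc : 0 < ε * Real.log 2 := by positivity
  calc (a + 1 : ℝ) ≤ (1 + 1 / (ε * Real.log 2)) * (1 + a * (ε * Real.log 2)) := by
        have : (1 + 1 / (ε * Real.log 2)) * (1 + a * (ε * Real.log 2)) =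
          1 + a + a * (ε * Real.log 2) + 1 / (ε * Real.log 2) := by field_simp; ring
        rw [this]
        have : 0 ≤ a * (ε * Real.log 2) := by positivity
        have : 0 ≤ 1 / (ε * Real.log 2) := by positivity
        linarith
    _ ≤ _ := by gcongr

/-- The divisor function grows more slowly than any positive power. -/
theorem exists_card_divisors_le {ε : ℝ} (hε : 0 < ε) :
    ∃ C : ℝ, 0 < C ∧ ∀ n : ℕ, n ≠ 0 → (n.divisors.card : ℝ) ≤ C * (n : ℝ) ^ ε := by
  have hl : 0 < Real.log 2 := Real.log_pos (by norm_num)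
  set D : ℝ := 1 + 1 / (ε * Real.log 2) with hD
  have hD1 : 1 ≤ D := by
    have : 0 ≤ 1 / (ε * Real.log 2) := by positivity
    linarith
  set P : ℕ := ⌈(2 : ℝ) ^ (1 / ε)⌉₊ with hP
  refine ⟨D ^ P, by positivity, fun n hn => ?_⟩
  have hn' : (n : ℝ) = ∏ p ∈ n.primeFactors, (p : ℝ) ^ n.factorization p := by
    conv_lhs => rw [← Nat.prod_factorization_pow_eq_self hn]
    rw [Finsupp.prod, Nat.support_factorization]; push_cast; rfl
  have h1 : ∀ p ∈ n.primeFactors, ((n.factorization p + 1 : ℕ) : ℝ) ≤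
      (if p < P then D else 1) * ((p : ℝ) ^ n.factorization p) ^ ε := by
    intro p hp
    have hp2 := (Nat.prime_of_mem_primeFactors hp).two_le
    push_cast
    split_ifs with h
    · exact add_one_le_mul_rpow hε p _ hp2
    · rw [one_mul]
      have h2 : (2 : ℝ) ^ (1 / ε) ≤ p := (Nat.le_ceil _).trans (by exact_mod_cast not_lt.1 h)
      have h3 : (2 : ℝ) ≤ (p : ℝ) ^ ε := by
        calc (2 : ℝ) = ((2 : ℝ) ^ (1 / ε)) ^ ε := by
              rw [← Real.rpow_mul (by norm_num), one_div_mul_cancel hε.ne', Real.rpow_one]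
          _ ≤ _ := by gcongr
      have h4 : ((p : ℝ) ^ n.factorization p) ^ ε = ((p : ℝ) ^ ε) ^ n.factorization p := by
        rw [← Real.rpow_natCast, ← Real.rpow_natCast, ← Real.rpow_mul (by positivity),
          ← Real.rpow_mul (by positivity), mul_comm]
      rw [h4]
      calc (n.factorization p + 1 : ℝ) ≤ 2 ^ n.factorization p := by
            exact_mod_cast Nat.succ_le_of_lt Nat.lt_two_pow_self
        _ ≤ _ := by gcongr
  rw [Nat.card_divisors hn]
  push_cast at h1 ⊢
  refine (Finset.prod_le_prod (fun _ _ => by positivity) h1).trans ?_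
  rw [Finset.prod_mul_distrib, Real.finsetProd_rpow _ _ (fun _ _ => by positivity), ← hn']
  gcongr
  rw [Finset.prod_ite, Finset.prod_const, Finset.prod_const_one, mul_one]
  refine pow_le_pow_right₀ hD1 ?_
  refine (Finset.card_le_card (t := Finset.range P) fun x hx => ?_).trans (Finset.card_range P).le
  exact Finset.mem_range.2 (Finset.mem_filter.1 hx).2

theorem exists_sub_eq_mul_deriv {f f' : ℝ → ℝ} (hf : ∀ y, 0 < y → HasDerivAt f (f' y) y)
    {x h : ℝ} (hx : 0 < x) (hh : 0 < h) :
    ∃ ξ, x < ξ ∧ ξ < x + h ∧ f (x + h) - f x = h * f' ξ := by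
  obtain ⟨ξ, hξ, e⟩ := exists_hasDerivAt_eq_slope f f' (show x < x + h by linarith)
    (fun y hy => (hf y (by linarith [hy.1])).continuousAt.continuousWithinAt)
    (fun y hy => hf y (by linarith [hy.1]))
  refine ⟨ξ, hξ.1, hξ.2, ?_⟩
  rw [e, add_sub_cancel_left, mul_div_cancel₀ _ hh.ne']

theorem hasDerivAt_const_mul_rpow (c p : ℝ) {y : ℝ} (hy : 0 < y) :
    HasDerivAt (fun x => c * x ^ p) (c * p * y ^ (p - 1)) y := by
  rw [mul_assoc]
  exact (Real.hasDerivAt_rpow_const (x := y) (p := p) (Or.inl hy.ne')).const_mul c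

theorem hasDerivAt_shift_sub {f f' : ℝ → ℝ} (hf : ∀ y, 0 < y → HasDerivAt f (f' y) y) {h : ℝ}
    (hh : 0 ≤ h) : ∀ y, 0 < y → HasDerivAt (fun x => f (x + h) - f x) (f' (y + h) - f' y) y := by
  intro y hy
  exact ((hf (y + h) (by linarith)).comp_add_const y h).sub (hf y hy)

section

variable {γ : ℝ}

theorem hasDerivAt_rpow_first {y : ℝ} (hy : 0 < y) :
    HasDerivAt (fun x : ℝ => x ^ γ) (γ * y ^ (γ - 1)) y :=
  Real.hasDerivAt_rpow_const (Or.inl hy.ne')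

theorem hasDerivAt_rpow_second {y : ℝ} (hy : 0 < y) :
    HasDerivAt (fun x : ℝ => γ * x ^ (γ - 1)) (γ * (γ - 1) * y ^ (γ - 2)) y := by
  have := hasDerivAt_const_mul_rpow γ (γ - 1) hy
  rwa [sub_sub, one_add_one_eq_two] at this

theorem hasDerivAt_rpow_third {y : ℝ} (hy : 0 < y) :
    HasDerivAt (fun x : ℝ => γ * (γ - 1) * x ^ (γ - 2)) (γ * (γ - 1) * (γ - 2) * y ^ (γ - 3)) y := by
  have := hasDerivAt_const_mul_rpow (γ * (γ - 1)) (γ - 2) hy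
  rwa [sub_sub, show (2 : ℝ) + 1 = 3 by norm_num] at this

theorem exists_rpow_diff {x h : ℝ} (hx : 0 < x) (hh : 0 < h) :
    ∃ ξ, x < ξ ∧ ξ < x + h ∧ (x + h) ^ γ - x ^ γ = h * (γ * ξ ^ (γ - 1)) :=
  exists_sub_eq_mul_deriv (fun _ => hasDerivAt_rpow_first) hx hh

theorem exists_rpow_diff_diff {x h k : ℝ} (hx : 0 < x) (hh : 0 < h) (hk : 0 < k) :
    ∃ ξ, x < ξ ∧ ξ < x + h + k ∧ ((x + k + h) ^ γ - (x + k) ^ γ) - ((x + h) ^ γ - x ^ γ) =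
      h * (k * (γ * (γ - 1) * ξ ^ (γ - 2))) := by
  obtain ⟨ξ, h1, h2, e⟩ := exists_sub_eq_mul_deriv
    (hasDerivAt_shift_sub (fun y => hasDerivAt_rpow_first (γ := γ) (y := y)) hh.le) hx hk
  obtain ⟨ζ, h3, h4, e'⟩ := exists_sub_eq_mul_deriv
    (fun y => hasDerivAt_rpow_second (γ := γ) (y := y)) (hx.trans h1) hh
  refine ⟨ζ, by linarith, by linarith, ?_⟩
  rw [e, e']; ring

theorem exists_rpow_diff_diff_diff {x h k l : ℝ} (hx : 0 < x) (hh : 0 < h) (hk : 0 < k)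
    (hl : 0 < l) :
    ∃ ξ, x < ξ ∧ ξ < x + h + k + l ∧
      (((x + l + k + h) ^ γ - (x + l + k) ^ γ) - ((x + l + h) ^ γ - (x + l) ^ γ)) -
      (((x + k + h) ^ γ - (x + k) ^ γ) - ((x + h) ^ γ - x ^ γ)) =
      h * (k * (l * (γ * (γ - 1) * (γ - 2) * ξ ^ (γ - 3)))) := by
  obtain ⟨ξ, h1, h2, e⟩ := exists_sub_eq_mul_deriv (hasDerivAt_shift_sub
    (hasDerivAt_shift_sub (fun y => hasDerivAt_rpow_first (γ := γ) (y := y)) hh.le) hk.le) hx hl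
  obtain ⟨ζ, h3, h4, e'⟩ := exists_sub_eq_mul_deriv
    (hasDerivAt_shift_sub (fun y => hasDerivAt_rpow_second (γ := γ) (y := y)) hh.le) (hx.trans h1) hk
  obtain ⟨η, h5, h6, e''⟩ := exists_sub_eq_mul_deriv
    (fun y => hasDerivAt_rpow_third (γ := γ) (y := y)) ((hx.trans h1).trans h3) hh
  refine ⟨η, by linarith, by linarith, ?_⟩
  rw [e, e', e'']; ring

theorem abs_rpow_diff_diff_le (hγ0 : 0 < γ) (hγ1 : γ < 1) {M x h : ℝ} (hM : 0 < M) (hx : M ≤ x)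
    (hh : 0 < h) : |((x + 1 + h) ^ γ - (x + 1) ^ γ) - ((x + h) ^ γ - x ^ γ)| ≤
      γ * (1 - γ) * (h * M ^ (γ - 2)) := by
  obtain ⟨ξ, h1, h2, e⟩ := exists_rpow_diff_diff (γ := γ) (hM.trans_le hx) hh one_pos
  rw [e]
  have h3 : ξ ^ (γ - 2) ≤ M ^ (γ - 2) :=
    Real.rpow_le_rpow_of_nonpos hM (by linarith) (by linarith)
  have h4 : 0 ≤ ξ ^ (γ - 2) := by
    have : 0 < ξ := by linarith
    positivity
  have h5 : 0 < γ * (1 - γ) := by apply mul_pos <;> linarith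
  rw [show h * (1 * (γ * (γ - 1) * ξ ^ (γ - 2))) = -(γ * (1 - γ) * (h * ξ ^ (γ - 2))) by ring, abs_neg,
    abs_of_nonneg (by positivity)]
  gcongr

theorem rpow_diff_diff_diff_ge (hγ0 : 0 < γ) (hγ1 : γ < 1) {x h X : ℝ} (hx : 0 < x)
    (hh : 0 < h) (hX : x + h + 2 ≤ X) :
    ((x + 1 + h) ^ γ - (x + 1) ^ γ) - ((x + h) ^ γ - x ^ γ) + γ * (1 - γ) * (h * X ^ (γ - 3)) ≤
      ((x + 2 + h) ^ γ - (x + 2) ^ γ) - ((x + 1 + h) ^ γ - (x + 1) ^ γ) := by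
  obtain ⟨ξ, h1, h2, e⟩ := exists_rpow_diff_diff_diff (γ := γ) hx hh one_pos one_pos
  rw [show x + 1 + 1 = x + 2 by ring] at e
  have h3 : X ^ (γ - 3) ≤ ξ ^ (γ - 3) :=
    Real.rpow_le_rpow_of_nonpos (by linarith) (by linarith) (by linarith)
  have h4 : 0 ≤ X ^ (γ - 3) := by
    have : 0 < X := by linarith
    positivity
  have h5 : 0 < γ * (1 - γ) := by apply mul_pos <;> linarith
  have h6 : γ * (1 - γ) * (h * X ^ (γ - 3)) ≤ h * (1 * (1 * (γ * (γ - 1) * (γ - 2) * ξ ^ (γ - 3)))) := by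
    calc γ * (1 - γ) * (h * X ^ (γ - 3)) ≤ γ * (1 - γ) * (h * ξ ^ (γ - 3)) := by gcongr
      _ ≤ γ * (1 - γ) * (h * ξ ^ (γ - 3)) * (2 - γ) := by
          refine le_mul_of_one_le_right ?_ (by linarith)
          have := h4.trans h3
          positivity
      _ = _ := by ring
  linarith

theorem conj_mul_ee_quadratic (τ B : ℝ) (n h : ℕ) :
    ee (τ * (n + h : ℕ) ^ 2 + B * ((n + h : ℕ) : ℝ) ^ γ) *
      (starRingEnd ℂ) (ee (τ * n ^ 2 + B * (n : ℝ) ^ γ)) =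
    ee (τ * h ^ 2) * ee (2 * τ * h * n + B * (((n : ℝ) + h) ^ γ - (n : ℝ) ^ γ)) := by
  rw [← ee_sub, ← ee_add]
  congr 1
  push_cast
  ring

/-- Weyl differencing for a quadratic polynomial perturbed by a fractional power. -/
theorem norm_sum_quadratic_sq_le (hγ0 : 0 < γ) (hγ1 : γ < 1) (τ B M R : ℝ) (a b H : ℕ)
    (hH : 1 ≤ H) (hHM : (H : ℝ) ≤ M) (ha : M ≤ a) (hb : (b : ℝ) ≤ 4 * M + 1)
    (hR : |B| * (H * M ^ (γ - 2)) ≤ R) (hR4 : R ≤ 1 / 4) :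
    ‖∑ n ∈ Finset.Ico a b, ee (τ * n ^ 2 + B * (n : ℝ) ^ γ)‖ ^ 2 ≤
      5 * M / H * (4 * M + 2 * ∑ h ∈ Finset.Ico 1 H, cappedBound (4 * M) 729 M R (2 * τ * h)) := by
  have hH' : (1 : ℝ) ≤ H := by exact_mod_cast hH
  have hM1 : 1 ≤ M := hH'.trans hHM
  have hM0 : 0 < M := by linarith
  have hL : ((b - a : ℕ) : ℝ) ≤ 4 * M := by
    rcases le_total b a with h | h
    · rw [Nat.sub_eq_zero_of_le h]; simp; linarith
    · rw [Nat.cast_sub h]; linarith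
  have hc0 : 0 < γ * (1 - γ) := by apply mul_pos <;> linarith
  have hc1 : γ * (1 - γ) ≤ 1 := by nlinarith [sq_nonneg γ]
  have hMp : 0 < M ^ (γ - 2) := by positivity
  have hcorr : ∀ h ∈ Finset.Ico 1 H, ‖∑ n ∈ Finset.Ico a (b - h),
      ee (τ * (n + h : ℕ) ^ 2 + B * ((n + h : ℕ) : ℝ) ^ γ) *
      (starRingEnd ℂ) (ee (τ * n ^ 2 + B * (n : ℝ) ^ γ))‖ ≤ cappedBound (4 * M) 729 M R (2 * τ * h) := by
    intro h hh
    obtain ⟨hh1, hhH⟩ := Finset.mem_Ico.1 hh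
    have hh0 : (0 : ℝ) < h := by exact_mod_cast hh1
    have hhH' : (h : ℝ) ≤ H := by exact_mod_cast hhH.le
    simp_rw [conj_mul_ee_quadratic]
    rw [← Finset.mul_sum, norm_mul, norm_ee, one_mul]
    refine le_cappedBound ?_ fun t ht htθ => ?_
    · refine (norm_sum_ee_le_card _ _ _).trans (le_trans ?_ hL)
      exact_mod_cast Nat.sub_le_sub_right (Nat.sub_le b h) a
    have hρR : |B| * (γ * (1 - γ) * (h * M ^ (γ - 2))) ≤ R := by
      refine le_trans (mul_le_mul_of_nonneg_left ?_ (abs_nonneg B)) hR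
      calc γ * (1 - γ) * (h * M ^ (γ - 2)) ≤ 1 * (H * M ^ (γ - 2)) := by gcongr
        _ = _ := one_mul _
    have h9 : (1 / 729) * M ^ (γ - 3) ≤ (9 * M) ^ (γ - 3) := by
      rw [Real.mul_rpow (by norm_num) hM0.le]
      have : (1 / 729 : ℝ) ≤ 9 ^ (γ - 3) := by
        calc (1 / 729 : ℝ) = 9 ^ (-3 : ℝ) := by
              rw [Real.rpow_neg (by norm_num)]; norm_num
          _ ≤ _ := Real.rpow_le_rpow_of_exponent_le (by norm_num) (by linarith)
      gcongr
    have hMM : M ^ (γ - 2) = M * M ^ (γ - 3) := by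
      rw [show γ - 2 = 1 + (γ - 3) by ring, Real.rpow_add hM0, Real.rpow_one]
    have hlρ : (9 * M) ^ (γ - 3) ≤ M ^ (γ - 2) := by
      calc (9 * M) ^ (γ - 3) ≤ M ^ (γ - 3) :=
            Real.rpow_le_rpow_of_nonpos hM0 (by linarith) (by linarith)
        _ ≤ M ^ (γ - 2) := Real.rpow_le_rpow_of_exponent_le hM1 (by linarith)
    refine norm_sum_ee_le_statBound (2 * τ * h) B (fun n => ((n : ℝ) + h) ^ γ - (n : ℝ) ^ γ) a (b - h)
      729 M R (γ * (1 - γ) * (h * (9 * M) ^ (γ - 3))) (γ * (1 - γ) * (h * M ^ (γ - 2)))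
      (by norm_num) hM0.le (by positivity) ?_ hρR (hρR.trans hR4) ?_ ?_ ?_ t ht htθ
    · refine le_trans (mul_le_mul_of_nonneg_left ?_ (abs_nonneg B)) (hρR.trans hR4)
      gcongr
    · rw [hMM]
      have : 0 ≤ γ * (1 - γ) * h * M := by positivity
      nlinarith [mul_le_mul_of_nonneg_left h9 this]
    · intro n hn _
      have hn' : (a : ℝ) ≤ n := by exact_mod_cast hn
      have := abs_rpow_diff_diff_le hγ0 hγ1 hM0 (ha.trans hn') hh0
      push_cast
      exact this
    · intro n hn hnb
      have hn' : (a : ℝ) ≤ n := by exact_mod_cast hn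
      have hnb' : (n : ℝ) + 2 + h ≤ b := by
        have : n + 2 + h ≤ b := by omega
        exact_mod_cast this
      have := rpow_diff_diff_diff_ge hγ0 hγ1 (hM0.trans_le (ha.trans hn')) hh0
        (show (n : ℝ) + h + 2 ≤ 9 * M by linarith)
      push_cast
      exact this
  have hvdc := norm_sum_sq_le_vanDerCorput (fun n => ee (τ * n ^ 2 + B * (n : ℝ) ^ γ))
    (fun n => (norm_ee _).le) a b H hH
  have hsum := Finset.sum_le_sum hcorr
  have hnn : 0 ≤ ∑ h ∈ Finset.Ico 1 H, cappedBound (4 * M) 729 M R (2 * τ * h) :=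
    Finset.sum_nonneg fun _ _ => cappedBound_nonneg (by linarith)
  rw [div_mul_eq_mul_div, le_div_iff₀ (by linarith), mul_comm]
  refine hvdc.trans ?_
  have h1 : ((b - a : ℕ) : ℝ) + H ≤ 5 * M := by linarith
  refine mul_le_mul h1 ?_ ?_ (by linarith)
  · exact add_le_add hL (mul_le_mul_of_nonneg_left hsum (by norm_num))
  · have : 0 ≤ ∑ h ∈ Finset.Ico 1 H, ‖∑ n ∈ Finset.Ico a (b - h),
      ee (τ * (n + h : ℕ) ^ 2 + B * ((n + h : ℕ) : ℝ) ^ γ) *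
      (starRingEnd ℂ) (ee (τ * n ^ 2 + B * (n : ℝ) ^ γ))‖ := Finset.sum_nonneg fun _ _ => norm_nonneg _
    positivity

end

/-- The second derivative test for a fractional power. -/
theorem norm_sum_rpow_le {γ : ℝ} (hγ0 : 0 < γ) (hγ1 : γ < 1) (B M : ℝ) (a b : ℕ) (hM : 1 ≤ M)
    (ha : M ≤ a) (hb : (b : ℝ) ≤ 4 * M + 1) (hB : B ≠ 0) (hP : |B| * M ^ γ ≤ M ^ 2 / 4) :
    ‖∑ n ∈ Finset.Ico a b, ee (B * (n : ℝ) ^ γ)‖ ≤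
      25 / √(γ * (1 - γ)) * (√(|B| * M ^ γ) + 2 * M / √(|B| * M ^ γ)) := by
  have hM0 : 0 < M := by linarith
  have hc0 : 0 < γ * (1 - γ) := by apply mul_pos <;> linarith
  have hc1 : γ * (1 - γ) ≤ 1 := by nlinarith [sq_nonneg γ]
  have hB0 : 0 < |B| := abs_pos.2 hB
  set P := |B| * M ^ γ with hPdef
  have hP0 : 0 < P := by positivity
  have e1 : |B| * M ^ (γ - 1) = P / M := by
    rw [Real.rpow_sub hM0, Real.rpow_one, hPdef]; ring
  have e2 : |B| * M ^ (γ - 2) = P / M ^ 2 := by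
    rw [Real.rpow_sub hM0, Real.rpow_two, hPdef]; ring
  set l := γ * (1 - γ) / 25 * (P / M ^ 2) with hl
  have hl0 : 0 < l := by positivity
  have h25 : 1 / 25 * M ^ (γ - 2) ≤ (5 * M) ^ (γ - 2) := by
    rw [Real.mul_rpow (by norm_num) hM0.le]
    have : (1 / 25 : ℝ) ≤ 5 ^ (γ - 2) := by
      calc (1 / 25 : ℝ) = 5 ^ (-2 : ℝ) := by
            rw [Real.rpow_neg (by norm_num)]; norm_num
        _ ≤ _ := Real.rpow_le_rpow_of_exponent_le (by norm_num) (by linarith)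
    gcongr
  set k := ⌈P / M⌉₊ with hk
  have habs : ‖∑ n ∈ Finset.Ico a b, ee (B * (n : ℝ) ^ γ)‖ =
      ‖∑ n ∈ Finset.Ico a b, ee (-|B| * (n : ℝ) ^ γ)‖ := by
    rcases le_total 0 B with h | h
    · rw [abs_of_nonneg h, ← norm_sum_ee_neg]
      simp only [neg_mul]
    · rw [abs_of_nonpos h, neg_neg]
  have hmain : ‖∑ n ∈ Finset.Ico a b, ee (-|B| * (n : ℝ) ^ γ)‖ ≤ (k + 1) * (5 / √l) := by
    refine norm_sum_ee_le_of_second_diff (fun n => -|B| * (n : ℝ) ^ γ) a (-(k : ℤ)) l hl0 ?_ k b ?_ ?_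
    · have : P / M ^ 2 ≤ 1 / 4 := by rw [div_le_iff₀ (by positivity)]; linarith
      have h2 : γ * (1 - γ) / 25 ≤ 1 := by linarith
      calc l ≤ 1 * (1 / 4) := by rw [hl]; gcongr
        _ = _ := by ring
    · intro n hn hnb
      have hn' : M ≤ n := ha.trans (by exact_mod_cast hn)
      obtain ⟨ξ, h1, h2, e⟩ := exists_rpow_diff (γ := γ) (hM0.trans_le hn') one_pos
      have h3 : ξ ^ (γ - 1) ≤ M ^ (γ - 1) :=
        Real.rpow_le_rpow_of_nonpos hM0 (by linarith) (by linarith)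
      have h4 : 0 ≤ ξ ^ (γ - 1) := by
        have : 0 < ξ := by linarith
        positivity
      have h5 : |B| * (γ * ξ ^ (γ - 1)) ≤ P / M := by
        rw [← e1]
        gcongr
        nlinarith
      have h6 : P / M ≤ k := Nat.le_ceil _
      have h7 : 0 ≤ |B| * (γ * ξ ^ (γ - 1)) := by positivity
      have e3 : -|B| * ((n + 1 : ℕ) : ℝ) ^ γ - -|B| * (n : ℝ) ^ γ = -(|B| * (γ * ξ ^ (γ - 1))) := by
        push_cast; linear_combination (-|B|) * e
      simp only [e3]
      push_cast
      constructor <;> linarith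
    · intro n hn hnb
      have hn' : M ≤ n := ha.trans (by exact_mod_cast hn)
      obtain ⟨ξ, h1, h2, e⟩ := exists_rpow_diff_diff (γ := γ) (hM0.trans_le hn') one_pos one_pos
      have hnb' : (n : ℝ) + 2 ≤ b := by
        have : n + 2 ≤ b := by omega
        exact_mod_cast this
      have h3 : (5 * M) ^ (γ - 2) ≤ ξ ^ (γ - 2) :=
        Real.rpow_le_rpow_of_nonpos (by linarith) (by linarith) (by linarith)
      have h4 := mul_le_mul_of_nonneg_left (h25.trans h3) (show 0 ≤ γ * (1 - γ) * |B| by positivity)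
      have e3 : l = γ * (1 - γ) * |B| * (1 / 25 * M ^ (γ - 2)) := by
        rw [hl, ← e2]; ring
      rw [← e3] at h4
      push_cast
      rw [show (n : ℝ) + 2 = n + 1 + 1 by ring]
      nlinarith [congrArg (fun t => |B| * t) e]
  rw [habs]
  refine hmain.trans ?_
  have hk1 : (k : ℝ) + 1 ≤ P / M + 2 := by
    have := Nat.ceil_lt_add_one (show 0 ≤ P / M by positivity)
    linarith
  have hsl : √l = √(γ * (1 - γ)) * √P / (5 * M) := by
    rw [hl, show γ * (1 - γ) / 25 * (P / M ^ 2) = (γ * (1 - γ)) * P / (5 * M) ^ 2 by ring,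
      Real.sqrt_div (by positivity), Real.sqrt_mul hc0.le, Real.sqrt_sq (by positivity)]
  have hs1 : 0 < √(γ * (1 - γ)) := Real.sqrt_pos.2 hc0
  have hs2 : 0 < √P := Real.sqrt_pos.2 hP0
  calc ((k : ℝ) + 1) * (5 / √l) ≤ (P / M + 2) * (5 / √l) := by gcongr
    _ = _ := by
      rw [hsl]
      field_simp
      rw [Real.sq_sqrt hP0.le]
      ring

/-- The correlation of `w` along multiples of `x` and `y` that lie in `(N, 4N]`. -/
noncomputable def corr (w : ℕ → ℂ) (N x y : ℕ) : ℝ :=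
  ‖∑ m ∈ (Finset.Ioc 0 (4 * N)).filter
    (fun m => (N < m * x ∧ m * x ≤ 4 * N) ∧ (N < m * y ∧ m * y ≤ 4 * N)),
    w (m * x) * (starRingEnd ℂ) (w (m * y))‖

theorem corr_nonneg (w : ℕ → ℂ) (N x y : ℕ) : 0 ≤ corr w N x y := norm_nonneg _

theorem corr_comm (w : ℕ → ℂ) (N x y : ℕ) : corr w N x y = corr w N y x := by
  rw [corr, corr, ← Complex.norm_conj, map_sum]
  congr 1
  refine Finset.sum_congr ?_ fun m _ => ?_
  · ext m; simp only [Finset.mem_filter]; tauto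
  · rw [map_mul, Complex.conj_conj, mul_comm]

theorem corr_add_eq (w : ℕ → ℂ) (N n q : ℕ) (hn : 0 < n) :
    corr w N (n + q) n = ‖∑ m ∈ Finset.Ioc (N / n) (4 * N / (n + q)),
      w (m * (n + q)) * (starRingEnd ℂ) (w (m * n))‖ := by
  rw [corr]
  congr 1
  refine Finset.sum_congr ?_ fun _ _ => rfl
  ext m
  simp only [Finset.mem_filter, Finset.mem_Ioc]
  rw [Nat.div_lt_iff_lt_mul hn, Nat.le_div_iff_mul_le (by omega)]
  constructor
  · rintro ⟨_, h1, h2⟩; exact ⟨h2.1, h1.2⟩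
  · rintro ⟨h1, h2⟩
    have hm : 0 < m := by
      rcases Nat.eq_zero_or_pos m with rfl | h
      · simp at h1
      · exact h
    have h3 : m * n ≤ m * (n + q) := Nat.mul_le_mul_left m (by omega)
    have h4 : m ≤ m * (n + q) := Nat.le_mul_of_pos_right m (by omega)
    refine ⟨⟨hm, by omega⟩, ⟨by omega, h2⟩, h1, by omega⟩

theorem corr_self_le (w : ℕ → ℂ) (hw : ∀ n, ‖w n‖ ≤ 1) (N n : ℕ) (hn : 0 < n) :
    corr w N n n ≤ 4 * N * (n : ℝ)⁻¹ := by
  have := corr_add_eq w N n 0 hn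
  rw [add_zero] at this
  rw [this]
  refine (norm_sum_le_of_le (f := fun m => w (m * n) * (starRingEnd ℂ) (w (m * n)))
    (n := fun _ => (1 : ℝ)) _ fun m _ => ?_).trans ?_
  · rw [norm_mul, Complex.norm_conj]
    exact mul_le_one₀ (hw _) (norm_nonneg _) (hw _)
  · rw [Finset.sum_const, Nat.card_Ioc, nsmul_eq_mul, mul_one]
    have h1 : ((4 * N / n - N / n : ℕ) : ℝ) ≤ ((4 * N / n : ℕ) : ℝ) := by
      exact_mod_cast Nat.sub_le _ _
    have h2 : ((4 * N / n : ℕ) : ℝ) ≤ ((4 * N : ℕ) : ℝ) / n := Nat.cast_div_le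
    push_cast at h2
    rw [← div_eq_mul_inv]
    linarith

theorem sum_inv_le_of_le (n : ℕ) (A : ℝ) (hA : 1 + Real.log n ≤ A) (s : Finset ℕ)
    (hs : ∀ i ∈ s, 1 ≤ i ∧ i ≤ n) : ∑ i ∈ s, (i : ℝ)⁻¹ ≤ A := by
  refine le_trans ?_ ((sum_inv_succ_le n).trans hA)
  rw [← Finset.sum_image (f := fun i : ℕ => (i : ℝ)⁻¹) (g := fun x => x + 1)
    (fun x _ y _ h => by simpa using h)]
  refine Finset.sum_le_sum_of_subset_of_nonneg ?_ fun i _ _ => by positivity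
  intro i hi
  obtain ⟨h1, h2⟩ := hs i hi
  exact Finset.mem_image.2 ⟨i - 1, Finset.mem_range.2 (by omega), by omega⟩

theorem sum_block_corr_le (w : ℕ → ℂ) (hw : ∀ n, ‖w n‖ ≤ 1) (N Q Y : ℕ) (A : ℝ) (hQ : 1 ≤ Q)
    (hY : 0 < Y) (hA : 1 + Real.log Y ≤ A) :
    ∑ x ∈ Finset.Ioc Q Y, ∑ y ∈ (Finset.Ioc Q Y).filter (fun y => y / Q = x / Q), corr w N x y ≤
      4 * N * A + 2 * ∑ n ∈ Finset.Ioc Q Y, ∑ q ∈ Finset.Ico 1 Q, corr w N (n + q) n := by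
  set I := Finset.Ioc Q Y
  set U := ∑ x ∈ I, ∑ y ∈ I, if y / Q = x / Q ∧ x < y then corr w N y x else 0 with hU
  have h1 : ∑ x ∈ I, ∑ y ∈ I.filter (fun y => y / Q = x / Q), corr w N x y =
      ∑ x ∈ I, corr w N x x + U + U := by
    have hU' : U = ∑ x ∈ I, ∑ y ∈ I, if y / Q = x / Q ∧ y < x then corr w N x y else 0 := by
      rw [hU, Finset.sum_comm]
      refine Finset.sum_congr rfl fun x _ => Finset.sum_congr rfl fun y _ => ?_
      simp only [eq_comm]
    nth_rewrite 2 [hU']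
    rw [hU, ← Finset.sum_add_distrib, ← Finset.sum_add_distrib]
    refine Finset.sum_congr rfl fun x hx => ?_
    have : corr w N x x = ∑ y ∈ I, if y = x then corr w N x y else 0 := by
      rw [Finset.sum_ite_eq' I x]; simp [hx]
    rw [this, ← Finset.sum_add_distrib, ← Finset.sum_add_distrib, Finset.sum_filter]
    refine Finset.sum_congr rfl fun y _ => ?_
    rcases lt_trichotomy x y with h | h | h
    · rw [if_neg h.ne', if_neg (c := y / Q = x / Q ∧ y < x) (by omega), corr_comm]
      simp [h]
    · subst h; simp
    · rw [if_neg h.ne, if_neg (c := y / Q = x / Q ∧ x < y) (by omega)]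
      simp [h]
  have h2 : ∑ x ∈ I, corr w N x x ≤ 4 * N * A := by
    calc ∑ x ∈ I, corr w N x x ≤ ∑ x ∈ I, 4 * N * (x : ℝ)⁻¹ :=
          Finset.sum_le_sum fun x hx => corr_self_le w hw N x (by
            have := Finset.mem_Ioc.1 hx; omega)
      _ = 4 * N * ∑ x ∈ I, (x : ℝ)⁻¹ := by rw [Finset.mul_sum]
      _ ≤ _ := by
          gcongr
          exact sum_inv_le_of_le Y A hA _ fun i hi => by
            have := Finset.mem_Ioc.1 hi; omega
  have h3 : U ≤ ∑ n ∈ I, ∑ q ∈ Finset.Ico 1 Q, corr w N (n + q) n := by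
    refine Finset.sum_le_sum fun x _ => ?_
    rw [← Finset.sum_filter]
    have e : ∑ q ∈ Finset.Ico 1 Q, corr w N (x + q) x =
        ∑ y ∈ Finset.Ico (x + 1) (x + Q), corr w N y x :=
      by rw [Finset.sum_Ico_add (fun y => corr w N y x)]; simp only [add_comm]
    rw [e]
    refine Finset.sum_le_sum_of_subset_of_nonneg ?_ fun _ _ _ => corr_nonneg _ _ _ _
    intro y hy
    obtain ⟨_, h, hxy⟩ := Finset.mem_filter.1 hy
    refine Finset.mem_Ico.2 ⟨hxy, ?_⟩
    have a1 := Nat.div_add_mod y Q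
    have a2 := Nat.div_add_mod x Q
    have a3 := Nat.mod_lt y (show 0 < Q by omega)
    rw [h] at a1
    omega
  linarith

/-- Bilinear sums whose outer variable lies below the square root of the range. -/
theorem norm_bilinear_half_le (w : ℕ → ℂ) (hw : ∀ n, ‖w n‖ ≤ 1) (N Q Y : ℕ) (A D : ℝ) (hQ : 1 ≤ Q)
    (hY : 0 < Y) (hA : 1 + Real.log Y ≤ A) (a b : ℕ → ℂ) (A₁ A₂ : ℝ) (hA₁ : 0 ≤ A₁) (hA₂ : 0 ≤ A₂)
    (ha : ∀ n ∈ Finset.Ioc Q Y, ‖a n‖ ≤ A₁) (hb : ∀ m ∈ Finset.Ioc 0 (4 * N), ‖b m‖ ≤ A₂)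
    (hD : ∑ n ∈ Finset.Ioc Q Y, ∑ q ∈ Finset.Ico 1 Q, corr w N (n + q) n ≤ D) :
    ‖∑ n ∈ Finset.Ioc Q Y, ∑ m ∈ Finset.Ioc (N / n) (4 * N / n), a n * b m * w (m * n)‖ ≤
      A₁ * A₂ * √((4 * N * A / Q) * (4 * N * A + 2 * D)) := by
  have hQ' : (0 : ℝ) < Q := by exact_mod_cast hQ
  set I := Finset.Ioc Q Y with hI
  set J := Finset.Icc 1 (Y / Q) with hJ
  have hmaps : ∀ n ∈ I, n / Q ∈ J := by
    intro n hn
    obtain ⟨h1, h2⟩ := Finset.mem_Ioc.1 hn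
    exact Finset.mem_Icc.2 ⟨(Nat.one_le_div_iff (by omega)).2 h1.le, Nat.div_le_div_right h2⟩
  set P := J.sigma fun j => Finset.Ioc 0 (4 * N / (j * Q)) with hP
  set F : ℕ → ℕ → Finset ℕ := fun j m =>
    (I.filter (fun n => n / Q = j)).filter (fun n => N < m * n ∧ m * n ≤ 4 * N) with hF
  set z : ℕ → ℕ → ℂ := fun j m => ∑ n ∈ F j m, a n * w (m * n) with hz
  have hmem : ∀ j ∈ J, ∀ n m, (n ∈ I.filter (fun n => n / Q = j) ∧
      m ∈ Finset.Ioc (N / n) (4 * N / n)) ↔ (n ∈ F j m ∧ m ∈ Finset.Ioc 0 (4 * N / (j * Q))) := by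
    intro j hj n m
    have hj1 := (Finset.mem_Icc.1 hj).1
    have hjQ : 0 < j * Q := Nat.mul_pos hj1 hQ
    simp only [hF, Finset.mem_filter, Finset.mem_Ioc, hI]
    constructor
    · rintro ⟨⟨⟨h1, h2⟩, h3⟩, h4, h5⟩
      have hn : 0 < n := by omega
      rw [Nat.div_lt_iff_lt_mul hn] at h4
      rw [Nat.le_div_iff_mul_le hn] at h5
      refine ⟨⟨⟨⟨h1, h2⟩, h3⟩, h4, h5⟩, ?_, ?_⟩
      · rcases Nat.eq_zero_or_pos m with rfl | h
        · simp at h4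
        · exact h
      · rw [Nat.le_div_iff_mul_le hjQ]
        have : j * Q ≤ n := by rw [← h3]; exact Nat.div_mul_le_self n Q
        exact (Nat.mul_le_mul_left m this).trans h5
    · rintro ⟨⟨⟨⟨h1, h2⟩, h3⟩, h4, h5⟩, h6, h7⟩
      have hn : 0 < n := by omega
      rw [Nat.div_lt_iff_lt_mul hn, Nat.le_div_iff_mul_le hn]
      exact ⟨⟨⟨h1, h2⟩, h3⟩, h4, h5⟩
  have hS : ∑ n ∈ I, ∑ m ∈ Finset.Ioc (N / n) (4 * N / n), a n * b m * w (m * n) =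
      ∑ p ∈ P, b p.2 * z p.1 p.2 := by
    rw [← Finset.sum_fiberwise_of_maps_to hmaps, hP, Finset.sum_sigma]
    refine Finset.sum_congr rfl fun j hj => ?_
    rw [Finset.sum_comm' (hmem j hj)]
    refine Finset.sum_congr rfl fun m _ => ?_
    rw [hz, Finset.mul_sum]
    exact Finset.sum_congr rfl fun n _ => by ring
  have hcard : (P.card : ℝ) ≤ 4 * N * A / Q := by
    rw [hP, Finset.card_sigma]
    push_cast
    calc ∑ j ∈ J, ((Finset.Ioc 0 (4 * N / (j * Q))).card : ℝ) ≤ ∑ j ∈ J, 4 * N / Q * (j : ℝ)⁻¹ := by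
          refine Finset.sum_le_sum fun j _ => ?_
          rw [Nat.card_Ioc, Nat.sub_zero]
          refine Nat.cast_div_le.trans (le_of_eq ?_)
          push_cast
          rw [← div_eq_mul_inv, div_div, mul_comm (Q : ℝ)]
      _ = 4 * N / Q * ∑ j ∈ J, (j : ℝ)⁻¹ := by rw [Finset.mul_sum]
      _ ≤ 4 * N / Q * A := by
          gcongr
          exact sum_inv_le_of_le Y A hA _ fun i hi => by
            have := Finset.mem_Icc.1 hi
            exact ⟨this.1, this.2.trans (Nat.div_le_self _ _)⟩
      _ = _ := by ring
  have hz2 : ∑ p ∈ P, ‖z p.1 p.2‖ ^ 2 ≤ A₁ ^ 2 * (4 * N * A + 2 * D) := by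
    have e : ((∑ p ∈ P, ‖z p.1 p.2‖ ^ 2 : ℝ) : ℂ) =
        ∑ j ∈ J, ∑ x ∈ I.filter (fun n => n / Q = j), ∑ y ∈ I.filter (fun n => n / Q = j),
          a x * (starRingEnd ℂ) (a y) * ∑ m ∈ (Finset.Ioc 0 (4 * N)).filter
            (fun m => (N < m * x ∧ m * x ≤ 4 * N) ∧ (N < m * y ∧ m * y ≤ 4 * N)),
            w (m * x) * (starRingEnd ℂ) (w (m * y)) := by
      push_cast
      rw [hP, Finset.sum_sigma]
      refine Finset.sum_congr rfl fun j hj => ?_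
      have hj1 := (Finset.mem_Icc.1 hj).1
      have hjQ : 0 < j * Q := Nat.mul_pos hj1 hQ
      have e1 : ∀ m, ((‖z j m‖ : ℂ)) ^ 2 = ∑ x ∈ I.filter (fun n => n / Q = j),
          ∑ y ∈ I.filter (fun n => n / Q = j),
          if (N < m * x ∧ m * x ≤ 4 * N) ∧ (N < m * y ∧ m * y ≤ 4 * N) then
            a x * (starRingEnd ℂ) (a y) * (w (m * x) * (starRingEnd ℂ) (w (m * y))) else 0 := by
        intro m
        rw [← Complex.mul_conj']
        simp only [hz, hF]
        rw [map_sum, Finset.sum_mul_sum, Finset.sum_filter]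
        refine Finset.sum_congr rfl fun x _ => ?_
        rw [Finset.sum_filter]
        by_cases hx : N < m * x ∧ m * x ≤ 4 * N
        · simp only [hx, true_and, and_self, if_true]
          refine Finset.sum_congr rfl fun y _ => ?_
          split_ifs
          · rw [map_mul]; ring
          · rfl
        · simp only [hx, false_and, if_false, Finset.sum_const_zero]
      simp only [e1]
      rw [Finset.sum_comm]
      refine Finset.sum_congr rfl fun x hx => ?_
      rw [Finset.sum_comm]
      refine Finset.sum_congr rfl fun y _ => ?_
      rw [Finset.mul_sum, Finset.sum_filter]
      refine Finset.sum_subset (Finset.Ioc_subset_Ioc_right (Nat.div_le_self _ _)) ?_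
      intro m hm hm'
      rw [if_neg]
      rintro ⟨h, _⟩
      have hxj := (Finset.mem_filter.1 hx).2
      obtain ⟨hxI, _⟩ := Finset.mem_Ioc.1 (Finset.mem_filter.1 hx).1
      refine hm' ((hmem j hj x m).1 ⟨hx, ?_⟩).2
      rw [Finset.mem_Ioc, Nat.div_lt_iff_lt_mul (by omega), Nat.le_div_iff_mul_le (by omega)]
      exact h
    have h0 : 0 ≤ ∑ p ∈ P, ‖z p.1 p.2‖ ^ 2 := Finset.sum_nonneg fun _ _ => by positivity
    rw [← abs_of_nonneg h0, ← Real.norm_eq_abs, ← Complex.norm_real, e]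
    have hb2 := sum_block_corr_le w hw N Q Y A hQ hY hA
    refine le_trans ?_ (mul_le_mul_of_nonneg_left (hb2.trans (add_le_add_right
      (mul_le_mul_of_nonneg_left hD zero_le_two) _)) (sq_nonneg A₁))
    refine (norm_sum_le_of_le _ (n := fun j => ∑ x ∈ I.filter (fun n => n / Q = j),
      A₁ ^ 2 * ∑ y ∈ I.filter (fun y => y / Q = x / Q), corr w N x y) fun j _ => ?_).trans ?_
    · refine norm_sum_le_of_le _ fun x hx => ?_
      obtain ⟨hxI, hxj⟩ := Finset.mem_filter.1 hx
      rw [hxj, Finset.mul_sum]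
      refine norm_sum_le_of_le _ fun y hy => ?_
      obtain ⟨hyI, _⟩ := Finset.mem_filter.1 hy
      rw [norm_mul, norm_mul, Complex.norm_conj, pow_two, corr]
      gcongr
      · exact ha x hxI
      · exact ha y hyI
    · rw [Finset.sum_fiberwise_of_maps_to hmaps, Finset.mul_sum]
  rw [hS]
  have h1 : ‖∑ p ∈ P, b p.2 * z p.1 p.2‖ ≤ A₂ * ∑ p ∈ P, ‖z p.1 p.2‖ := by
    rw [Finset.mul_sum]
    refine norm_sum_le_of_le _ fun p hp => ?_
    rw [norm_mul]
    gcongr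
    apply hb
    have := (Finset.mem_sigma.1 hp).2
    exact Finset.Ioc_subset_Ioc_right (Nat.div_le_self _ _) this
  have h2 : (∑ p ∈ P, ‖z p.1 p.2‖) ^ 2 ≤ (4 * N * A / Q) * (A₁ ^ 2 * (4 * N * A + 2 * D)) :=
    sq_sum_le_card_mul_sum_sq.trans (mul_le_mul hcard hz2
      (Finset.sum_nonneg fun _ _ => by positivity) ((Nat.cast_nonneg _).trans hcard))
  have h3 : ∑ p ∈ P, ‖z p.1 p.2‖ ≤ A₁ * √((4 * N * A / Q) * (4 * N * A + 2 * D)) := by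
    rw [← Real.sqrt_sq hA₁, ← Real.sqrt_mul (sq_nonneg A₁)]
    apply Real.le_sqrt_of_sq_le
    linarith
  calc _ ≤ _ := h1
    _ ≤ A₂ * (A₁ * √((4 * N * A / Q) * (4 * N * A + 2 * D))) := by gcongr
    _ = _ := by ring

theorem sum_mul_le_of_monotone (u : ℕ → ℝ) (z : ℕ → ℂ) (U T : ℝ) (b : ℕ) (hT : 0 ≤ T) (a : ℕ)
    (hu : ∀ e, a ≤ e → e + 1 < b → u e ≤ u (e + 1)) (hU : ∀ e, a ≤ e → e < b → u e ≤ U)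
    (hz : ∀ j, a ≤ j → ‖∑ e ∈ Finset.Ico j b, z e‖ ≤ T) (c : ℝ) (hc : a < b → c ≤ u a) (hcU : c ≤ U) :
    ‖∑ e ∈ Finset.Ico a b, ((u e - c : ℝ) : ℂ) * z e‖ ≤ (U - c) * T := by
  rcases le_or_gt b a with hab | hab
  · rw [Finset.Ico_eq_empty_of_le hab]; simp
    exact mul_nonneg (by linarith) hT
  induction hn : b - a generalizing a c with
  | zero => omega
  | succ n ih =>
    have e : ∑ e ∈ Finset.Ico a b, ((u e - c : ℝ) : ℂ) * z e =
        ((u a - c : ℝ) : ℂ) * ∑ e ∈ Finset.Ico a b, z e +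
        ∑ e ∈ Finset.Ico (a + 1) b, ((u e - u a : ℝ) : ℂ) * z e := by
      have : ∑ e ∈ Finset.Ico (a + 1) b, ((u e - u a : ℝ) : ℂ) * z e =
          ∑ e ∈ Finset.Ico a b, ((u e - u a : ℝ) : ℂ) * z e := by
        rw [Finset.sum_eq_sum_Ico_succ_bot hab]; simp
      rw [this, Finset.mul_sum, ← Finset.sum_add_distrib]
      refine Finset.sum_congr rfl fun e _ => ?_
      push_cast; ring
    have h1 : ‖((u a - c : ℝ) : ℂ) * ∑ e ∈ Finset.Ico a b, z e‖ ≤ (u a - c) * T := by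
      rw [norm_mul, Complex.norm_real, Real.norm_of_nonneg (by linarith [hc hab])]
      exact mul_le_mul_of_nonneg_left (hz a le_rfl) (by linarith [hc hab])
    have h2 : ‖∑ e ∈ Finset.Ico (a + 1) b, ((u e - u a : ℝ) : ℂ) * z e‖ ≤ (U - u a) * T := by
      rcases le_or_gt b (a + 1) with hab' | hab'
      · rw [Finset.Ico_eq_empty_of_le hab']; simp
        exact mul_nonneg (by linarith [hU a le_rfl hab]) hT
      · exact ih (a + 1) (fun e h => hu e (by omega)) (fun e h => hU e (by omega))
          (fun j h => hz j (by omega)) (u a) (fun _ => hu a le_rfl hab')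
          (hU a le_rfl hab) hab' (by omega)
    rw [e]
    refine (norm_add_le _ _).trans ?_
    linarith

theorem norm_sum_log_mul_le (z : ℕ → ℂ) (a b : ℕ) (A T : ℝ) (ha : 1 ≤ a) (hT : 0 ≤ T) (hA0 : 0 ≤ A)
    (hA : ∀ e, a ≤ e → e < b → Real.log e ≤ A)
    (hz : ∀ j, a ≤ j → ‖∑ e ∈ Finset.Ico j b, z e‖ ≤ T) :
    ‖∑ e ∈ Finset.Ico a b, (Real.log e : ℂ) * z e‖ ≤ A * T := by
  have := sum_mul_le_of_monotone (fun e => Real.log e) z A T b hT a (fun e h _ => by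
    apply Real.log_le_log
    · have : 0 < e := by omega
      exact_mod_cast this
    · push_cast; linarith) hA hz 0 (fun _ => Real.log_natCast_nonneg a) hA0
  simpa using this

/-- Bilinear sums over `N < m * e ≤ 4 * N` with both variables larger than `Q`. -/
theorem norm_bilinear_le (w : ℕ → ℂ) (hw : ∀ n, ‖w n‖ ≤ 1) (N Q Y : ℕ) (A D : ℝ) (hQ : 1 ≤ Q)
    (hQY : Q ≤ Y) (hYN : 4 * N ≤ Y ^ 2) (hY4 : Y ≤ 4 * N)
    (hA : 1 + Real.log Y ≤ A) (a b : ℕ → ℂ) (A₁ A₂ : ℝ) (hA₁ : 0 ≤ A₁) (hA₂ : 0 ≤ A₂)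
    (ha : ∀ n ∈ Finset.Ioc 0 (4 * N), ‖a n‖ ≤ A₁) (hb : ∀ m ∈ Finset.Ioc 0 (4 * N), ‖b m‖ ≤ A₂)
    (ha0 : ∀ n ≤ Q, a n = 0) (hb0 : ∀ m ≤ Q, b m = 0)
    (hD : ∑ n ∈ Finset.Ioc Q Y, ∑ q ∈ Finset.Ico 1 Q, corr w N (n + q) n ≤ D) :
    ‖∑ m ∈ Finset.Ioc 0 (4 * N), ∑ e ∈ Finset.Ioc (N / m) (4 * N / m), a m * b e * w (m * e)‖ ≤
      2 * (A₁ * A₂ * √((4 * N * A / Q) * (4 * N * A + 2 * D))) := by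
  have hYpos : 0 < Y := by omega
  have hIY : Finset.Ioc Q Y ⊆ Finset.Ioc 0 (4 * N) := Finset.Ioc_subset_Ioc (by omega) hY4
  have hsplit : ∑ m ∈ Finset.Ioc 0 (4 * N), ∑ e ∈ Finset.Ioc (N / m) (4 * N / m),
      a m * b e * w (m * e) =
      ∑ m ∈ Finset.Ioc Q Y, ∑ e ∈ Finset.Ioc (N / m) (4 * N / m), a m * b e * w (m * e) +
      ∑ m ∈ Finset.Ioc Y (4 * N), ∑ e ∈ Finset.Ioc (N / m) (4 * N / m), a m * b e * w (m * e) := by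
    rw [← Finset.sum_Ioc_consecutive _ (Nat.zero_le Y) hY4,
      ← Finset.sum_Ioc_consecutive _ (Nat.zero_le Q) hQY]
    rw [Finset.sum_eq_zero (s := Finset.Ioc 0 Q), zero_add]
    intro m hm
    rw [ha0 m (Finset.mem_Ioc.1 hm).2]; simp
  have hsecond : ∑ m ∈ Finset.Ioc Y (4 * N), ∑ e ∈ Finset.Ioc (N / m) (4 * N / m),
      a m * b e * w (m * e) =
      ∑ e ∈ Finset.Ioc Q Y, ∑ m ∈ Finset.Ioc (N / e) (4 * N / e),
        b e * (if Y < m then a m else 0) * w (m * e) := by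
    rw [Finset.sum_comm' (s' := fun e => (Finset.Ioc (N / e) (4 * N / e)).filter (fun m => Y < m))
      (t' := Finset.Ioc 0 (4 * N))]
    · rw [← Finset.sum_subset hIY]
      · refine Finset.sum_congr rfl fun e _ => ?_
        rw [Finset.sum_filter]
        refine Finset.sum_congr rfl fun m _ => ?_
        split_ifs
        · ring
        · simp
      · intro e he he'
        refine Finset.sum_eq_zero fun m hm => ?_
        obtain ⟨hm1, hm2⟩ := Finset.mem_filter.1 hm
        obtain ⟨_, hm3⟩ := Finset.mem_Ioc.1 hm1
        have he0 := (Finset.mem_Ioc.1 he).1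
        rw [Nat.le_div_iff_mul_le he0] at hm3
        have : e ≤ Q := by
          by_contra hcon
          have : Y < e := by
            by_contra h
            exact he' (Finset.mem_Ioc.2 ⟨by omega, by omega⟩)
          nlinarith
        rw [hb0 e this]; simp
    · intro m e
      simp only [Finset.mem_Ioc, Finset.mem_filter]
      constructor
      · rintro ⟨⟨h1, h2⟩, h3, h4⟩
        have hm : 0 < m := by omega
        rw [Nat.div_lt_iff_lt_mul hm] at h3
        rw [Nat.le_div_iff_mul_le hm] at h4
        have he : 0 < e := by
          rcases Nat.eq_zero_or_pos e with rfl | h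
          · simp at h3
          · exact h
        rw [Nat.div_lt_iff_lt_mul he, Nat.le_div_iff_mul_le he, mul_comm m e]
        refine ⟨⟨⟨h3, h4⟩, h1⟩, he, ?_⟩
        exact (Nat.le_mul_of_pos_right e hm).trans h4
      · rintro ⟨⟨⟨h3, h4⟩, h1⟩, he, h5⟩
        have hm : 0 < m := by omega
        rw [Nat.div_lt_iff_lt_mul he] at h3
        rw [Nat.le_div_iff_mul_le he] at h4
        rw [Nat.div_lt_iff_lt_mul hm, Nat.le_div_iff_mul_le hm, mul_comm e m]
        refine ⟨⟨h1, (Nat.le_mul_of_pos_right m he).trans h4⟩, h3, h4⟩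
  have h1 := norm_bilinear_half_le w hw N Q Y A D hQ hYpos hA a b A₁ A₂ hA₁ hA₂
    (fun n hn => ha n (hIY hn)) hb hD
  have h2 := norm_bilinear_half_le w hw N Q Y A D hQ hYpos hA b (fun m => if Y < m then a m else 0)
    A₂ A₁ hA₂ hA₁ (fun n hn => hb n (hIY hn)) (fun m hm => by
      split_ifs
      · exact ha m hm
      · simpa using hA₁) hD
  rw [hsplit, hsecond]
  refine (norm_add_le _ _).trans ?_
  have h1' : ∑ m ∈ Finset.Ioc Q Y, ∑ e ∈ Finset.Ioc (N / m) (4 * N / m), a m * b e * w (m * e) =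
      ∑ n ∈ Finset.Ioc Q Y, ∑ m ∈ Finset.Ioc (N / n) (4 * N / n), a n * b m * w (m * n) := by
    simp only [mul_comm]
  rw [h1', mul_comm A₂ A₁] at *
  linarith

theorem sum_arith_mul_eq (f g : ArithmeticFunction ℝ) (w : ℕ → ℂ) (N N' : ℕ) :
    ∑ n ∈ Finset.Ioc N N', ((f * g) n : ℂ) * w n =
      ∑ m ∈ Finset.Ioc 0 N', ∑ e ∈ Finset.Ioc (N / m) (N' / m), (f m : ℂ) * g e * w (m * e) := by
  simp only [ArithmeticFunction.mul_apply]
  push_cast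
  simp only [Finset.sum_mul]
  rw [Finset.sum_sigma', Finset.sum_sigma']
  refine Finset.sum_bij' (fun x _ => (⟨x.2.1, x.2.2⟩ : Σ _ : ℕ, ℕ))
    (fun x _ => (⟨x.1 * x.2, (x.1, x.2)⟩ : Σ _ : ℕ, ℕ × ℕ)) ?_ ?_ ?_ ?_ ?_
  · rintro ⟨n, x, y⟩ h
    simp only [Finset.mem_sigma, Finset.mem_Ioc, Nat.mem_divisorsAntidiagonal] at h ⊢
    obtain ⟨⟨h1, h2⟩, rfl, h4⟩ := h
    have hx : 0 < x := Nat.pos_of_ne_zero fun h => h4 (by simp [h])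
    have hy : 0 < y := Nat.pos_of_ne_zero fun h => h4 (by simp [h])
    rw [Nat.div_lt_iff_lt_mul hx, Nat.le_div_iff_mul_le hx, mul_comm y x]
    exact ⟨⟨hx, (Nat.le_mul_of_pos_right x hy).trans h2⟩, h1, h2⟩
  · rintro ⟨x, y⟩ h
    simp only [Finset.mem_sigma, Finset.mem_Ioc, Nat.mem_divisorsAntidiagonal] at h ⊢
    obtain ⟨⟨hx, h2⟩, h3, h4⟩ := h
    rw [Nat.div_lt_iff_lt_mul hx, mul_comm y x] at h3
    rw [Nat.le_div_iff_mul_le hx, mul_comm y x] at h4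
    exact ⟨⟨h3, h4⟩, trivial, by omega⟩
  · rintro ⟨n, x, y⟩ h
    simp only [Finset.mem_sigma, Finset.mem_Ioc, Nat.mem_divisorsAntidiagonal] at h
    obtain ⟨_, rfl, _⟩ := h
    rfl
  · rintro ⟨x, y⟩ _; rfl
  · rintro ⟨n, x, y⟩ h
    simp only [Finset.mem_sigma, Finset.mem_Ioc, Nat.mem_divisorsAntidiagonal] at h
    obtain ⟨_, rfl, _⟩ := h
    rfl

namespace ArithmeticFunction

/-- Restriction of an arithmetic function to arguments at most `Q`. -/
noncomputable def truncate (f : ArithmeticFunction ℝ) (Q : ℕ) : ArithmeticFunction ℝ :=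
  ⟨fun n => if n ≤ Q then f n else 0, by simp⟩

theorem truncate_apply (f : ArithmeticFunction ℝ) (Q n : ℕ) :
    f.truncate Q n = if n ≤ Q then f n else 0 := rfl

theorem vonMangoldt_eq_vaughan (Q : ℕ) :
    vonMangoldt = vonMangoldt.truncate Q + (moebius : ArithmeticFunction ℝ).truncate Q * log -
      ((moebius : ArithmeticFunction ℝ).truncate Q * vonMangoldt.truncate Q) * zeta +
      (((moebius : ArithmeticFunction ℝ) - (moebius : ArithmeticFunction ℝ).truncate Q) * zeta) *
        (vonMangoldt - vonMangoldt.truncate Q) := by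
  have h1 : vonMangoldt * (zeta : ArithmeticFunction ℝ) = log := vonMangoldt_mul_zeta
  have h2 : (moebius : ArithmeticFunction ℝ) * zeta = 1 := coe_moebius_mul_coe_zeta
  set μ : ArithmeticFunction ℝ := (moebius : ArithmeticFunction ℝ)
  set ζ : ArithmeticFunction ℝ := (zeta : ArithmeticFunction ℝ)
  rw [← h1]
  linear_combination (truncate vonMangoldt Q - vonMangoldt) * h2

theorem abs_truncate_le (f : ArithmeticFunction ℝ) (Q n : ℕ) : |f.truncate Q n| ≤ |f n| := by
  rw [truncate_apply]; split_ifs <;> simp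

theorem abs_moebius_cast_le_one (n : ℕ) : |(moebius : ArithmeticFunction ℝ) n| ≤ 1 := by
  rw [intCoe_apply]
  exact_mod_cast abs_moebius_le_one

theorem sub_truncate_apply (f : ArithmeticFunction ℝ) (Q n : ℕ) :
    (f - f.truncate Q) n = if n ≤ Q then 0 else f n := by
  have : (f - f.truncate Q) n = f n - f.truncate Q n := rfl
  rw [this, truncate_apply]; split_ifs <;> simp

theorem abs_sub_truncate_le (f : ArithmeticFunction ℝ) (Q n : ℕ) :
    |(f - f.truncate Q) n| ≤ |f n| := by
  rw [sub_truncate_apply]; split_ifs <;> simp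

theorem abs_truncate_mul_truncate_le (Q n : ℕ) :
    |((moebius : ArithmeticFunction ℝ).truncate Q * vonMangoldt.truncate Q) n| ≤ Real.log n := by
  rw [mul_apply]
  refine (Finset.abs_sum_le_sum_abs _ _).trans ?_
  rw [← vonMangoldt_sum, ← Nat.sum_divisorsAntidiagonal' (fun _ y => vonMangoldt y)]
  refine Finset.sum_le_sum fun x _ => ?_
  rw [abs_mul]
  calc _ ≤ 1 * |vonMangoldt x.2| := mul_le_mul
        ((abs_truncate_le _ _ _).trans (abs_moebius_cast_le_one _)) (abs_truncate_le _ _ _)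
        (abs_nonneg _) zero_le_one
    _ = _ := by rw [one_mul, abs_of_nonneg vonMangoldt_nonneg]

theorem truncate_mul_truncate_eq_zero (f g : ArithmeticFunction ℝ) (Q n : ℕ) (hn : Q ^ 2 < n) :
    (f.truncate Q * g.truncate Q) n = 0 := by
  rw [mul_apply]
  refine Finset.sum_eq_zero fun x hx => ?_
  obtain ⟨h1, _⟩ := Nat.mem_divisorsAntidiagonal.1 hx
  rw [truncate_apply, truncate_apply]
  by_cases h2 : x.1 ≤ Q
  · have : ¬ x.2 ≤ Q := by
      intro h3
      have := Nat.mul_le_mul h2 h3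
      rw [← pow_two] at this
      omega
    simp [this]
  · simp [h2]

theorem abs_sub_truncate_mul_zeta_le (Q n : ℕ) :
    |(((moebius : ArithmeticFunction ℝ) - (moebius : ArithmeticFunction ℝ).truncate Q) * zeta) n| ≤
      n.divisors.card := by
  rw [coe_mul_zeta_apply]
  refine (Finset.abs_sum_le_sum_abs _ _).trans ?_
  refine (Finset.sum_le_card_nsmul _ _ 1 fun i _ => (abs_sub_truncate_le _ _ _).trans
    (abs_moebius_cast_le_one i)).trans ?_
  simp

theorem sub_truncate_mul_zeta_eq_zero (f : ArithmeticFunction ℝ) (Q n : ℕ) (hn : n ≤ Q) :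
    ((f - f.truncate Q) * (zeta : ArithmeticFunction ℝ)) n = 0 := by
  rw [coe_mul_zeta_apply]
  refine Finset.sum_eq_zero fun i hi => ?_
  have := Nat.divisor_le hi
  rw [sub_truncate_apply, if_pos (by omega)]

end ArithmeticFunction

/-- Vaughan's identity as an upper bound for sums over primes. -/
theorem norm_sum_vonMangoldt_mul_le (w : ℕ → ℂ) (hw : ∀ n, ‖w n‖ ≤ 1) (N Q Y : ℕ) (A D : ℝ)
    (T : ℕ → ℝ) (hQ : 1 ≤ Q) (hQN : Q ^ 3 ≤ N) (hQY : Q ≤ Y) (hYN : 4 * N ≤ Y ^ 2)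
    (hY4 : Y ≤ 4 * N) (hA : 1 + Real.log (4 * N) ≤ A)
    (hd : ∀ n ∈ Finset.Ioc 0 (4 * N), (n.divisors.card : ℝ) ≤ A) (hT0 : ∀ m, 0 ≤ T m)
    (hT : ∀ m ∈ Finset.Icc 1 Q, ∀ a b, N / m < a → b ≤ 4 * N / m + 1 →
      ‖∑ e ∈ Finset.Ico a b, w (m * e)‖ ≤ T m)
    (hD : ∑ n ∈ Finset.Ioc Q Y, ∑ q ∈ Finset.Ico 1 Q, corr w N (n + q) n ≤ D) :
    ‖∑ n ∈ Finset.Ioc N (4 * N), (ArithmeticFunction.vonMangoldt n : ℂ) * w n‖ ≤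
      2 * A * ∑ m ∈ Finset.Icc 1 Q, T m + 16 * A ^ 3 * √(N / Q * (N + D)) := by
  have hQQ : Q ≤ Q ^ 2 := Nat.le_self_pow two_ne_zero Q
  have hQQN : Q ^ 2 ≤ N := (Nat.pow_le_pow_right hQ (by norm_num)).trans hQN
  have hN : 1 ≤ N := by omega
  have hN' : (1 : ℝ) ≤ N := by exact_mod_cast hN
  have hQ' : (1 : ℝ) ≤ Q := by exact_mod_cast hQ
  have hD0 : 0 ≤ D := le_trans (Finset.sum_nonneg fun _ _ => Finset.sum_nonneg fun _ _ =>
    corr_nonneg _ _ _ _) hD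
  have hlog0 : 0 ≤ Real.log (4 * N) := Real.log_nonneg (by linarith)
  have hA1 : 1 ≤ A := by linarith
  have hlog : ∀ n : ℕ, 1 ≤ n → n ≤ 4 * N → Real.log n ≤ A := by
    intro n h1 h2
    have : Real.log n ≤ Real.log (4 * N) := by
      apply Real.log_le_log
      · exact_mod_cast h1
      · exact_mod_cast h2
    linarith
  have hAY : 1 + Real.log Y ≤ A := by
    have : Real.log Y ≤ Real.log (4 * N) := by
      apply Real.log_le_log
      · exact_mod_cast hQ.trans hQY
      · exact_mod_cast hY4
    linarith
  have hIccIoc : Finset.Icc 1 Q = Finset.Ioc 0 Q := by ext; simp [Nat.succ_le_iff]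
  have hIocIco : ∀ m : ℕ, Finset.Ioc (N / m) (4 * N / m) = Finset.Ico (N / m + 1) (4 * N / m + 1) := by
    intro m; ext; simp only [Finset.mem_Ioc, Finset.mem_Ico]; omega
  have hQ4 : Q ≤ 4 * N := by omega
  set μ₁ := (ArithmeticFunction.moebius : ArithmeticFunction ℝ).truncate Q with hμ₁
  set L₁ := ArithmeticFunction.vonMangoldt.truncate Q with hL₁
  set c := μ₁ * L₁ with hc
  set f := ((ArithmeticFunction.moebius : ArithmeticFunction ℝ) - μ₁) *
    (ArithmeticFunction.zeta : ArithmeticFunction ℝ) with hf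
  set g := ArithmeticFunction.vonMangoldt - L₁ with hg
  set E := √((4 * N * A / Q) * (4 * N * A + 2 * D)) with hE
  have h0 : ∑ n ∈ Finset.Ioc N (4 * N), (L₁ n : ℂ) * w n = 0 := by
    refine Finset.sum_eq_zero fun n hn => ?_
    have := (Finset.mem_Ioc.1 hn).1
    rw [hL₁, ArithmeticFunction.truncate_apply, if_neg (by omega)]
    simp
  have h1 : ‖∑ n ∈ Finset.Ioc N (4 * N), ((μ₁ * ArithmeticFunction.log) n : ℂ) * w n‖ ≤
      A * ∑ m ∈ Finset.Icc 1 Q, T m := by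
    rw [sum_arith_mul_eq, ← Finset.sum_subset (Finset.Ioc_subset_Ioc_right hQ4), Finset.mul_sum,
      hIccIoc]
    · refine norm_sum_le_of_le _ fun m hm => ?_
      have hm' := Finset.mem_Ioc.1 hm
      simp only [mul_assoc]
      rw [← Finset.mul_sum, norm_mul, Complex.norm_real]
      have hb : ‖μ₁ m‖ ≤ 1 := (ArithmeticFunction.abs_truncate_le _ _ _).trans
        (ArithmeticFunction.abs_moebius_cast_le_one m)
      refine (mul_le_mul hb ?_ (norm_nonneg _) zero_le_one).trans_eq (one_mul _)
      rw [hIocIco]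
      refine norm_sum_log_mul_le (fun e => w (m * e)) _ _ A (T m) (Nat.le_add_left 1 _) (hT0 m) (by linarith)
        ?_ fun j hj => hT m (by rw [hIccIoc]; exact hm) j _ (Nat.lt_of_succ_le hj) le_rfl
      intro e he1 he2
      apply hlog e ((Nat.le_add_left 1 _).trans he1)
      have := Nat.div_le_self (4 * N) m
      omega
    · intro m _ hm
      have : μ₁ m = 0 := by
        rw [hμ₁, ArithmeticFunction.truncate_apply, if_neg]
        intro h
        apply hm
        simp_all
      simp [this]
  have hcabs : ∀ m ∈ Finset.Ioc 0 (4 * N), ‖(c m : ℂ)‖ ≤ A := by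
    intro m hm
    have hm' := Finset.mem_Ioc.1 hm
    rw [Complex.norm_real]
    exact (ArithmeticFunction.abs_truncate_mul_truncate_le Q m).trans (hlog m hm'.1 hm'.2)
  have h2 : ‖∑ n ∈ Finset.Ioc N (4 * N), ((c * (ArithmeticFunction.zeta : ArithmeticFunction ℝ)) n : ℂ)
      * w n‖ ≤ A * ∑ m ∈ Finset.Icc 1 Q, T m + 2 * (A * 1 * E) := by
    have hz : ∀ m e : ℕ, e ∈ Finset.Ioc (N / m) (4 * N / m) →
        ((ArithmeticFunction.zeta : ArithmeticFunction ℝ) e : ℂ) = 1 := by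
      intro m e he
      have := (Finset.mem_Ioc.1 he).1
      rw [ArithmeticFunction.natCoe_apply, ArithmeticFunction.zeta_apply_ne ((Nat.zero_le _).trans_lt this).ne']; simp
    rw [sum_arith_mul_eq, ← Finset.sum_Ioc_consecutive _ (Nat.zero_le Q) hQ4]
    refine (norm_add_le _ _).trans (add_le_add ?_ ?_)
    · rw [Finset.mul_sum, hIccIoc]
      refine norm_sum_le_of_le _ fun m hm => ?_
      have hm' := Finset.mem_Ioc.1 hm
      have : ∑ e ∈ Finset.Ioc (N / m) (4 * N / m),
          (c m : ℂ) * ((ArithmeticFunction.zeta : ArithmeticFunction ℝ) e : ℂ) * w (m * e) =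
          (c m : ℂ) * ∑ e ∈ Finset.Ico (N / m + 1) (4 * N / m + 1), w (m * e) := by
        rw [Finset.mul_sum, ← hIocIco]
        exact Finset.sum_congr rfl fun e he => by rw [hz m e he, mul_one]
      rw [this, norm_mul]
      exact mul_le_mul (hcabs m (Finset.mem_Ioc.2 ⟨hm'.1, by omega⟩))
        (hT m (by rw [hIccIoc]; exact hm) _ _ (Nat.lt_succ_self _) le_rfl) (norm_nonneg _) (by linarith)
    · have hB := norm_bilinear_le w hw N Q Y A D hQ hQY hYN hY4 hAY
        (fun m => if m ≤ Q then 0 else (c m : ℂ)) (fun e => if e ≤ Q then 0 else 1) A 1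
        (by linarith) zero_le_one ?_ ?_ ?_ ?_ hD
      · refine le_trans (le_of_eq ?_) hB
        congr 1
        rw [← Finset.sum_Ioc_consecutive _ (Nat.zero_le Q) hQ4,
          Finset.sum_eq_zero (s := Finset.Ioc 0 Q), zero_add]
        · refine Finset.sum_congr rfl fun m hm => ?_
          have hm' := Finset.mem_Ioc.1 hm
          refine Finset.sum_congr rfl fun e he => ?_
          rw [hz m e he, if_neg (by omega)]
          by_cases hmQ : Q ^ 2 < m
          · have : c m = 0 := ArithmeticFunction.truncate_mul_truncate_eq_zero _ _ Q m hmQ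
            simp [this]
          · have he1 := (Finset.mem_Ioc.1 he).1
            have : Q ≤ N / m := by
              rw [Nat.le_div_iff_mul_le (by omega)]
              calc Q * m ≤ Q * Q ^ 2 := Nat.mul_le_mul_left Q (by omega)
                _ = Q ^ 3 := by ring
                _ ≤ N := hQN
            rw [if_neg (by omega)]
        · intro m hm
          rw [if_pos (Finset.mem_Ioc.1 hm).2]; simp
      · intro m hm
        split_ifs
        · simp; linarith
        · exact hcabs m hm
      · intro e _
        split_ifs <;> simp
      · intro m hm; rw [if_pos hm]
      · intro m hm; rw [if_pos hm]
  have h3 : ‖∑ n ∈ Finset.Ioc N (4 * N), ((f * g) n : ℂ) * w n‖ ≤ 2 * (A * A * E) := by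
    rw [sum_arith_mul_eq]
    refine norm_bilinear_le w hw N Q Y A D hQ hQY hYN hY4 hAY (fun m => (f m : ℂ)) (fun e => (g e : ℂ))
      A A (by linarith) (by linarith) ?_ ?_ ?_ ?_ hD
    · intro m hm
      rw [Complex.norm_real]
      exact (ArithmeticFunction.abs_sub_truncate_mul_zeta_le Q m).trans (hd m hm)
    · intro e he
      have he' := Finset.mem_Ioc.1 he
      rw [Complex.norm_real]
      refine (ArithmeticFunction.abs_sub_truncate_le _ Q e).trans ?_
      rw [abs_of_nonneg ArithmeticFunction.vonMangoldt_nonneg]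
      exact ArithmeticFunction.vonMangoldt_le_log.trans (hlog e he'.1 he'.2)
    · intro m hm
      rw [hf, hμ₁, ArithmeticFunction.sub_truncate_mul_zeta_eq_zero _ Q m hm]; simp
    · intro e he
      rw [hg, hL₁, ArithmeticFunction.sub_truncate_apply, if_pos he]; simp
  have hdecomp : ∑ n ∈ Finset.Ioc N (4 * N), (ArithmeticFunction.vonMangoldt n : ℂ) * w n =
      ∑ n ∈ Finset.Ioc N (4 * N), (L₁ n : ℂ) * w n +
      ∑ n ∈ Finset.Ioc N (4 * N), ((μ₁ * ArithmeticFunction.log) n : ℂ) * w n -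
      ∑ n ∈ Finset.Ioc N (4 * N), ((c * (ArithmeticFunction.zeta : ArithmeticFunction ℝ)) n : ℂ) * w n +
      ∑ n ∈ Finset.Ioc N (4 * N), ((f * g) n : ℂ) * w n := by
    rw [← Finset.sum_add_distrib, ← Finset.sum_sub_distrib, ← Finset.sum_add_distrib]
    refine Finset.sum_congr rfl fun n _ => ?_
    have := congrArg (fun F : ArithmeticFunction ℝ => F n) (ArithmeticFunction.vonMangoldt_eq_vaughan Q)
    have e : ArithmeticFunction.vonMangoldt n = L₁ n + (μ₁ * ArithmeticFunction.log) n -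
      (c * (ArithmeticFunction.zeta : ArithmeticFunction ℝ)) n + (f * g) n := this
    rw [e]; push_cast; ring
  have hEle : E ≤ 4 * A * √(N / Q * (N + D)) := by
    rw [hE]
    apply Real.sqrt_le_iff.2
    refine ⟨by positivity, ?_⟩
    rw [mul_pow, Real.sq_sqrt (by positivity)]
    have h1 : 4 * N * A + 2 * D ≤ 4 * A * (N + D) := by nlinarith
    calc (4 * N * A / Q) * (4 * N * A + 2 * D) ≤ (4 * N * A / Q) * (4 * A * (N + D)) := by gcongr
      _ = _ := by ring
  rw [hdecomp, h0, zero_add]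
  refine (norm_add_le _ _).trans ((add_le_add_left (norm_sub_le _ _) _).trans ?_)
  have hE0 : 0 ≤ E := Real.sqrt_nonneg _
  have h5 : 2 * (A * 1 * E) + 2 * (A * A * E) ≤ 16 * A ^ 3 * √(N / Q * (N + D)) := by
    calc 2 * (A * 1 * E) + 2 * (A * A * E) ≤ 4 * A ^ 2 * E := by
          nlinarith [mul_le_mul_of_nonneg_right hA1 (mul_nonneg (by linarith : (0:ℝ) ≤ A) hE0)]
      _ ≤ 4 * A ^ 2 * (4 * A * √(N / Q * (N + D))) := by gcongr
      _ = _ := by ring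
  linarith

theorem cappedBound_mono {V κ M R V' M' R' x : ℝ} (hκ : 0 ≤ κ) (hV : V ≤ V') (hM : M ≤ M')
    (hR : R ≤ R') : cappedBound V κ M R x ≤ cappedBound V' κ M' R' x := by
  rw [cappedBound, cappedBound]
  split_ifs
  · exact hV
  · exact min_le_min hV (statBound_mono hκ hM hR (nint_nonneg _))

/-- A sum over tuples is bounded by a sum over an integer value that determines the tuple together
with three of its divisors. -/
theorem sum_comp_le_of_dvd {ι : Type*} (P : Finset ι) (c : ι → ℕ) (t : ι → ℕ × ℕ × ℕ) (F : ℕ → ℝ)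
    (hF : ∀ j, 0 ≤ F j) (n : ℕ) (A : ℝ) (hA : 0 ≤ A)
    (hd : ∀ j, 0 < j → j < n → (j.divisors.card : ℝ) ≤ A)
    (hc : ∀ p ∈ P, 0 < c p ∧ c p < n)
    (ht : ∀ p ∈ P, (t p).1 ∣ c p ∧ (t p).2.1 ∣ c p ∧ (t p).2.2 ∣ c p)
    (hinj : ∀ p ∈ P, ∀ p' ∈ P, c p = c p' → t p = t p' → p = p') :
    ∑ p ∈ P, F (c p) ≤ A ^ 3 * ∑ j ∈ Finset.range n, F j := by
  rw [← Finset.sum_fiberwise_of_maps_to (s := P) (t := Finset.range n) (g := c)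
    (fun p hp => Finset.mem_range.2 (hc p hp).2), Finset.mul_sum]
  refine Finset.sum_le_sum fun j hj => ?_
  rw [Finset.sum_congr rfl (g := fun _ => F j)
    (fun p hp => by rw [(Finset.mem_filter.1 hp).2]), Finset.sum_const, nsmul_eq_mul]
  rcases (P.filter fun p => c p = j).eq_empty_or_nonempty with h | ⟨p₀, hp₀⟩
  · rw [h]
    simp only [Finset.card_empty, Nat.cast_zero, zero_mul]
    exact mul_nonneg (by positivity) (hF _)
  · obtain ⟨hp, rfl⟩ := Finset.mem_filter.1 hp₀
    refine mul_le_mul_of_nonneg_right ?_ (hF _)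
    have h0 := (hc p₀ hp).1
    have hcard : (P.filter fun p => c p = c p₀).card ≤
        ((c p₀).divisors ×ˢ (c p₀).divisors ×ˢ (c p₀).divisors).card := by
      refine Finset.card_le_card_of_injOn t (fun p hp' => ?_) fun p hp' p' hp'' h => ?_
      · obtain ⟨h1, h2⟩ := Finset.mem_filter.1 hp'
        have := ht p h1
        rw [h2] at this
        simp [this, h0.ne']
      · obtain ⟨h1, h2⟩ := Finset.mem_filter.1 hp'
        obtain ⟨h3, h4⟩ := Finset.mem_filter.1 hp''
        exact hinj p h1 p' h3 (h2.trans h4.symm) h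
    rw [Finset.card_product, Finset.card_product] at hcard
    calc ((P.filter fun p => c p = c p₀).card : ℝ) ≤
        ((c p₀).divisors.card : ℝ) * ((c p₀).divisors.card * (c p₀).divisors.card) := by
          exact_mod_cast hcard
      _ = ((c p₀).divisors.card : ℝ) ^ 3 := by ring
      _ ≤ A ^ 3 := by gcongr; exact hd _ h0 (hc p₀ hp).2

/-- The phase `e(τ n² + l n^γ)`. -/
noncomputable def phase (γ τ l : ℝ) (n : ℕ) : ℂ := ee (τ * n ^ 2 + l * (n : ℝ) ^ γ)

theorem norm_phase (γ τ l : ℝ) (n : ℕ) : ‖phase γ τ l n‖ = 1 := norm_ee _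

theorem phase_mul (γ τ l : ℝ) (m e : ℕ) :
    phase γ τ l (m * e) = ee (τ * m ^ 2 * e ^ 2 + l * (m : ℝ) ^ γ * (e : ℝ) ^ γ) := by
  rw [phase]
  push_cast
  rw [Real.mul_rpow (by positivity) (by positivity)]
  congr 1
  ring

theorem div_lt_cast_of_div_lt {N m a : ℕ} (hm : 0 < m) (h : N / m < a) : (N : ℝ) / m ≤ a := by
  have hm' : (0 : ℝ) < m := by exact_mod_cast hm
  rw [div_le_iff₀ hm']
  have := (Nat.div_lt_iff_lt_mul hm).1 h
  exact_mod_cast this.le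

theorem cast_le_of_le_div {N m b : ℕ} (h : b ≤ 4 * N / m + 1) : (b : ℝ) ≤ 4 * (N / m) + 1 := by
  have h1 : ((4 * N / m : ℕ) : ℝ) ≤ ((4 * N : ℕ) : ℝ) / m := Nat.cast_div_le
  have h2 : (b : ℝ) ≤ ((4 * N / m : ℕ) : ℝ) + 1 := by exact_mod_cast h
  push_cast at h1
  rw [← mul_div_assoc]
  linarith

theorem norm_sum_phase_mul_sq_le {γ : ℝ} (hγ0 : 0 < γ) (hγ1 : γ < 1) (τ l R : ℝ) (N m a b H : ℕ)
    (hm : 1 ≤ m) (hH : 1 ≤ H) (hHN : (H : ℝ) ≤ N / m) (ha : N / m < a) (hb : b ≤ 4 * N / m + 1)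
    (hR : |l| * m ^ 2 * H * (N : ℝ) ^ (γ - 2) ≤ R) (hR4 : R ≤ 1 / 4) :
    ‖∑ e ∈ Finset.Ico a b, phase γ τ l (m * e)‖ ^ 2 ≤ 5 * (N / m) / H * (4 * (N / m) +
      2 * ∑ h ∈ Finset.Ico 1 H, cappedBound (4 * N) 729 N R (2 * (τ * m ^ 2) * h)) := by
  have hm' : (1 : ℝ) ≤ m := by exact_mod_cast hm
  have hNm : (N : ℝ) / m ≤ N := div_le_self (by positivity) hm'
  simp_rw [phase_mul]
  refine (norm_sum_quadratic_sq_le hγ0 hγ1 (τ * m ^ 2) (l * (m : ℝ) ^ γ) (N / m) R a b H hH hHN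
    (div_lt_cast_of_div_lt hm ha) (cast_le_of_le_div hb) (le_trans (le_of_eq ?_) hR) hR4).trans ?_
  · rw [abs_mul, abs_of_nonneg (by positivity : (0 : ℝ) ≤ (m : ℝ) ^ γ),
      Real.div_rpow (by positivity) (by positivity), Real.rpow_sub (by linarith : (0 : ℝ) < m) γ 2,
      Real.rpow_two]
    have : (0 : ℝ) < (m : ℝ) ^ γ := by positivity
    field_simp
  · gcongr
    exact cappedBound_mono (by norm_num) (by linarith) hNm le_rfl

theorem corr_phase_sq_le {γ : ℝ} (hγ0 : 0 < γ) (hγ1 : γ < 1) (τ l R : ℝ) (N n q H : ℕ)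
    (hn : 1 ≤ n) (hq : 1 ≤ q) (hH : 1 ≤ H) (hHN : (H : ℝ) ≤ N / n)
    (hR : |l| * q * n * H * (N : ℝ) ^ (γ - 2) ≤ R) (hR4 : R ≤ 1 / 4) :
    corr (phase γ τ l) N (n + q) n ^ 2 ≤ 5 * (N / n) / H * (4 * (N / n) +
      2 * ∑ h ∈ Finset.Ico 1 H,
        cappedBound (4 * (N / n)) 729 (N / n) R (2 * (τ * q * (2 * n + q)) * h)) := by
  have hn' : (1 : ℝ) ≤ n := by exact_mod_cast hn
  have hn0 : (0 : ℝ) < n := by linarith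
  have hq' : (1 : ℝ) ≤ q := by exact_mod_cast hq
  have hterm : ∀ m : ℕ, phase γ τ l (m * (n + q)) * (starRingEnd ℂ) (phase γ τ l (m * n)) =
      ee (τ * q * (2 * n + q) * m ^ 2 + l * (((n : ℝ) + q) ^ γ - (n : ℝ) ^ γ) * (m : ℝ) ^ γ) := by
    intro m
    rw [mul_comm m, mul_comm m, phase_mul, phase_mul, ← ee_sub]
    congr 1
    push_cast
    ring
  rw [corr_add_eq _ _ _ _ hn]
  simp_rw [hterm]
  have hIoc : Finset.Ioc (N / n) (4 * N / (n + q)) = Finset.Ico (N / n + 1) (4 * N / (n + q) + 1) := by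
    ext; simp only [Finset.mem_Ioc, Finset.mem_Ico]; omega
  rw [hIoc]
  refine norm_sum_quadratic_sq_le hγ0 hγ1 _ _ (N / n) R _ _ H hH hHN
    (div_lt_cast_of_div_lt hn (Nat.lt_succ_self _))
    (cast_le_of_le_div (Nat.succ_le_succ (Nat.div_le_div_left (by omega) hn)))
    (le_trans ?_ hR) hR4
  obtain ⟨ξ, hξ1, _, hξ⟩ := exists_rpow_diff (γ := γ) hn0 (by linarith : (0 : ℝ) < q)
  have hξ' : ξ ^ (γ - 1) ≤ (n : ℝ) ^ (γ - 1) :=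
    Real.rpow_le_rpow_of_nonpos hn0 hξ1.le (by linarith)
  have hξ0 : 0 ≤ ξ ^ (γ - 1) := by have := hn0.trans hξ1; positivity
  rw [hξ, abs_mul, abs_of_nonneg (by positivity : 0 ≤ (q : ℝ) * (γ * ξ ^ (γ - 1)))]
  have h1 : γ * ξ ^ (γ - 1) ≤ (n : ℝ) ^ (γ - 1) := by nlinarith
  have h2 : (n : ℝ) ^ (γ - 1) * (N / n : ℝ) ^ (γ - 2) = n * (N : ℝ) ^ (γ - 2) := by
    rw [Real.div_rpow (by positivity) (by positivity), Real.rpow_sub hn0 γ 2,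
      Real.rpow_sub hn0 γ 1, Real.rpow_two, Real.rpow_one]
    have : (0 : ℝ) < (n : ℝ) ^ γ := by positivity
    field_simp
  calc |l| * (q * (γ * ξ ^ (γ - 1))) * (H * (N / n : ℝ) ^ (γ - 2)) ≤
      |l| * (q * (n : ℝ) ^ (γ - 1)) * (H * (N / n : ℝ) ^ (γ - 2)) := by gcongr
    _ = |l| * q * H * ((n : ℝ) ^ (γ - 1) * (N / n : ℝ) ^ (γ - 2)) := by ring
    _ = _ := by rw [h2]; ring

/-- A rational approximation `a / q` to `α` together with a scale `r` of size about `q ^ (1 / 8)`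
and a majorant `A` for divisor functions and logarithms at that scale. -/
structure IsScale (α A C : ℝ) (a : ℤ) (q r : ℕ) : Prop where
  coprime : IsCoprime a (q : ℤ)
  approx : |α - a / q| ≤ 1 / (q : ℝ) ^ 2
  le_den : r ^ 8 ≤ q
  den_le : q ≤ 256 * r ^ 8
  one_le : 1 ≤ C
  le_scale : 32 * C ≤ r
  log_le : 1 + Real.log ((r : ℝ) ^ 15) ≤ A
  card_divisors_le : ∀ j : ℕ, 0 < j → j ≤ r ^ 15 → (j.divisors.card : ℝ) ≤ A

namespace IsScale

variable {α A C : ℝ} {a : ℤ} {q r : ℕ}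

theorem eighteen_le (h : IsScale α A C a q r) : 18 ≤ r := by
  have : (18 : ℝ) ≤ r := by linarith [h.one_le, h.le_scale]
  exact_mod_cast this

theorem cast_pos (h : IsScale α A C a q r) : (0 : ℝ) < r := by
  have := h.eighteen_le
  have : 0 < r := by omega
  exact_mod_cast this

theorem log_le_of_le (h : IsScale α A C a q r) {x : ℝ} (hx : 0 < x) (hxr : x ≤ (r : ℝ) ^ 15) :
    1 + Real.log x ≤ A :=
  (add_le_add_right (Real.log_le_log hx hxr) 1).trans h.log_le

theorem one_le_A (h : IsScale α A C a q r) : 1 ≤ A := by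
  have h1 : (1 : ℝ) ≤ r := by exact_mod_cast (by norm_num : 1 ≤ 18).trans h.eighteen_le
  simpa using h.log_le_of_le one_pos (one_le_pow₀ h1)

theorem sum_cappedBound_le (h : IsScale α A C a q r) {V M R S : ℝ} (hV : 0 ≤ V) (hM : 0 ≤ M)
    (hR : 0 ≤ R) (hS : 0 ≤ S) (hMR : M * R ≤ S ^ 2) (n : ℕ) :
    ∑ c ∈ Finset.range n, cappedBound V 729 M R (c * α) ≤
      ((n : ℝ) / r ^ 8 + 1) * (6 * V + 1024 * (A * r ^ 8) + 1244160 * (r ^ 8 * S)) := by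
  have hr := h.cast_pos
  have hq : 0 < q := lt_of_lt_of_le (by have := h.eighteen_le; positivity) h.le_den
  have hq' : (0 : ℝ) < q := by exact_mod_cast hq
  have hq1 : (r : ℝ) ^ 8 ≤ q := by exact_mod_cast h.le_den
  have hq2 : (q : ℝ) ≤ 256 * r ^ 8 := by exact_mod_cast h.den_le
  have hA := h.one_le_A
  have h18 : (18 : ℝ) ≤ r := by exact_mod_cast h.eighteen_le
  have hlog : 1 + Real.log q ≤ A := by
    refine h.log_le_of_le hq' (hq2.trans ?_)
    have : (256 : ℝ) ≤ r ^ 7 := by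
      calc (256 : ℝ) ≤ 18 ^ 7 := by norm_num
        _ ≤ r ^ 7 := by gcongr
    calc 256 * (r : ℝ) ^ 8 ≤ r ^ 7 * r ^ 8 := by gcongr
      _ = _ := by ring
  have hsq : √(729 * M * R) ≤ 27 * S := by
    apply Real.sqrt_le_iff.2
    constructor
    · positivity
    · nlinarith
  have hlog0 : 0 ≤ 1 + Real.log q := by
    have : (1 : ℝ) ≤ q := by exact_mod_cast hq
    have := Real.log_nonneg this
    linarith
  refine (_root_.sum_cappedBound_le α a q hq h.coprime h.approx V 729 M R hV (by norm_num) hM hR n).trans ?_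
  have e1 : 4 * (q : ℝ) * (1 + Real.log q) ≤ 1024 * (A * r ^ 8) := by
    calc 4 * (q : ℝ) * (1 + Real.log q) ≤ 4 * (256 * r ^ 8) * A := by gcongr
      _ = _ := by ring
  have e2 : 180 * (q : ℝ) * √(729 * M * R) ≤ 1244160 * (r ^ 8 * S) := by
    calc 180 * (q : ℝ) * √(729 * M * R) ≤ 180 * (256 * r ^ 8) * (27 * S) := by gcongr
      _ = _ := by ring
  have e3 : (n : ℝ) / q ≤ n / r ^ 8 := by gcongr
  have e4 : 0 ≤ 6 * V + 4 * q * (1 + Real.log q) + 180 * q * √(729 * M * R) := by positivity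
  calc _ ≤ ((n : ℝ) / r ^ 8 + 1) * (6 * V + 4 * q * (1 + Real.log q) + 180 * q * √(729 * M * R)) := by
        gcongr
    _ ≤ _ := by gcongr

theorem sum_range_inv_le (h : IsScale α A C a q r) {n : ℕ} (hn : 0 < n) (hnr : n ≤ r ^ 15) :
    ∑ m ∈ Finset.Icc 1 n, (m : ℝ)⁻¹ ≤ A := by
  refine sum_inv_le_of_le n A (h.log_le_of_le (by exact_mod_cast hn) (by exact_mod_cast hnr)) _ ?_
  intro i hi
  exact Finset.mem_Icc.1 hi

/-- Average of the majorants for the type I sums. -/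
theorem sum_typeI_le (h : IsScale α A C a q r) {K : ℕ} (hK : 1 ≤ K) (hKr : K ≤ r) :
    ∑ k ∈ Finset.Icc 1 K, ∑ m ∈ Finset.Icc 1 (r ^ 2),
      √(5 * ((r ^ 14 : ℕ) / m) / (r ^ 4 : ℕ) * (4 * ((r ^ 14 : ℕ) / m) + 2 * ∑ j ∈ Finset.Ico 1 (r ^ 4),
        cappedBound (4 * (r ^ 14 : ℕ)) 729 (r ^ 14 : ℕ) (C / r ^ 6) (2 * (k * α * m ^ 2) * j))) ≤
      10 ^ 4 * (C * A ^ 3 * K * r ^ 12) := by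
  have hr := h.cast_pos
  have hA := h.one_le_A
  have hC := h.one_le
  have hr18 := h.eighteen_le
  have hr1 : (1 : ℝ) ≤ r := by exact_mod_cast (by norm_num : 1 ≤ 18).trans hr18
  have hK' : (1 : ℝ) ≤ K := by exact_mod_cast hK
  set F : ℕ → ℝ := fun c => cappedBound (4 * (r ^ 14 : ℕ)) 729 (r ^ 14 : ℕ) (C / r ^ 6) (c * α) with hF
  have hF0 : ∀ j, 0 ≤ F j := fun j => cappedBound_nonneg (by positivity)
  have hn15 : 2 * K * r ^ 8 + 1 ≤ r ^ 15 := by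
    calc 2 * K * r ^ 8 + 1 ≤ 2 * r * r ^ 8 + r ^ 9 := by
          gcongr
          exact Nat.one_le_pow _ _ (by omega)
      _ = 3 * r ^ 9 := by ring
      _ ≤ r * r ^ 9 := by gcongr; omega
      _ = r ^ 10 := by ring
      _ ≤ r ^ 15 := Nat.pow_le_pow_right (by omega) (by norm_num)
  have hsumF : ∑ p ∈ Finset.Icc 1 K ×ˢ Finset.Icc 1 (r ^ 2) ×ˢ Finset.Ico 1 (r ^ 4),
      F (2 * p.1 * p.2.1 ^ 2 * p.2.2) ≤ 5200000 * (C * A ^ 4 * K * r ^ 14) := by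
    refine (sum_comp_le_of_dvd _ (fun p : ℕ × ℕ × ℕ => 2 * p.1 * p.2.1 ^ 2 * p.2.2) id F hF0
      (2 * K * r ^ 8 + 1) A (by linarith) (fun j h1 h2 => h.card_divisors_le j h1 (by omega))
      ?_ ?_ (fun p _ p' _ _ e => e)).trans ?_
    · rintro ⟨k, m, j⟩ hp
      simp only [Finset.mem_product, Finset.mem_Icc, Finset.mem_Ico] at hp
      obtain ⟨⟨h1, h2⟩, ⟨h3, h4⟩, h5, h6⟩ := hp
      refine ⟨by simp only; positivity, Nat.lt_succ_of_le ?_⟩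
      calc 2 * k * m ^ 2 * j ≤ 2 * K * (r ^ 2) ^ 2 * r ^ 4 := by gcongr
        _ = 2 * K * r ^ 8 := by ring
    · rintro ⟨k, m, j⟩ hp
      refine ⟨⟨2 * m ^ 2 * j, by simp only [id]; ring⟩, ⟨2 * k * m * j, by simp only [id]; ring⟩,
        ⟨2 * k * m ^ 2, by simp only [id]; ring⟩⟩
    · have := h.sum_cappedBound_le (V := 4 * (r ^ 14 : ℕ)) (M := (r ^ 14 : ℕ)) (R := C / r ^ 6)
        (S := C * r ^ 4) (by positivity) (by positivity) (by positivity) (by positivity) (by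
          push_cast
          have e : (r : ℝ) ^ 14 * (C / r ^ 6) = C * r ^ 8 := by field_simp
          rw [e, mul_pow, ← pow_mul]
          gcongr
          exact le_self_pow₀ hC (by norm_num)) (2 * K * r ^ 8 + 1)
      refine (mul_le_mul_of_nonneg_left this (by positivity)).trans ?_
      have e1 : ((2 * K * r ^ 8 + 1 : ℕ) : ℝ) / r ^ 8 + 1 ≤ 4 * K := by
        have : (1 : ℝ) ≤ r ^ 8 := one_le_pow₀ hr1
        have e : ((2 * K * r ^ 8 + 1 : ℕ) : ℝ) / r ^ 8 = 2 * K + 1 / r ^ 8 := by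
          push_cast; field_simp
        have : 1 / (r : ℝ) ^ 8 ≤ 1 := by rw [div_le_one (by positivity)]; exact this
        rw [e]; linarith
      have e2 : 6 * (4 * ((r ^ 14 : ℕ) : ℝ)) + 1024 * (A * r ^ 8) + 1244160 * (r ^ 8 * (C * r ^ 4)) ≤
          1300000 * (C * A * r ^ 14) := by
        push_cast
        have f1 : (r : ℝ) ^ 14 ≤ C * A * r ^ 14 := by
          have : 1 ≤ C * A := one_le_mul_of_one_le_of_one_le hC hA
          exact le_mul_of_one_le_left (by positivity) this
        have f2 : A * (r : ℝ) ^ 8 ≤ C * A * r ^ 14 := by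
          calc A * (r : ℝ) ^ 8 = 1 * A * r ^ 8 := by ring
            _ ≤ C * A * r ^ 14 := by gcongr; norm_num
        have f3 : (r : ℝ) ^ 8 * (C * r ^ 4) ≤ C * A * r ^ 14 := by
          calc (r : ℝ) ^ 8 * (C * r ^ 4) = C * 1 * r ^ 12 := by ring
            _ ≤ C * A * r ^ 14 := by gcongr; norm_num
        have f4 : 0 ≤ C * A * (r : ℝ) ^ 14 := by positivity
        linarith
      calc A ^ 3 * _ ≤ A ^ 3 * ((4 * K) * (1300000 * (C * A * r ^ 14))) := by gcongr
        _ = _ := by ring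
  rw [← Finset.sum_product']
  set T : ℕ × ℕ → ℝ := fun p => √(5 * ((r ^ 14 : ℕ) / p.2) / (r ^ 4 : ℕ) *
    (4 * ((r ^ 14 : ℕ) / p.2) + 2 * ∑ j ∈ Finset.Ico 1 (r ^ 4), F (2 * p.1 * p.2 ^ 2 * j))) with hT
  have hTeq : ∀ p : ℕ × ℕ, √(5 * ((r ^ 14 : ℕ) / p.2) / (r ^ 4 : ℕ) * (4 * ((r ^ 14 : ℕ) / p.2) +
      2 * ∑ j ∈ Finset.Ico 1 (r ^ 4), cappedBound (4 * (r ^ 14 : ℕ)) 729 (r ^ 14 : ℕ) (C / r ^ 6)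
        (2 * (p.1 * α * p.2 ^ 2) * j))) = T p := by
    intro p
    simp only [hT, hF]
    congr 4
    refine Finset.sum_congr rfl fun j _ => ?_
    congr 1
    push_cast
    ring
  simp_rw [hTeq]
  set s := Finset.Icc 1 K ×ˢ Finset.Icc 1 (r ^ 2) with hs
  have hcs := Finset.sum_sq_le_sum_mul_sum_of_sq_le_mul s (r := T) (f := fun p => (p.2 : ℝ)⁻¹)
    (g := fun p => 5 * r ^ 10 * (4 * r ^ 14 * (p.2 : ℝ)⁻¹ +
      2 * ∑ j ∈ Finset.Ico 1 (r ^ 4), F (2 * p.1 * p.2 ^ 2 * j))) (fun p _ => by positivity)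
    (fun p _ => by
      have := Finset.sum_nonneg (s := Finset.Ico 1 (r ^ 4))
        (fun j _ => hF0 (2 * p.1 * p.2 ^ 2 * j))
      positivity) (fun p hp => by
      have := Finset.sum_nonneg (s := Finset.Ico 1 (r ^ 4))
        (fun j _ => hF0 (2 * p.1 * p.2 ^ 2 * j))
      simp only [hT]
      rw [Real.sq_sqrt (by positivity)]
      push_cast
      refine le_of_eq ?_
      field_simp)
  have hinv : ∑ p ∈ s, (p.2 : ℝ)⁻¹ ≤ K * A := by
    rw [hs, Finset.sum_product]
    simp only [Finset.sum_const, Nat.card_Icc, Nat.add_sub_cancel, nsmul_eq_mul]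
    gcongr
    exact h.sum_range_inv_le (by positivity) (Nat.pow_le_pow_right (by omega) (by norm_num))
  have hg : ∑ p ∈ s, 5 * (r : ℝ) ^ 10 * (4 * r ^ 14 * (p.2 : ℝ)⁻¹ +
      2 * ∑ j ∈ Finset.Ico 1 (r ^ 4), F (2 * p.1 * p.2 ^ 2 * j)) ≤
      5 * r ^ 10 * (4 * r ^ 14 * (K * A) + 2 * (5200000 * (C * A ^ 4 * K * r ^ 14))) := by
    rw [← Finset.mul_sum, Finset.sum_add_distrib, ← Finset.mul_sum, ← Finset.mul_sum]
    gcongr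
    refine le_trans (le_of_eq ?_) hsumF
    rw [hs, Finset.sum_product, Finset.sum_product]
    refine Finset.sum_congr rfl fun k _ => ?_
    rw [Finset.sum_product]
  have hfin : (∑ p ∈ s, T p) ^ 2 ≤ (10 ^ 4 * (C * A ^ 3 * K * r ^ 12)) ^ 2 := by
    refine hcs.trans ?_
    have f : K * A ≤ C * A ^ 4 * K := by
      calc K * A = 1 * A * K := by ring
        _ ≤ C * A ^ 4 * K := by gcongr; exact le_self_pow₀ hA (by norm_num)
    calc _ ≤ (K * A) * (5 * r ^ 10 * (4 * r ^ 14 * (K * A) + 2 * (5200000 * (C * A ^ 4 * K * r ^ 14)))) := by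
          gcongr
          exact Finset.sum_nonneg fun p _ => by
            have := Finset.sum_nonneg (s := Finset.Ico 1 (r ^ 4))
              (fun j _ => hF0 (2 * p.1 * p.2 ^ 2 * j))
            positivity
      _ ≤ (K * A) * (5 * r ^ 10 * (4 * r ^ 14 * (C * A ^ 4 * K) + 2 * (5200000 * (C * A ^ 4 * K * r ^ 14)))) := by
          gcongr
      _ = 52000020 * (1 * A ^ 5 * C * K ^ 2 * r ^ 24) := by ring
      _ ≤ 100000000 * (C * A ^ 6 * C * K ^ 2 * r ^ 24) := by gcongr <;> norm_num
      _ = _ := by ring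
  exact abs_le_of_sq_le_sq' hfin (by positivity) |>.2

theorem sum_range_corr_dyadic_le (h : IsScale α A C a q r) {γ l : ℝ} (hγ0 : 0 < γ) (hγ1 : γ < 1)
    (hl : |l| ≤ C * ((r ^ 14 : ℕ) : ℝ) ^ (1 - γ)) {K : ℕ} (hK : 1 ≤ K) (hKr : K ≤ r) (X : ℕ)
    (hXr : r ^ 2 ≤ 2 * X) (hX : X ≤ 2 * r ^ 7) (P : Finset ℕ)
    (hP : ∀ n ∈ P, X ≤ n ∧ n < 2 * X ∧ n ≤ 2 * r ^ 7) :
    ∑ k ∈ Finset.Icc 1 K, ∑ n ∈ P, ∑ j ∈ Finset.Ico 1 (r ^ 2),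
      corr (phase γ (k * α) l) (r ^ 14) (n + j) n ≤ 3 * 10 ^ 4 * (C * A ^ 2 * K * r ^ 14) := by
  have hr := h.cast_pos
  have hA := h.one_le_A
  have hC := h.one_le
  have hr18 := h.eighteen_le
  have hr1 : (1 : ℝ) ≤ r := by exact_mod_cast (by norm_num : 1 ≤ 18).trans hr18
  have h32 := h.le_scale
  have hr32 : 32 ≤ r := by
    have : (32 : ℝ) ≤ r := by linarith
    exact_mod_cast this
  have hK' : (1 : ℝ) ≤ K := by exact_mod_cast hK
  have hX0 : 0 < X := by have : 0 < r ^ 2 := by positivity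
                         omega
  have hX0' : (0 : ℝ) < X := by exact_mod_cast hX0
  have hXr' : (r : ℝ) ^ 2 ≤ 2 * X := by exact_mod_cast hXr
  have hX' : (X : ℝ) ≤ 2 * r ^ 7 := by exact_mod_cast hX
  have hPX : (P.card : ℝ) ≤ X := by
    have : P ⊆ Finset.Ico X (2 * X) := fun n hn => Finset.mem_Ico.2 ⟨(hP n hn).1, (hP n hn).2.1⟩
    have := Finset.card_le_card this
    rw [Nat.card_Ico] at this
    have : P.card ≤ X := by omega
    exact_mod_cast this
  set N : ℝ := (r : ℝ) ^ 14 with hN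
  have hN0 : 0 < N := by positivity
  set R : ℝ := 2 * C * r ^ 6 * X / N with hR
  set F : ℕ → ℝ := fun c => cappedBound (4 * (N / X)) 729 (N / X) R (c * α) with hF
  have hF0 : ∀ j, 0 ≤ F j := fun j => cappedBound_nonneg (by positivity)
  have hn15 : 12 * K * X * r ^ 6 + 1 ≤ r ^ 15 := by
    calc 12 * K * X * r ^ 6 + 1 ≤ 12 * r * (2 * r ^ 7) * r ^ 6 + r ^ 14 := by
          gcongr
          exact Nat.one_le_pow _ _ (by omega)
      _ = 25 * r ^ 14 := by ring
      _ ≤ r * r ^ 14 := by gcongr; omega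
      _ = r ^ 15 := by ring
  have hsumF : ∑ p ∈ Finset.Icc 1 K ×ˢ P ×ˢ Finset.Ico 1 (r ^ 2) ×ˢ Finset.Ico 1 (r ^ 4),
      F (2 * p.1 * p.2.2.1 * (2 * p.2.1 + p.2.2.1) * p.2.2.2) ≤ A ^ 3 * (16 * K * X / r ^ 2 *
        (24 * N / X + 2490000 * (C * A * r ^ 11))) := by
    refine (sum_comp_le_of_dvd _ (fun p : ℕ × ℕ × ℕ × ℕ =>
      2 * p.1 * p.2.2.1 * (2 * p.2.1 + p.2.2.1) * p.2.2.2) (fun p => (p.1, p.2.2.1, p.2.2.2)) F hF0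
      (12 * K * X * r ^ 6 + 1) A (by linarith) (fun j h1 h2 => h.card_divisors_le j h1 (by omega))
      ?_ ?_ ?_).trans ?_
    · rintro ⟨k, n, m, j⟩ hp
      simp only [Finset.mem_product, Finset.mem_Icc, Finset.mem_Ico] at hp
      obtain ⟨⟨h1, h2⟩, h3, ⟨h4, h5⟩, h6, h7⟩ := hp
      have hn := hP n h3
      refine ⟨by simp only; positivity, Nat.lt_succ_of_le ?_⟩
      calc 2 * k * m * (2 * n + m) * j ≤ 2 * K * r ^ 2 * (6 * X) * r ^ 4 := by gcongr; omega
        _ = 12 * K * X * r ^ 6 := by ring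
    · rintro ⟨k, n, m, j⟩ hp
      exact ⟨⟨2 * m * (2 * n + m) * j, by simp only; ring⟩,
        ⟨2 * k * (2 * n + m) * j, by simp only; ring⟩,
        ⟨2 * k * m * (2 * n + m), by simp only; ring⟩⟩
    · rintro ⟨k, n, m, j⟩ hp ⟨k', n', m', j'⟩ _ e1 e2
      simp only [Prod.mk.injEq] at e1 e2 ⊢
      obtain ⟨rfl, rfl, rfl⟩ := e2
      simp only [Finset.mem_product, Finset.mem_Icc, Finset.mem_Ico] at hp
      obtain ⟨⟨h1, h2⟩, h3, ⟨h4, h5⟩, h6, h7⟩ := hp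
      have e3 := Nat.eq_of_mul_eq_mul_right h6 e1
      have e4 := Nat.eq_of_mul_eq_mul_left (show 0 < 2 * k * m by positivity) e3
      exact ⟨rfl, by omega, rfl, rfl⟩
    · have := h.sum_cappedBound_le (V := 4 * (N / X)) (M := N / X) (R := R)
        (S := 2 * C * r ^ 3) (by positivity) (by positivity) (by positivity) (by positivity) (by
          have e : N / X * R = 2 * C * r ^ 6 := by rw [hR]; field_simp
          rw [e, mul_pow, ← pow_mul]
          gcongr
          exact le_self_pow₀ (by linarith) (by norm_num)) (12 * K * X * r ^ 6 + 1)
      refine (mul_le_mul_of_nonneg_left this (by positivity)).trans ?_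
      have e1 : ((12 * K * X * r ^ 6 + 1 : ℕ) : ℝ) / r ^ 8 + 1 ≤ 16 * K * X / r ^ 2 := by
        have : (1 : ℝ) ≤ r ^ 8 := one_le_pow₀ hr1
        have e : ((12 * K * X * r ^ 6 + 1 : ℕ) : ℝ) / r ^ 8 = 12 * K * X / r ^ 2 + 1 / r ^ 8 := by
          push_cast; field_simp
        have e' : 1 / (r : ℝ) ^ 8 ≤ 1 := by rw [div_le_one (by positivity)]; exact this
        have e'' : 2 ≤ 4 * K * X / (r : ℝ) ^ 2 := by
          rw [le_div_iff₀ (by positivity)]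
          nlinarith
        have e''' : 16 * K * X / (r : ℝ) ^ 2 = 12 * K * X / r ^ 2 + 4 * K * X / (r : ℝ) ^ 2 := by ring
        rw [e, e''']; linarith
      have e2 : 6 * (4 * (N / X)) + 1024 * (A * r ^ 8) + 1244160 * (r ^ 8 * (2 * C * r ^ 3)) ≤
          24 * N / X + 2490000 * (C * A * r ^ 11) := by
        have f2 : A * (r : ℝ) ^ 8 ≤ C * A * r ^ 11 := by
          calc A * (r : ℝ) ^ 8 = 1 * A * r ^ 8 := by ring
            _ ≤ C * A * r ^ 11 := by gcongr; norm_num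
        have f3 : (r : ℝ) ^ 8 * (2 * C * r ^ 3) ≤ 2 * (C * A * r ^ 11) := by
          calc (r : ℝ) ^ 8 * (2 * C * r ^ 3) = 2 * (C * 1 * r ^ 11) := by ring
            _ ≤ 2 * (C * A * r ^ 11) := by gcongr
        have f4 : 0 ≤ C * A * (r : ℝ) ^ 11 := by positivity
        have f5 : 6 * (4 * (N / X)) = 24 * N / X := by ring
        linarith
      gcongr
  have hcorr : ∀ k ∈ Finset.Icc 1 K, ∀ n ∈ P, ∀ m ∈ Finset.Ico 1 (r ^ 2),
      corr (phase γ (k * α) l) (r ^ 14) (n + m) n ^ 2 ≤ 5 * (N / X) / r ^ 4 * (4 * (N / X) +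
        2 * ∑ j ∈ Finset.Ico 1 (r ^ 4), F (2 * k * m * (2 * n + m) * j)) := by
    intro k _ n hn m hm
    obtain ⟨hn1, hn2, hn3⟩ := hP n hn
    obtain ⟨hm1, hm2⟩ := Finset.mem_Ico.1 hm
    have hn0 : (0 : ℝ) < n := by exact_mod_cast hX0.trans_le hn1
    have hXn : (X : ℝ) ≤ n := by exact_mod_cast hn1
    have hn2' : (n : ℝ) ≤ 2 * X := by exact_mod_cast hn2.le
    have hn3' : (n : ℝ) ≤ 2 * r ^ 7 := by exact_mod_cast hn3
    have hm2' : (m : ℝ) ≤ r ^ 2 := by exact_mod_cast hm2.le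
    have hNX : N / n ≤ N / X := by gcongr
    have hcast : ((r ^ 14 : ℕ) : ℝ) = N := by push_cast; rfl
    have hcast4 : ((r ^ 4 : ℕ) : ℝ) = r ^ 4 := by push_cast; rfl
    rw [hcast] at hl
    have := corr_phase_sq_le hγ0 hγ1 (k * α) l R (r ^ 14) n m (r ^ 4) (hX0.trans_le hn1) hm1
      (Nat.one_le_pow _ _ (by omega)) ?_ ?_ ?_
    · refine this.trans ?_
      rw [hcast, hcast4]
      have hs : ∑ j ∈ Finset.Ico 1 (r ^ 4), cappedBound (4 * (N / n)) 729 (N / n) R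
          (2 * (k * α * m * (2 * n + m)) * j) ≤
          ∑ j ∈ Finset.Ico 1 (r ^ 4), F (2 * k * m * (2 * n + m) * j) := by
        refine Finset.sum_le_sum fun j _ => ?_
        have e : 2 * (k * α * m * (2 * n + m)) * j =
            ((2 * k * m * (2 * n + m) * j : ℕ) : ℝ) * α := by push_cast; ring
        rw [e]
        exact cappedBound_mono (by norm_num) (by linarith) hNX le_rfl
      have hs0 : 0 ≤ ∑ j ∈ Finset.Ico 1 (r ^ 4), cappedBound (4 * (N / n)) 729 (N / n) R
          (2 * (k * α * m * (2 * n + m)) * j) :=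
        Finset.sum_nonneg fun j _ => cappedBound_nonneg (by positivity)
      gcongr
    · rw [hcast, hcast4, le_div_iff₀ hn0]
      calc (r : ℝ) ^ 4 * (n : ℝ) ≤ (r : ℝ) ^ 4 * (2 * (r : ℝ) ^ 7) := by gcongr
        _ = 2 * (r : ℝ) ^ 11 := by ring
        _ ≤ r * (r : ℝ) ^ 11 := by gcongr; linarith
        _ = (r : ℝ) ^ 12 := by ring
        _ ≤ (r : ℝ) ^ 14 := pow_le_pow_right₀ hr1 (by norm_num)
    · rw [hcast, hcast4]
      have hpow : N ^ (1 - γ) * N ^ (γ - 2) = N⁻¹ := by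
        rw [← Real.rpow_add hN0, ← Real.rpow_neg_one]; congr 1; ring
      calc |l| * m * n * r ^ 4 * N ^ (γ - 2) ≤
          (C * N ^ (1 - γ)) * r ^ 2 * (2 * X) * r ^ 4 * N ^ (γ - 2) := by gcongr
        _ = C * r ^ 2 * (2 * X) * r ^ 4 * (N ^ (1 - γ) * N ^ (γ - 2)) := by ring
        _ = R := by rw [hpow, hR]; field_simp
    · rw [hR, div_le_iff₀ hN0]
      calc 2 * C * r ^ 6 * X ≤ 2 * C * r ^ 6 * (2 * r ^ 7) := by gcongr
        _ = (4 * C) * r ^ 13 := by ring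
        _ ≤ (r / 4) * r ^ 13 := by gcongr; linarith
        _ = 1 / 4 * N := by rw [hN]; ring
  set s := Finset.Icc 1 K ×ˢ P ×ˢ Finset.Ico 1 (r ^ 2) with hs
  have hcard : (s.card : ℝ) ≤ K * X * r ^ 2 := by
    rw [hs, Finset.card_product, Finset.card_product, Nat.card_Icc, Nat.card_Ico,
      Nat.add_sub_cancel]
    have : ((r ^ 2 - 1 : ℕ) : ℝ) ≤ r ^ 2 := by exact_mod_cast Nat.sub_le _ _
    push_cast
    rw [mul_assoc]
    gcongr
  have hsq : ∑ p ∈ s, corr (phase γ (p.1 * α) l) (r ^ 14) (p.2.1 + p.2.2) p.2.1 ^ 2 ≤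
      5 * (N / X) / r ^ 4 * (4 * (N / X) * (K * X * r ^ 2) + 2 * (A ^ 3 * (16 * K * X / r ^ 2 *
        (24 * N / X + 2490000 * (C * A * r ^ 11))))) := by
    calc _ ≤ ∑ p ∈ s, 5 * (N / X) / r ^ 4 * (4 * (N / X) +
          2 * ∑ j ∈ Finset.Ico 1 (r ^ 4), F (2 * p.1 * p.2.2 * (2 * p.2.1 + p.2.2) * j)) := by
          refine Finset.sum_le_sum fun p hp => ?_
          obtain ⟨h1, h2⟩ := Finset.mem_product.1 hp
          obtain ⟨h3, h4⟩ := Finset.mem_product.1 h2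
          exact hcorr _ h1 _ h3 _ h4
      _ ≤ _ := by
          rw [← Finset.mul_sum, Finset.sum_add_distrib, Finset.sum_const, nsmul_eq_mul,
            ← Finset.mul_sum, mul_comm (s.card : ℝ)]
          gcongr
          refine le_trans (le_of_eq ?_) hsumF
          rw [hs, Finset.sum_product, Finset.sum_product]
          refine Finset.sum_congr rfl fun k _ => ?_
          rw [Finset.sum_product, Finset.sum_product]
          refine Finset.sum_congr rfl fun n _ => ?_
          rw [Finset.sum_product]
  have hsum : ∑ k ∈ Finset.Icc 1 K, ∑ n ∈ P, ∑ j ∈ Finset.Ico 1 (r ^ 2),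
      corr (phase γ (k * α) l) (r ^ 14) (n + j) n =
      ∑ p ∈ s, corr (phase γ (p.1 * α) l) (r ^ 14) (p.2.1 + p.2.2) p.2.1 := by
    rw [hs, Finset.sum_product]
    refine Finset.sum_congr rfl fun k _ => ?_
    rw [Finset.sum_product]
  rw [hsum]
  refine (abs_le_of_sq_le_sq' (sq_sum_le_card_mul_sum_sq.trans ?_) (by positivity)).2
  have g1 : (24 * N / X + 2490000 * (C * A * r ^ 11)) ≤ 4980024 * (C * A * r ^ 18 / X) := by
    have f1 : N / X ≤ C * A * r ^ 18 / X := by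
      gcongr
      calc N = 1 * 1 * r ^ 14 := by rw [hN]; ring
        _ ≤ C * A * r ^ 18 := by gcongr; norm_num
    have f2 : C * A * (r : ℝ) ^ 11 ≤ 2 * (C * A * r ^ 18 / X) := by
      rw [← mul_div_assoc, le_div_iff₀ hX0']
      calc C * A * (r : ℝ) ^ 11 * X ≤ C * A * r ^ 11 * (2 * r ^ 7) := by gcongr
        _ = _ := by ring
    have f3 : 24 * N / X = 24 * (N / X) := by ring
    rw [f3]; linarith
  calc _ ≤ (K * X * r ^ 2) * (5 * (N / X) / r ^ 4 * (4 * (N / X) * (K * X * r ^ 2) +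
        2 * (A ^ 3 * (16 * K * X / r ^ 2 * (4980024 * (C * A * r ^ 18 / X)))))) := by
        gcongr
        refine hsq.trans ?_
        gcongr
    _ = (20 + 5 * 32 * 4980024 * (C * A ^ 4)) * (K * N) ^ 2 := by
        rw [hN]; field_simp; ring
    _ ≤ (20 * (C * A ^ 4) + 5 * 32 * 4980024 * (C * A ^ 4)) * (K * N) ^ 2 := by
        have : 1 ≤ C * A ^ 4 := one_le_mul_of_one_le_of_one_le hC (one_le_pow₀ hA)
        gcongr
        linarith
    _ = 796803860 * (1 * C * A ^ 4 * (K * N) ^ 2) := by ring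
    _ ≤ 900000000 * (C * C * A ^ 4 * (K * N) ^ 2) := by gcongr; norm_num
    _ = _ := by ring

theorem sum_corr_le (h : IsScale α A C a q r) {γ l : ℝ} (hγ0 : 0 < γ) (hγ1 : γ < 1)
    (hl : |l| ≤ C * ((r ^ 14 : ℕ) : ℝ) ^ (1 - γ)) {K : ℕ} (hK : 1 ≤ K) (hKr : K ≤ r) :
    ∑ k ∈ Finset.Icc 1 K, ∑ n ∈ Finset.Ioc (r ^ 2) (2 * r ^ 7), ∑ j ∈ Finset.Ico 1 (r ^ 2),
      corr (phase γ (k * α) l) (r ^ 14) (n + j) n ≤ 6 * 10 ^ 4 * (C * A ^ 3 * K * r ^ 14) := by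
  have hr := h.cast_pos
  have hA := h.one_le_A
  have hC := h.one_le
  have hr18 := h.eighteen_le
  set Y := 2 * r ^ 7 with hY
  have hY0 : 0 < Y := by positivity
  have hY15 : (Y : ℝ) ≤ r ^ 15 := by
    have : Y ≤ r ^ 15 := by
      calc Y ≤ r * r ^ 7 := by rw [hY]; gcongr; omega
        _ = r ^ 8 := by ring
        _ ≤ r ^ 15 := Nat.pow_le_pow_right (by omega) (by norm_num)
    exact_mod_cast this
  have hlogY : ((Nat.log 2 Y + 1 : ℕ) : ℝ) ≤ 2 * A := by
    have h1 : (2 : ℝ) ^ Nat.log 2 Y ≤ Y := by exact_mod_cast Nat.pow_log_le_self 2 hY0.ne'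
    have h2 := Real.log_le_log (by positivity) h1
    rw [Real.log_pow] at h2
    have h3 := h.log_le_of_le (by exact_mod_cast hY0) hY15
    have h4 := Real.log_two_gt_d9
    have h5 : (0 : ℝ) ≤ Nat.log 2 Y := Nat.cast_nonneg _
    push_cast
    nlinarith
  calc _ = ∑ k ∈ Finset.Icc 1 K, ∑ i ∈ Finset.range (Nat.log 2 Y + 1),
        ∑ n ∈ (Finset.Ioc (r ^ 2) Y).filter (fun n => Nat.log 2 n = i), ∑ j ∈ Finset.Ico 1 (r ^ 2),
          corr (phase γ (k * α) l) (r ^ 14) (n + j) n := by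
        refine Finset.sum_congr rfl fun k _ => ?_
        rw [Finset.sum_fiberwise_of_maps_to]
        intro n hn
        exact Finset.mem_range.2 (Nat.lt_succ_of_le (Nat.log_mono_right (Finset.mem_Ioc.1 hn).2))
    _ = ∑ i ∈ Finset.range (Nat.log 2 Y + 1), ∑ k ∈ Finset.Icc 1 K,
        ∑ n ∈ (Finset.Ioc (r ^ 2) Y).filter (fun n => Nat.log 2 n = i), ∑ j ∈ Finset.Ico 1 (r ^ 2),
          corr (phase γ (k * α) l) (r ^ 14) (n + j) n := Finset.sum_comm
    _ ≤ ∑ i ∈ Finset.range (Nat.log 2 Y + 1), 3 * 10 ^ 4 * (C * A ^ 2 * K * r ^ 14) := by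
        refine Finset.sum_le_sum fun i hi => ?_
        set P := (Finset.Ioc (r ^ 2) Y).filter (fun n => Nat.log 2 n = i) with hP
        have hPn : ∀ n ∈ P, 2 ^ i ≤ n ∧ n < 2 * 2 ^ i ∧ n ≤ Y ∧ r ^ 2 < n := by
          intro n hn
          obtain ⟨h1, rfl⟩ := Finset.mem_filter.1 hn
          obtain ⟨h2, h3⟩ := Finset.mem_Ioc.1 h1
          refine ⟨Nat.pow_log_le_self 2 (by omega), ?_, h3, h2⟩
          rw [← pow_succ']
          exact Nat.lt_pow_succ_log_self (by norm_num) n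
        rcases P.eq_empty_or_nonempty with hP0 | ⟨n₀, hn₀⟩
        · rw [hP0]
          simp only [Finset.sum_empty, Finset.sum_const_zero]
          positivity
        · have := hPn n₀ hn₀
          exact h.sum_range_corr_dyadic_le hγ0 hγ1 hl hK hKr (2 ^ i) (by omega) (by omega) P
            fun n hn => ⟨(hPn n hn).1, (hPn n hn).2.1, (hPn n hn).2.2.1⟩
    _ = ((Nat.log 2 Y + 1 : ℕ) : ℝ) * (3 * 10 ^ 4 * (C * A ^ 2 * K * r ^ 14)) := by
        rw [Finset.sum_const, Finset.card_range, nsmul_eq_mul]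
    _ ≤ 2 * A * (3 * 10 ^ 4 * (C * A ^ 2 * K * r ^ 14)) := by gcongr
    _ = _ := by ring

theorem four_mul_pow_le (h : IsScale α A C a q r) : 4 * r ^ 14 ≤ r ^ 15 := by
  rw [pow_succ' r 14]
  exact Nat.mul_le_mul_right _ (by have := h.eighteen_le; omega)

/-- Vaughan's bound at the scale `r`. -/
theorem norm_sum_vonMangoldt_mul_le (h : IsScale α A C a q r) (w : ℕ → ℂ) (hw : ∀ n, ‖w n‖ ≤ 1)
    (T : ℕ → ℝ) (D : ℝ) (hT0 : ∀ m, 0 ≤ T m)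
    (hT : ∀ m ∈ Finset.Icc 1 (r ^ 2), ∀ a b, r ^ 14 / m < a → b ≤ 4 * r ^ 14 / m + 1 →
      ‖∑ e ∈ Finset.Ico a b, w (m * e)‖ ≤ T m)
    (hD : ∑ n ∈ Finset.Ioc (r ^ 2) (2 * r ^ 7), ∑ j ∈ Finset.Ico 1 (r ^ 2),
      corr w (r ^ 14) (n + j) n ≤ D) :
    ‖∑ n ∈ Finset.Ioc (r ^ 14) (4 * r ^ 14), (ArithmeticFunction.vonMangoldt n : ℂ) * w n‖ ≤
      2 * A * ∑ m ∈ Finset.Icc 1 (r ^ 2), T m + 16 * A ^ 3 * √((r : ℝ) ^ 12 * (r ^ 14 + D)) := by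
  have hr := h.cast_pos
  have h18 := h.eighteen_le
  have hr1 : 1 ≤ r := by omega
  have := _root_.norm_sum_vonMangoldt_mul_le w hw (r ^ 14) (r ^ 2) (2 * r ^ 7) A D T
    (Nat.one_le_pow _ _ hr1) ?_ ?_ (le_of_eq (by ring)) ?_ ?_ ?_ hT0 hT hD
  · refine this.trans (le_of_eq ?_)
    push_cast
    congr 3
    field_simp
  · rw [← pow_mul]; exact Nat.pow_le_pow_right hr1 (by norm_num)
  · calc r ^ 2 ≤ r ^ 7 := Nat.pow_le_pow_right hr1 (by norm_num)
      _ ≤ 2 * r ^ 7 := by omega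
  · calc 2 * r ^ 7 ≤ 4 * r ^ 7 := by omega
      _ ≤ 4 * r ^ 14 := by gcongr; norm_num
  · refine h.log_le_of_le (by positivity) ?_
    exact_mod_cast h.four_mul_pow_le
  · intro n hn
    have := Finset.mem_Ioc.1 hn
    exact h.card_divisors_le n this.1 (this.2.trans h.four_mul_pow_le)

theorem sum_norm_sum_vonMangoldt_le (h : IsScale α A C a q r) {γ l : ℝ} (hγ0 : 0 < γ) (hγ1 : γ < 1)
    (hl : |l| ≤ C * ((r ^ 14 : ℕ) : ℝ) ^ (1 - γ)) {K : ℕ} (hK : 1 ≤ K) (hKr : K ≤ r) :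
    ∑ k ∈ Finset.Icc 1 K, ‖∑ n ∈ Finset.Ioc (r ^ 14) (4 * r ^ 14),
      (ArithmeticFunction.vonMangoldt n : ℂ) * phase γ (k * α) l n‖ ≤
      3 * 10 ^ 4 * (C * A ^ 5 * K * r ^ 13) := by
  have hr := h.cast_pos
  have hA := h.one_le_A
  have hC := h.one_le
  have h18 := h.eighteen_le
  have hr1 : (1 : ℝ) ≤ r := by exact_mod_cast (by norm_num : 1 ≤ 18).trans h18
  set D : ℕ → ℝ := fun k => ∑ n ∈ Finset.Ioc (r ^ 2) (2 * r ^ 7), ∑ j ∈ Finset.Ico 1 (r ^ 2),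
    corr (phase γ (k * α) l) (r ^ 14) (n + j) n with hD
  have hD0 : ∀ k, 0 ≤ D k := fun k => Finset.sum_nonneg fun _ _ => Finset.sum_nonneg fun _ _ =>
    corr_nonneg _ _ _ _
  have hDsum : ∑ k ∈ Finset.Icc 1 K, D k ≤ 6 * 10 ^ 4 * (C * A ^ 3 * K * r ^ 14) :=
    h.sum_corr_le hγ0 hγ1 hl hK hKr
  set T : ℕ → ℕ → ℝ := fun k m => √(5 * ((r ^ 14 : ℕ) / m) / (r ^ 4 : ℕ) *
    (4 * ((r ^ 14 : ℕ) / m) + 2 * ∑ j ∈ Finset.Ico 1 (r ^ 4),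
      cappedBound (4 * (r ^ 14 : ℕ)) 729 (r ^ 14 : ℕ) (C / r ^ 6) (2 * (k * α * m ^ 2) * j))) with hTdef
  have hTsum : ∑ k ∈ Finset.Icc 1 K, ∑ m ∈ Finset.Icc 1 (r ^ 2), T k m ≤
      10 ^ 4 * (C * A ^ 3 * K * r ^ 12) := h.sum_typeI_le hK hKr
  have hk : ∀ k ∈ Finset.Icc 1 K, ‖∑ n ∈ Finset.Ioc (r ^ 14) (4 * r ^ 14),
      (ArithmeticFunction.vonMangoldt n : ℂ) * phase γ (k * α) l n‖ ≤
      2 * A * ∑ m ∈ Finset.Icc 1 (r ^ 2), T k m + 16 * A ^ 3 * √((r : ℝ) ^ 12 * (r ^ 14 + D k)) := by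
    intro k _
    refine h.norm_sum_vonMangoldt_mul_le _ (fun n => (norm_phase _ _ _ _).le) (T k) (D k)
      (fun m => Real.sqrt_nonneg _) ?_ le_rfl
    intro m hm a b ha hb
    obtain ⟨hm1, hm2⟩ := Finset.mem_Icc.1 hm
    have hm0 : (0 : ℝ) < m := by exact_mod_cast hm1
    have hm2' : (m : ℝ) ≤ r ^ 2 := by exact_mod_cast hm2
    refine Real.le_sqrt_of_sq_le ?_
    refine norm_sum_phase_mul_sq_le hγ0 hγ1 (k * α) l (C / r ^ 6) (r ^ 14) m a b (r ^ 4) hm1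
      (Nat.one_le_pow _ _ (by omega)) ?_ ha hb ?_ ?_
    · push_cast
      rw [le_div_iff₀ hm0]
      calc (r : ℝ) ^ 4 * (m : ℝ) ≤ (r : ℝ) ^ 4 * (r : ℝ) ^ 2 := by gcongr
        _ = (r : ℝ) ^ 6 := by ring
        _ ≤ (r : ℝ) ^ 14 := pow_le_pow_right₀ hr1 (by norm_num)
    · set N : ℝ := ((r ^ 14 : ℕ) : ℝ) with hN
      have hN' : N = (r : ℝ) ^ 14 := by rw [hN]; push_cast; rfl
      have hN0 : 0 < N := by rw [hN']; positivity
      have hpow : N ^ (1 - γ) * N ^ (γ - 2) = N⁻¹ := by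
        rw [← Real.rpow_add hN0, ← Real.rpow_neg_one]; congr 1; ring
      calc |l| * m ^ 2 * (r ^ 4 : ℕ) * N ^ (γ - 2) ≤
          (C * N ^ (1 - γ)) * (r ^ 2) ^ 2 * (r ^ 4 : ℕ) * N ^ (γ - 2) := by gcongr
        _ = C * (r ^ 2) ^ 2 * (r ^ 4 : ℕ) * (N ^ (1 - γ) * N ^ (γ - 2)) := by ring
        _ = C / r ^ 6 := by rw [hpow, hN']; push_cast; field_simp
    · rw [div_le_iff₀ (by positivity)]
      have h1 : (r : ℝ) ≤ r ^ 6 := le_self_pow₀ hr1 (by norm_num)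
      have := h.le_scale
      linarith
  have hsqrt : ∑ k ∈ Finset.Icc 1 K, √((r : ℝ) ^ 12 * (r ^ 14 + D k)) ≤ 300 * (C * A ^ 2 * K * r ^ 13) := by
    refine (abs_le_of_sq_le_sq' (sq_sum_le_card_mul_sum_sq.trans ?_) (by positivity)).2
    rw [Finset.sum_congr rfl fun k _ => Real.sq_sqrt (by have := hD0 k; positivity),
      ← Finset.mul_sum, Finset.sum_add_distrib, Finset.sum_const, Nat.card_Icc, Nat.add_sub_cancel,
      nsmul_eq_mul]
    have f : (K : ℝ) * r ^ 14 ≤ C * A ^ 3 * K * r ^ 14 := by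
      have : 1 ≤ C * A ^ 3 := one_le_mul_of_one_le_of_one_le hC (one_le_pow₀ hA)
      rw [mul_assoc (C * A ^ 3)]
      exact le_mul_of_one_le_left (by positivity) this
    calc (K : ℝ) * (r ^ 12 * (K * r ^ 14 + ∑ k ∈ Finset.Icc 1 K, D k)) ≤
        (K : ℝ) * (r ^ 12 * (C * A ^ 3 * K * r ^ 14 + 6 * 10 ^ 4 * (C * A ^ 3 * K * r ^ 14))) := by
          gcongr
      _ = 60001 * (C * 1 * A ^ 3 * K ^ 2 * r ^ 26) := by ring
      _ ≤ 90000 * (C * C * A ^ 4 * K ^ 2 * r ^ 26) := by gcongr <;> norm_num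
      _ = _ := by ring
  calc _ ≤ ∑ k ∈ Finset.Icc 1 K, (2 * A * ∑ m ∈ Finset.Icc 1 (r ^ 2), T k m +
        16 * A ^ 3 * √((r : ℝ) ^ 12 * (r ^ 14 + D k))) := Finset.sum_le_sum hk
    _ = 2 * A * ∑ k ∈ Finset.Icc 1 K, ∑ m ∈ Finset.Icc 1 (r ^ 2), T k m +
        16 * A ^ 3 * ∑ k ∈ Finset.Icc 1 K, √((r : ℝ) ^ 12 * (r ^ 14 + D k)) := by
        rw [Finset.sum_add_distrib, Finset.mul_sum, Finset.mul_sum]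
    _ ≤ 2 * A * (10 ^ 4 * (C * A ^ 3 * K * r ^ 12)) +
        16 * A ^ 3 * (300 * (C * A ^ 2 * K * r ^ 13)) := by gcongr
    _ = 20000 * (C * A ^ 4 * K * r ^ 12) + 4800 * (C * A ^ 5 * K * r ^ 13) := by ring
    _ ≤ 20000 * (C * A ^ 5 * K * r ^ 13) + 4800 * (C * A ^ 5 * K * r ^ 13) := by
        gcongr <;> norm_num
    _ ≤ _ := by
        have : 0 ≤ C * A ^ 5 * K * (r : ℝ) ^ 13 := by positivity
        linarith

theorem abs_mul_rpow_le (h : IsScale α A C a q r) {γ l N : ℝ} (hl : |l| ≤ C * N ^ (1 - γ))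
    (hN' : N = (r : ℝ) ^ 14) : |l| * N ^ γ ≤ C * r ^ 14 := by
  have hr := h.cast_pos
  have hN0 : 0 < N := by rw [hN']; positivity
  calc |l| * N ^ γ ≤ C * N ^ (1 - γ) * N ^ γ := by gcongr
    _ = C * (N ^ (1 - γ) * N ^ γ) := by ring
    _ = C * r ^ 14 := by rw [← Real.rpow_add hN0, sub_add_cancel, Real.rpow_one, hN']

theorem le_abs_mul_rpow (h : IsScale α A C a q r) {γ l N : ℝ} (hγ : 13 / 14 < γ) (hl1 : 1 ≤ |l|)
    (hN' : N = (r : ℝ) ^ 14) : (r : ℝ) ^ 13 ≤ |l| * N ^ γ := by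
  have hr := h.cast_pos
  have hr1 : (1 : ℝ) ≤ r := by exact_mod_cast (by norm_num : 1 ≤ 18).trans h.eighteen_le
  have hNγ : (r : ℝ) ^ 13 ≤ N ^ γ := by
    rw [hN', ← Real.rpow_natCast, ← Real.rpow_natCast, ← Real.rpow_mul hr.le]
    apply Real.rpow_le_rpow_of_exponent_le hr1
    push_cast
    linarith
  have hN0 : 0 < N := by rw [hN']; positivity
  exact hNγ.trans (le_mul_of_one_le_left (by positivity) hl1)

theorem _root_.phase_zero_mul (γ l : ℝ) (m e : ℕ) :
    phase γ 0 l (m * e) = ee (l * (m : ℝ) ^ γ * (e : ℝ) ^ γ) := by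
  rw [phase_mul]
  congr 1
  ring

/-- Type I sums for `n ↦ ee (l * n ^ γ)`. -/
theorem norm_sum_phase_zero_le (h : IsScale α A C a q r) {γ l N c : ℝ}
    (hγ : 13 / 14 < γ) (hγ1 : γ < 1) (hl1 : 1 ≤ |l|) (hl : |l| ≤ C * N ^ (1 - γ))
    (hN : N = ((r ^ 14 : ℕ) : ℝ)) (hc : c = 25 / √(γ * (1 - γ))) (hc1 : 1 ≤ c) (hl0 : l ≠ 0)
    {m : ℕ} (hm : m ∈ Finset.Icc 1 (r ^ 2)) {a b : ℕ} (ha : r ^ 14 / m < a)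
    (hb : b ≤ 4 * r ^ 14 / m + 1) :
    ‖∑ e ∈ Finset.Ico a b, phase γ 0 l (m * e)‖ ≤ c * (3 * (C * r ^ 8)) := by
  have hr := h.cast_pos
  have hC := h.one_le
  have h18 := h.eighteen_le
  have h32 := h.le_scale
  have hr1 : (1 : ℝ) ≤ r := by exact_mod_cast (by norm_num : 1 ≤ 18).trans h18
  have hγ0 : 0 < γ := by linarith
  have hN' : N = (r : ℝ) ^ 14 := by rw [hN]; push_cast; rfl
  have hN0 : 0 < N := by rw [hN']; positivity
  have hlN : |l| * N ^ γ ≤ C * r ^ 14 := h.abs_mul_rpow_le hl hN'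
  have hNγ : (r : ℝ) ^ 13 ≤ N ^ γ := by
    simpa using h.le_abs_mul_rpow (l := 1) hγ (by simp) hN'
  have hlN' : (r : ℝ) ^ 13 ≤ |l| * N ^ γ := h.le_abs_mul_rpow hγ hl1 hN'
  have hphase := phase_zero_mul γ l
  obtain ⟨hm1, hm2⟩ := Finset.mem_Icc.1 hm
  have hm0 : (0 : ℝ) < m := by exact_mod_cast hm1
  have hm1' : (1 : ℝ) ≤ m := by exact_mod_cast hm1
  have hm2' : (m : ℝ) ≤ r ^ 2 := by exact_mod_cast hm2
  simp_rw [hphase]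
  have hM : (r : ℝ) ^ 12 ≤ N / m := by
    rw [le_div_iff₀ hm0, hN']
    calc (r : ℝ) ^ 12 * (m : ℝ) ≤ (r : ℝ) ^ 12 * (r : ℝ) ^ 2 := by gcongr
      _ = (r : ℝ) ^ 14 := by ring
  have hP : |l * (m : ℝ) ^ γ| * (N / m) ^ γ = |l| * N ^ γ := by
    rw [abs_mul, abs_of_nonneg (by positivity : (0 : ℝ) ≤ (m : ℝ) ^ γ),
      Real.div_rpow hN0.le hm0.le]
    have : (0 : ℝ) < (m : ℝ) ^ γ := by positivity
    field_simp
  refine (norm_sum_rpow_le hγ0 hγ1 (l * (m : ℝ) ^ γ) (N / m) a b ((one_le_pow₀ hr1).trans hM)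
    (hN ▸ div_lt_cast_of_div_lt hm1 ha)
      (hN ▸ cast_le_of_le_div hb) (by positivity) ?_).trans ?_
  · rw [hP]
    calc |l| * N ^ γ ≤ C * r ^ 14 := hlN
      _ ≤ (r / 4) * r ^ 14 := by gcongr; linarith
      _ = r ^ 15 / 4 := by ring
      _ ≤ (r : ℝ) ^ 24 / 4 := by
        gcongr
        norm_num
      _ = ((r : ℝ) ^ 12) ^ 2 / 4 := by ring
      _ ≤ _ := by gcongr
  · rw [hP, ← hc]
    have e1 : √(|l| * N ^ γ) ≤ C * r ^ 7 := by
      rw [Real.sqrt_le_iff]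
      refine ⟨by positivity, hlN.trans ?_⟩
      calc C * (r : ℝ) ^ 14 = C * 1 * r ^ 14 := by ring
        _ ≤ C * C * r ^ 14 := by gcongr
        _ = _ := by ring
    have e2 : (r : ℝ) ^ 6 ≤ √(|l| * N ^ γ) := by
      apply Real.le_sqrt_of_sq_le
      refine le_trans ?_ hlN'
      rw [← pow_mul]
      exact pow_le_pow_right₀ hr1 (by norm_num)
    have e3 : 2 * (N / m) / √(|l| * N ^ γ) ≤ 2 * r ^ 8 := by
      calc 2 * (N / m) / √(|l| * N ^ γ) ≤ 2 * N / r ^ 6 := by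
            gcongr
            exact div_le_self hN0.le hm1'
        _ = 2 * r ^ 8 := by rw [hN']; field_simp
    gcongr
    calc √(|l| * N ^ γ) + 2 * (N / m) / √(|l| * N ^ γ) ≤ C * r ^ 7 + 2 * r ^ 8 := add_le_add e1 e3
      _ = C * r ^ 7 + 2 * (1 * r ^ 8) := by ring
      _ ≤ C * r ^ 8 + 2 * (C * r ^ 8) := by gcongr; norm_num
      _ = _ := by ring

/-- Type II correlations for `n ↦ ee (l * n ^ γ)`. -/
theorem corr_phase_zero_le (h : IsScale α A C a q r) {γ l N c : ℝ}
    (hγ : 13 / 14 < γ) (hγ1 : γ < 1) (hl1 : 1 ≤ |l|) (hl : |l| ≤ C * N ^ (1 - γ))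
    (hN : N = ((r ^ 14 : ℕ) : ℝ)) (hc : c = 25 / √(γ * (1 - γ))) (hc1 : 1 ≤ c) (hl0 : l ≠ 0)
    {n : ℕ} (hn : n ∈ Finset.Ioc (r ^ 2) (2 * r ^ 7)) {m : ℕ} (hm : m ∈ Finset.Ico 1 (r ^ 2)) :
    corr (phase γ 0 l) (r ^ 14) (n + m) n ≤ 5 * (c * C * r ^ 8) * (√n)⁻¹ := by
  have hr := h.cast_pos
  have hC := h.one_le
  have h18 := h.eighteen_le
  have h32 := h.le_scale
  have hr1 : (1 : ℝ) ≤ r := by exact_mod_cast (by norm_num : 1 ≤ 18).trans h18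
  have hγ0 : 0 < γ := by linarith
  have hN' : N = (r : ℝ) ^ 14 := by rw [hN]; push_cast; rfl
  have hN0 : 0 < N := by rw [hN']; positivity
  have hlN : |l| * N ^ γ ≤ C * r ^ 14 := h.abs_mul_rpow_le hl hN'
  have hNγ : (r : ℝ) ^ 13 ≤ N ^ γ := by
    simpa using h.le_abs_mul_rpow (l := 1) hγ (by simp) hN'
  have hlN' : (r : ℝ) ^ 13 ≤ |l| * N ^ γ := h.le_abs_mul_rpow hγ hl1 hN'
  have hphase := phase_zero_mul γ l
  obtain ⟨hn1, hn2⟩ := Finset.mem_Ioc.1 hn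
  obtain ⟨hm1, hm2⟩ := Finset.mem_Ico.1 hm
  have hn0 : 0 < n := by omega
  have hn0' : (0 : ℝ) < n := by exact_mod_cast hn0
  have hm0 : (0 : ℝ) < m := by exact_mod_cast hm1
  have hm1' : (1 : ℝ) ≤ m := by exact_mod_cast hm1
  have hmn : (m : ℝ) ≤ n := by exact_mod_cast (hm2.trans hn1).le
  have hm2' : (m : ℝ) ≤ r ^ 2 := by exact_mod_cast hm2.le
  have hn2' : (n : ℝ) ≤ 2 * r ^ 7 := by exact_mod_cast hn2
  have hterm : ∀ e : ℕ, phase γ 0 l (e * (n + m)) * (starRingEnd ℂ) (phase γ 0 l (e * n)) =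
      ee (l * (((n : ℝ) + m) ^ γ - (n : ℝ) ^ γ) * (e : ℝ) ^ γ) := by
    intro e
    rw [mul_comm e, mul_comm e, hphase, hphase, ← ee_sub]
    congr 1
    push_cast
    ring
  have hIoc : Finset.Ioc (r ^ 14 / n) (4 * r ^ 14 / (n + m)) =
      Finset.Ico (r ^ 14 / n + 1) (4 * r ^ 14 / (n + m) + 1) := by
    ext; simp only [Finset.mem_Ioc, Finset.mem_Ico]; omega
  rw [corr_add_eq _ _ _ _ hn0, hIoc]
  simp_rw [hterm]
  obtain ⟨ξ, hξ1, hξ2, hξ⟩ := exists_rpow_diff (γ := γ) hn0' hm0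
  have hξ0 : 0 < ξ := hn0'.trans hξ1
  set B := l * (((n : ℝ) + m) ^ γ - (n : ℝ) ^ γ) with hB
  have hBabs : |B| = |l| * (m * (γ * ξ ^ (γ - 1))) := by
    rw [hB, hξ, abs_mul, abs_of_nonneg (by positivity : 0 ≤ (m : ℝ) * (γ * ξ ^ (γ - 1)))]
  have hpow : (n : ℝ) ^ (γ - 1) * (N / n) ^ γ = N ^ γ / n := by
    rw [Real.div_rpow hN0.le hn0'.le, Real.rpow_sub hn0', Real.rpow_one]
    have : (0 : ℝ) < (n : ℝ) ^ γ := by positivity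
    field_simp
  have hPu : |B| * (N / n) ^ γ ≤ C * r ^ 16 / n := by
    have h1 : γ * ξ ^ (γ - 1) ≤ 1 * (n : ℝ) ^ (γ - 1) :=
      mul_le_mul hγ1.le (Real.rpow_le_rpow_of_nonpos hn0' hξ1.le (by linarith))
        (by positivity) zero_le_one
    calc |B| * (N / n) ^ γ ≤ |l| * (r ^ 2 * (1 * (n : ℝ) ^ (γ - 1))) * (N / n) ^ γ := by
          rw [hBabs]; gcongr
      _ = |l| * r ^ 2 * ((n : ℝ) ^ (γ - 1) * (N / n) ^ γ) := by ring
      _ = (|l| * N ^ γ) * r ^ 2 / n := by rw [hpow]; ring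
      _ ≤ (C * r ^ 14) * r ^ 2 / n := by gcongr
      _ = _ := by ring
  have hPl : (r : ℝ) ^ 13 / (4 * n) ≤ |B| * (N / n) ^ γ := by
    have h1 : 1 / 2 * (n : ℝ) ^ (γ - 1) ≤ ξ ^ (γ - 1) := by
      calc 1 / 2 * (n : ℝ) ^ (γ - 1) = (2 : ℝ) ^ (-1 : ℝ) * (n : ℝ) ^ (γ - 1) := by
            rw [Real.rpow_neg_one]; norm_num
        _ ≤ (2 : ℝ) ^ (γ - 1) * (n : ℝ) ^ (γ - 1) := by
            gcongr
            · norm_num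
            · linarith
        _ = (2 * (n : ℝ)) ^ (γ - 1) := by rw [Real.mul_rpow (by norm_num) hn0'.le]
        _ ≤ ξ ^ (γ - 1) := Real.rpow_le_rpow_of_nonpos hξ0 (by linarith) (by linarith)
    calc (r : ℝ) ^ 13 / (4 * n) ≤ N ^ γ / (4 * n) := by gcongr
      _ = 1 * (1 * (1 / 2 * (1 / 2 * (N ^ γ / n)))) := by ring
      _ = 1 * (1 * (1 / 2 * (1 / 2 * (n : ℝ) ^ (γ - 1)))) * (N / n) ^ γ := by rw [← hpow]; ring
      _ ≤ |l| * (m * (γ * ξ ^ (γ - 1))) * (N / n) ^ γ := by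
          gcongr
          linarith
      _ = _ := by rw [hBabs]
  have hB0 : B ≠ 0 := by
    intro h0
    rw [h0, abs_zero, zero_mul] at hPl
    have : (0 : ℝ) < r ^ 13 / (4 * n) := by positivity
    linarith
  have hsn : 0 < √(n : ℝ) := Real.sqrt_pos.2 hn0'
  have hsn2 : √(n : ℝ) ^ 2 = n := Real.sq_sqrt hn0'.le
  refine (norm_sum_rpow_le hγ0 hγ1 B (N / n) _ _ ?_
    (hN ▸ div_lt_cast_of_div_lt hn0 (Nat.lt_succ_self _))
    (hN ▸ cast_le_of_le_div (Nat.succ_le_succ (Nat.div_le_div_left (by omega) hn0))) hB0 ?_).trans ?_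
  · rw [le_div_iff₀ hn0', one_mul, hN']
    refine hn2'.trans ?_
    calc 2 * (r : ℝ) ^ 7 ≤ r * (r : ℝ) ^ 7 := by gcongr; linarith
      _ = (r : ℝ) ^ 8 := by ring
      _ ≤ (r : ℝ) ^ 14 := pow_le_pow_right₀ hr1 (by norm_num)
  · refine hPu.trans ?_
    rw [div_pow, hN', div_div, div_le_div_iff₀ hn0' (by positivity)]
    calc C * (r : ℝ) ^ 16 * ((n : ℝ) ^ 2 * 4) = C * r ^ 16 * 4 * n * n := by ring
      _ ≤ C * r ^ 16 * 4 * (2 * r ^ 7) * n := by gcongr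
      _ = (8 * C) * r ^ 23 * n := by ring
      _ ≤ r * r ^ 23 * n := by gcongr; linarith
      _ = (r : ℝ) ^ 24 * n := by ring
      _ ≤ (r : ℝ) ^ 28 * n := by
        gcongr
        norm_num
      _ = ((r : ℝ) ^ 14) ^ 2 * n := by ring
  · rw [← hc]
    have e1 : √(|B| * (N / n) ^ γ) ≤ C * r ^ 8 * (√n)⁻¹ := by
      rw [Real.sqrt_le_iff]
      refine ⟨by positivity, hPu.trans ?_⟩
      rw [mul_pow, inv_pow, hsn2]
      calc C * (r : ℝ) ^ 16 / n = C * 1 * r ^ 16 * (n : ℝ)⁻¹ := by ring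
        _ ≤ C * C * r ^ 16 * (n : ℝ)⁻¹ := by gcongr
        _ = _ := by ring
    have e2 : (r : ℝ) ^ 6 * (2 * √n)⁻¹ ≤ √(|B| * (N / n) ^ γ) := by
      apply Real.le_sqrt_of_sq_le
      refine le_trans ?_ hPl
      rw [mul_pow, inv_pow, mul_pow, hsn2, ← pow_mul, div_eq_mul_inv]
      norm_num only
      gcongr
      norm_num
    have e3 : 2 * (N / n) / √(|B| * (N / n) ^ γ) ≤ 4 * r ^ 8 * (√n)⁻¹ := by
      calc 2 * (N / n) / √(|B| * (N / n) ^ γ) ≤ 2 * (N / n) / ((r : ℝ) ^ 6 * (2 * √n)⁻¹) := by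
            gcongr
        _ = 4 * r ^ 8 * (√n)⁻¹ := by
            rw [hN']
            nth_rewrite 1 [← hsn2]
            field_simp
            ring
    calc c * (√(|B| * (N / n) ^ γ) + 2 * (N / n) / √(|B| * (N / n) ^ γ)) ≤
        c * (C * r ^ 8 * (√n)⁻¹ + 4 * r ^ 8 * (√n)⁻¹) := by gcongr
      _ = c * (C * r ^ 8 * (√n)⁻¹ + 4 * (1 * r ^ 8 * (√n)⁻¹)) := by ring
      _ ≤ c * (C * r ^ 8 * (√n)⁻¹ + 4 * (C * r ^ 8 * (√n)⁻¹)) := by gcongr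
      _ = _ := by ring

theorem sum_inv_sqrt_le (h : IsScale α A C a q r) :
    ∑ n ∈ Finset.Ioc (r ^ 2) (2 * r ^ 7), (√(n : ℝ))⁻¹ ≤ 2 * r ^ 4 := by
  have hr := h.cast_pos
  have hC := h.one_le
  have h32 := h.le_scale
  have h1 : ∑ n ∈ Finset.Ioc (r ^ 2) (2 * r ^ 7), (√(n : ℝ))⁻¹ ≤
      ∑ n ∈ Finset.range (2 * r ^ 7), (√((n + 1 : ℕ) : ℝ))⁻¹ := by
    rw [Finset.range_eq_Ico, Finset.sum_Ico_add' (fun n : ℕ => (√(n : ℝ))⁻¹)]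
    refine Finset.sum_le_sum_of_subset_of_nonneg ?_ fun i _ _ => by positivity
    intro n hn
    have := Finset.mem_Ioc.1 hn
    exact Finset.mem_Ico.2 ⟨by omega, by omega⟩
  have h2 : √((2 * r ^ 7 : ℕ) : ℝ) ≤ r ^ 4 := by
    rw [Real.sqrt_le_iff]
    refine ⟨by positivity, ?_⟩
    push_cast
    calc 2 * (r : ℝ) ^ 7 ≤ r * r ^ 7 := by gcongr; linarith
      _ = _ := by ring
  have h3 := sum_inv_sqrt_succ_le (2 * r ^ 7)
  refine h1.trans (le_trans ?_ (h3.trans (by linarith)))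
  refine Finset.sum_le_sum fun n _ => ?_
  push_cast
  simp

theorem norm_sum_vonMangoldt_rpow_le (h : IsScale α A C a q r) {γ l : ℝ} (hγ : 13 / 14 < γ)
    (hγ1 : γ < 1) (hl1 : 1 ≤ |l|) (hl : |l| ≤ C * ((r ^ 14 : ℕ) : ℝ) ^ (1 - γ)) :
    ‖∑ n ∈ Finset.Ioc (r ^ 14) (4 * r ^ 14),
      (ArithmeticFunction.vonMangoldt n : ℂ) * phase γ 0 l n‖ ≤
      200 * (25 / √(γ * (1 - γ)) * C * A ^ 3 * r ^ 13) := by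
  have hr := h.cast_pos
  have hA := h.one_le_A
  have hC := h.one_le
  have h18 := h.eighteen_le
  have h32 := h.le_scale
  have hr1 : (1 : ℝ) ≤ r := by exact_mod_cast (by norm_num : 1 ≤ 18).trans h18
  have hγ0 : 0 < γ := by linarith
  set N : ℝ := ((r ^ 14 : ℕ) : ℝ) with hN
  have hN' : N = (r : ℝ) ^ 14 := by rw [hN]; push_cast; rfl
  have hN0 : 0 < N := by rw [hN']; positivity
  set c := 25 / √(γ * (1 - γ)) with hc
  have hg0 : 0 < γ * (1 - γ) := by apply mul_pos <;> linarith
  have hc1 : 1 ≤ c := by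
    rw [hc, le_div_iff₀ (Real.sqrt_pos.2 hg0), one_mul, Real.sqrt_le_iff]
    constructor
    · norm_num
    · nlinarith
  have hl0 : l ≠ 0 := by
    rintro rfl
    rw [abs_zero] at hl1
    linarith
  have hT : ∀ m ∈ Finset.Icc 1 (r ^ 2), ∀ a b, r ^ 14 / m < a → b ≤ 4 * r ^ 14 / m + 1 →
      ‖∑ e ∈ Finset.Ico a b, phase γ 0 l (m * e)‖ ≤ c * (3 * (C * r ^ 8)) :=
    fun m hm a b ha hb => h.norm_sum_phase_zero_le hγ hγ1 hl1 hl hN hc hc1 hl0 hm ha hb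
  have hcorr : ∀ n ∈ Finset.Ioc (r ^ 2) (2 * r ^ 7), ∀ m ∈ Finset.Ico 1 (r ^ 2),
      corr (phase γ 0 l) (r ^ 14) (n + m) n ≤ 5 * (c * C * r ^ 8) * (√n)⁻¹ :=
    fun n hn m hm => h.corr_phase_zero_le hγ hγ1 hl1 hl hN hc hc1 hl0 hn hm
  have hsum := h.sum_inv_sqrt_le
  have hD : ∑ n ∈ Finset.Ioc (r ^ 2) (2 * r ^ 7), ∑ j ∈ Finset.Ico 1 (r ^ 2),
      corr (phase γ 0 l) (r ^ 14) (n + j) n ≤ 10 * (c * C * r ^ 14) := by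
    calc _ ≤ ∑ n ∈ Finset.Ioc (r ^ 2) (2 * r ^ 7), ∑ j ∈ Finset.Ico 1 (r ^ 2),
          5 * (c * C * r ^ 8) * (√(n : ℝ))⁻¹ :=
          Finset.sum_le_sum fun n hn => Finset.sum_le_sum fun j hj => hcorr n hn j hj
      _ = ((r ^ 2 - 1 : ℕ) : ℝ) * (5 * (c * C * r ^ 8)) *
          ∑ n ∈ Finset.Ioc (r ^ 2) (2 * r ^ 7), (√(n : ℝ))⁻¹ := by
          rw [Finset.mul_sum]
          refine Finset.sum_congr rfl fun n _ => ?_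
          rw [Finset.sum_const, Nat.card_Ico, nsmul_eq_mul]; ring
      _ ≤ r ^ 2 * (5 * (c * C * r ^ 8)) * (2 * r ^ 4) := by
          have : ((r ^ 2 - 1 : ℕ) : ℝ) ≤ r ^ 2 := by exact_mod_cast Nat.sub_le _ _
          gcongr
      _ = _ := by ring
  refine (h.norm_sum_vonMangoldt_mul_le (phase γ 0 l) (fun n => (norm_phase _ _ _ _).le)
    (fun _ => c * (3 * (C * r ^ 8))) (10 * (c * C * r ^ 14)) (fun _ => by positivity) hT hD).trans ?_
  rw [Finset.sum_const, Nat.card_Icc, Nat.add_sub_cancel, nsmul_eq_mul]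
  have hcC : 1 ≤ c * C := one_le_mul_of_one_le_of_one_le hc1 hC
  have e1 : √((r : ℝ) ^ 12 * (r ^ 14 + 10 * (c * C * r ^ 14))) ≤ 11 * (c * C * r ^ 13) := by
    rw [Real.sqrt_le_iff]
    refine ⟨by positivity, ?_⟩
    calc (r : ℝ) ^ 12 * (r ^ 14 + 10 * (c * C * r ^ 14)) = (1 * 1 + 10 * (c * C * 1)) * r ^ 26 := by ring
      _ ≤ ((c * C) * (c * C) + 10 * (c * C * (c * C))) * r ^ 26 := by gcongr
      _ ≤ 121 * (c * C * (c * C)) * r ^ 26 := by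
          gcongr
          nlinarith
      _ = _ := by ring
  calc 2 * A * (((r ^ 2 : ℕ) : ℝ) * (c * (3 * (C * r ^ 8)))) +
      16 * A ^ 3 * √((r : ℝ) ^ 12 * (r ^ 14 + 10 * (c * C * r ^ 14))) ≤
      2 * A * (((r ^ 2 : ℕ) : ℝ) * (c * (3 * (C * r ^ 8)))) + 16 * A ^ 3 * (11 * (c * C * r ^ 13)) := by
        gcongr
    _ = 6 * (c * C * A * r ^ 10) + 176 * (c * C * A ^ 3 * r ^ 13) := by push_cast; ring
    _ ≤ 6 * (c * C * A ^ 3 * r ^ 13) + 176 * (c * C * A ^ 3 * r ^ 13) := by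
        have : A ≤ A ^ 3 := le_self_pow₀ hA (by norm_num)
        gcongr
        norm_num
    _ ≤ _ := by
        have : 0 ≤ c * C * A ^ 3 * (r : ℝ) ^ 13 := by positivity
        linarith

end IsScale

theorem four_mul_nint_le_norm (x : ℝ) : 4 * nint x ≤ ‖ee x - 1‖ := by
  have h1 : ee x = ee (x - round x) := by
    rw [← ee_add_int (x - round x) (round x)]; congr 1; ring
  rw [h1, norm_ee_sub_one, nint]
  have h2 : |x - round x| ≤ 1 / 2 := abs_sub_round x
  have h3 := two_mul_le_sin_pi_mul (abs_nonneg (x - round x)) le_rfl (by linarith)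
  have h4 : |Real.sin (Real.pi * (x - round x))| = |Real.sin (Real.pi * |x - round x|)| := by
    rcases abs_cases (x - round x) with ⟨h, _⟩ | ⟨h, _⟩ <;> rw [h]
    rw [mul_neg, Real.sin_neg, abs_neg]
  rw [h4]
  have := le_abs_self (Real.sin (Real.pi * |x - round x|))
  linarith

/-- The trigonometric polynomial with coefficients `a 0, …, a (n - 1)`. -/
noncomputable def trigPoly (a : ℕ → ℝ) (n : ℕ) (x : ℝ) : ℂ :=
  ∑ j ∈ Finset.range n, (a j : ℂ) * ee (j * x)

/-- The autocorrelation of `a 0, …, a (n - 1)` at lag `k`. -/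
noncomputable def autocorr (a : ℕ → ℝ) (n : ℕ) (k : ℤ) : ℝ :=
  ∑ p ∈ (Finset.range n ×ˢ Finset.range n) with (p.1 : ℤ) - p.2 = k, a p.1 * a p.2

theorem normSq_trigPoly (a : ℕ → ℝ) (n : ℕ) (x : ℝ) :
    ((‖trigPoly a n x‖ ^ 2 : ℝ) : ℂ) =
      ∑ k ∈ Finset.Ioo (-n : ℤ) n, (autocorr a n k : ℂ) * ee (k * x) := by
  have h1 : ((‖trigPoly a n x‖ ^ 2 : ℝ) : ℂ) =
      ∑ p ∈ Finset.range n ×ˢ Finset.range n,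
        ((a p.1 * a p.2 : ℝ) : ℂ) * ee (((p.1 : ℤ) - p.2 : ℤ) * x) := by
    rw [Complex.ofReal_pow, ← Complex.mul_conj', trigPoly, map_sum, Finset.sum_mul_sum,
      Finset.sum_product]
    refine Finset.sum_congr rfl fun i _ => Finset.sum_congr rfl fun j _ => ?_
    have : (((i : ℤ) - j : ℤ) : ℝ) * x = i * x - j * x := by push_cast; ring
    rw [this, ee_sub, map_mul, Complex.conj_ofReal]
    push_cast
    ring
  rw [h1, ← Finset.sum_fiberwise_of_maps_to (t := Finset.Ioo (-n : ℤ) n)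
    (g := fun p : ℕ × ℕ => (p.1 : ℤ) - p.2)]
  · refine Finset.sum_congr rfl fun k _ => ?_
    rw [autocorr, Complex.ofReal_sum, Finset.sum_mul]
    refine Finset.sum_congr rfl fun p hp => ?_
    rw [(Finset.mem_filter.1 hp).2]
  · rintro ⟨i, j⟩ hp
    simp only [Finset.mem_product, Finset.mem_range] at hp
    simp only [Finset.mem_Ioo]
    omega

theorem autocorr_zero (a : ℕ → ℝ) (n : ℕ) :
    autocorr a n 0 = ∑ j ∈ Finset.range n, a j ^ 2 := by
  rw [autocorr]
  refine (Finset.sum_nbij (fun j => (j, j)) ?_ ?_ ?_ ?_).symm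
  · intro j hj; simpa using hj
  · intro i _ j _ h; simpa using h
  · rintro ⟨i, j⟩ hp
    simp only [Finset.coe_filter, Finset.mem_product, Finset.mem_range, Set.mem_ofPred_eq] at hp
    obtain ⟨⟨h1, h2⟩, h3⟩ := hp
    refine ⟨i, by simpa using h1, ?_⟩
    simp only [Prod.mk.injEq, true_and]
    omega
  · intro j _; ring

theorem abs_autocorr_le (a : ℕ → ℝ) (n : ℕ) (k : ℤ) :
    |autocorr a n k| ≤ ∑ j ∈ Finset.range n, a j ^ 2 := by
  set s := (Finset.range n ×ˢ Finset.range n).filter (fun p => (p.1 : ℤ) - p.2 = k) with hs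
  have h1 : ∑ p ∈ s, a p.1 ^ 2 ≤ ∑ j ∈ Finset.range n, a j ^ 2 := by
    rw [← Finset.sum_image (s := s) (g := fun p => p.1) (f := fun j => a j ^ 2)]
    · refine Finset.sum_le_sum_of_subset_of_nonneg ?_ fun i _ _ => sq_nonneg _
      intro i hi
      obtain ⟨p, hp, rfl⟩ := Finset.mem_image.1 hi
      exact (Finset.mem_product.1 (Finset.mem_filter.1 hp).1).1
    · rintro ⟨i, j⟩ hp ⟨i', j'⟩ hp' h
      have e1 := (Finset.mem_filter.1 hp).2
      have e2 := (Finset.mem_filter.1 hp').2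
      simp only at e1 e2 h
      simp only [Prod.mk.injEq]
      omega
  have h2 : ∑ p ∈ s, a p.2 ^ 2 ≤ ∑ j ∈ Finset.range n, a j ^ 2 := by
    rw [← Finset.sum_image (s := s) (g := fun p => p.2) (f := fun j => a j ^ 2)]
    · refine Finset.sum_le_sum_of_subset_of_nonneg ?_ fun i _ _ => sq_nonneg _
      intro i hi
      obtain ⟨p, hp, rfl⟩ := Finset.mem_image.1 hi
      exact (Finset.mem_product.1 (Finset.mem_filter.1 hp).1).2
    · rintro ⟨i, j⟩ hp ⟨i', j'⟩ hp' h
      have e1 := (Finset.mem_filter.1 hp).2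
      have e2 := (Finset.mem_filter.1 hp').2
      simp only at e1 e2 h
      simp only [Prod.mk.injEq]
      omega
  calc |autocorr a n k| ≤ ∑ p ∈ s, |a p.1 * a p.2| := Finset.abs_sum_le_sum_abs _ _
    _ ≤ ∑ p ∈ s, (a p.1 ^ 2 + a p.2 ^ 2) / 2 := by
        refine Finset.sum_le_sum fun p _ => ?_
        rw [abs_mul, ← sq_abs (a p.1), ← sq_abs (a p.2)]
        nlinarith [sq_nonneg (|a p.1| - |a p.2|)]
    _ = (∑ p ∈ s, a p.1 ^ 2 + ∑ p ∈ s, a p.2 ^ 2) / 2 := by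
        rw [← Finset.sum_div, Finset.sum_add_distrib]
    _ ≤ _ := by linarith

/-- The frequencies `(k, l) ≠ 0` with `|k| < n` and `|l| < m`. -/
noncomputable def puncturedBox (n m : ℕ) : Finset (ℤ × ℤ) :=
  (Finset.Ioo (-n : ℤ) n ×ˢ Finset.Ioo (-m : ℤ) m).erase 0

/-- Orthogonality with error for products of squares of trigonometric polynomials. -/
theorem abs_sum_normSq_trigPoly_sub_le (P : Finset ℕ) (w x y : ℕ → ℝ) (a b : ℕ → ℝ) (n m : ℕ) :
    |∑ p ∈ P, w p * (‖trigPoly a n (x p)‖ ^ 2 * ‖trigPoly b m (y p)‖ ^ 2) -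
        (∑ j ∈ Finset.range n, a j ^ 2) * (∑ j ∈ Finset.range m, b j ^ 2) * ∑ p ∈ P, w p| ≤
      (∑ j ∈ Finset.range n, a j ^ 2) * (∑ j ∈ Finset.range m, b j ^ 2) *
        ∑ κ ∈ puncturedBox n m, ‖∑ p ∈ P, (w p : ℂ) * ee (κ.1 * x p + κ.2 * y p)‖ := by
  rcases Nat.eq_zero_or_pos n with rfl | hn
  · simp [trigPoly]
  rcases Nat.eq_zero_or_pos m with rfl | hm
  · simp [trigPoly]
  set S : ℤ × ℤ → ℂ := fun κ => ∑ p ∈ P, (w p : ℂ) * ee (κ.1 * x p + κ.2 * y p) with hS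
  have h1 : ((∑ p ∈ P, w p * (‖trigPoly a n (x p)‖ ^ 2 * ‖trigPoly b m (y p)‖ ^ 2) : ℝ) : ℂ) =
      ∑ κ ∈ Finset.Ioo (-n : ℤ) n ×ˢ Finset.Ioo (-m : ℤ) m,
        ((autocorr a n κ.1 * autocorr b m κ.2 : ℝ) : ℂ) * S κ := by
    rw [Complex.ofReal_sum]
    simp_rw [hS, Finset.mul_sum]
    rw [Finset.sum_comm]
    refine Finset.sum_congr rfl fun p _ => ?_
    rw [Complex.ofReal_mul, Complex.ofReal_mul, normSq_trigPoly, normSq_trigPoly,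
      Finset.sum_mul_sum, Finset.mul_sum, Finset.sum_product]
    refine Finset.sum_congr rfl fun k _ => ?_
    rw [Finset.mul_sum]
    refine Finset.sum_congr rfl fun l _ => ?_
    rw [ee_add]
    push_cast
    ring
  have h0 : (0 : ℤ × ℤ) ∈ Finset.Ioo (-n : ℤ) n ×ˢ Finset.Ioo (-m : ℤ) m := by
    simp only [Finset.mem_product, Finset.mem_Ioo, Prod.fst_zero, Prod.snd_zero]
    omega
  rw [← Finset.add_sum_erase _ _ h0] at h1
  have hS0 : S 0 = ((∑ p ∈ P, w p : ℝ) : ℂ) := by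
    simp [hS, ee_zero]
  simp only [Prod.fst_zero, Prod.snd_zero, autocorr_zero, hS0] at h1
  rw [← Real.norm_eq_abs, ← Complex.norm_real, Complex.ofReal_sub, h1, ← Complex.ofReal_mul, add_sub_cancel_left,
    Finset.mul_sum]
  refine (norm_sum_le _ _).trans (Finset.sum_le_sum fun κ _ => ?_)
  rw [norm_mul, Complex.norm_real, Real.norm_eq_abs, abs_mul]
  exact mul_le_mul_of_nonneg_right (mul_le_mul (abs_autocorr_le _ _ _) (abs_autocorr_le _ _ _)
    (abs_nonneg _) (Finset.sum_nonneg fun _ _ => sq_nonneg _)) (norm_nonneg _)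

/-- The tent `0, 1, …, J, …, 1, 0`. -/
noncomputable def tent (J j : ℕ) : ℝ := min (j : ℝ) (2 * J - j)

theorem sum_tent_sq_ge (J : ℕ) : (J : ℝ) ^ 3 / 3 ≤ ∑ j ∈ Finset.range (2 * J), tent J j ^ 2 := by
  have key : ∀ K : ℕ, (K : ℝ) ^ 3 / 3 ≤ ∑ j ∈ Finset.range K, ((j + 1 : ℕ) : ℝ) ^ 2 := by
    intro K
    induction K with
    | zero => simp
    | succ K ih =>
      rw [Finset.sum_range_succ]
      push_cast at ih ⊢
      nlinarith [(Nat.cast_nonneg K : (0 : ℝ) ≤ K)]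
  rw [two_mul, Finset.sum_range_add]
  refine (key J).trans ?_
  rw [← Finset.sum_range_reflect]
  refine le_add_of_nonneg_of_le (Finset.sum_nonneg fun _ _ => sq_nonneg _)
    (Finset.sum_le_sum fun j hj => ?_)
  have hj := Finset.mem_range.1 hj
  have hj' : (j : ℝ) ≤ J := by exact_mod_cast hj.le
  have e : ((J - 1 - j + 1 : ℕ) : ℝ) = J - j := by
    rw [show J - 1 - j + 1 = J - j by omega, Nat.cast_sub hj.le]
  rw [e, tent, min_eq_right (by push_cast; linarith)]
  push_cast
  apply le_of_eq
  ring

theorem sum_tent_sub_sq (J : ℕ) :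
    ∑ j ∈ Finset.range (2 * J), (tent J (j + 1) - tent J j) ^ 2 = 2 * J := by
  have : ∀ j ∈ Finset.range (2 * J), (tent J (j + 1) - tent J j) ^ 2 = 1 := by
    intro j hj
    rw [tent, tent]
    rcases lt_or_ge j J with h | h
    · have : (j : ℝ) + 1 ≤ J := by exact_mod_cast h
      rw [min_eq_left (by push_cast; linarith), min_eq_left (by linarith)]
      push_cast; ring
    · have : (J : ℝ) ≤ j := by exact_mod_cast h
      rw [min_eq_right (by push_cast; linarith), min_eq_right (by linarith)]
      push_cast; ring
  rw [Finset.sum_congr rfl this]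
  simp

theorem norm_trigPoly_tent_sub (J : ℕ) (x : ℝ) :
    ‖trigPoly (fun j => tent J (j + 1) - tent J j) (2 * J) x‖ =
      ‖ee x - 1‖ * ‖trigPoly (tent J) (2 * J) x‖ := by
  have h0 : tent J 0 = 0 := by simp [tent]
  have h1 : tent J (2 * J) = 0 := by simp [tent]
  have h2 : trigPoly (tent J) (2 * J) x =
      ∑ j ∈ Finset.range (2 * J), (tent J (j + 1) : ℂ) * ee ((j + 1 : ℕ) * x) := by
    have e1 := Finset.sum_range_succ (fun j => (tent J j : ℂ) * ee (j * x)) (2 * J)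
    have e2 := Finset.sum_range_succ' (fun j => (tent J j : ℂ) * ee (j * x)) (2 * J)
    rw [e1] at e2
    simpa [h0, h1, trigPoly] using e2
  have h3 : (1 - ee x) * trigPoly (tent J) (2 * J) x =
      ee x * trigPoly (fun j => tent J (j + 1) - tent J j) (2 * J) x := by
    rw [sub_mul, one_mul]
    nth_rewrite 1 [h2]
    rw [trigPoly, trigPoly, Finset.mul_sum, Finset.mul_sum, ← Finset.sum_sub_distrib]
    refine Finset.sum_congr rfl fun j _ => ?_
    rw [show ((j + 1 : ℕ) : ℝ) * x = x + j * x by push_cast; ring, ee_add]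
    push_cast
    ring
  have h4 := congrArg norm h3
  rw [norm_mul, norm_mul, norm_ee, one_mul] at h4
  rw [← h4, norm_sub_rev]

/-- If the exponential sums of a weighted family of points are small, some point lies in the
prescribed box around the origin modulo one. -/
theorem exists_nint_lt (P : Finset ℕ) (w x y : ℕ → ℝ) (hw : ∀ p ∈ P, 0 ≤ w p) (J₁ J₂ : ℕ)
    (δ₁ δ₂ : ℝ) (hδ₁ : 0 < δ₁) (hδ₂ : 0 < δ₂) (hJ₁ : 2 ≤ J₁ ^ 2 * δ₁ ^ 2) (hJ₂ : 2 ≤ J₂ ^ 2 * δ₂ ^ 2)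
    (hE : 3 * ∑ κ ∈ puncturedBox (2 * J₁) (2 * J₂),
      ‖∑ p ∈ P, (w p : ℂ) * ee (κ.1 * x p + κ.2 * y p)‖ < ∑ p ∈ P, w p) :
    ∃ p ∈ P, nint (x p) < δ₁ ∧ nint (y p) < δ₂ := by
  by_contra! hcon
  set E := ∑ κ ∈ puncturedBox (2 * J₁) (2 * J₂),
      ‖∑ p ∈ P, (w p : ℂ) * ee (κ.1 * x p + κ.2 * y p)‖ with hEdef
  set W := ∑ p ∈ P, w p with hW
  set u := trigPoly (tent J₁) (2 * J₁) with hu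
  set v := trigPoly (tent J₂) (2 * J₂) with hv
  have key : ∀ J : ℕ, ∀ δ : ℝ, 2 ≤ J ^ 2 * δ ^ 2 → 2 * (J : ℝ) ≤
      4 * δ ^ 2 * ∑ j ∈ Finset.range (2 * J), tent J j ^ 2 := by
    intro J δ h
    have h1 := sum_tent_sq_ge J
    calc 2 * (J : ℝ) ≤ (J ^ 2 * δ ^ 2) * J := by gcongr
      _ ≤ 4 / 3 * ((J ^ 2 * δ ^ 2) * J) := by
          have : 0 ≤ (J ^ 2 * δ ^ 2) * (J : ℝ) := by positivity
          linarith
      _ = 4 * δ ^ 2 * ((J : ℝ) ^ 3 / 3) := by ring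
      _ ≤ _ := by gcongr
  have hpos : ∀ J : ℕ, ∀ δ : ℝ, 2 ≤ J ^ 2 * δ ^ 2 →
      0 < ∑ j ∈ Finset.range (2 * J), tent J j ^ 2 := by
    intro J δ h
    refine lt_of_lt_of_le ?_ (sum_tent_sq_ge J)
    have : J ≠ 0 := by rintro rfl; norm_num at h
    positivity
  have ha0 := hpos J₁ δ₁ hJ₁
  have hb0 := hpos J₂ δ₂ hJ₂
  have ha' := key J₁ δ₁ hJ₁
  have hb' := key J₂ δ₂ hJ₂
  have m0 := abs_sum_normSq_trigPoly_sub_le P w x y (tent J₁) (tent J₂) (2 * J₁) (2 * J₂)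
  have m1 := abs_sum_normSq_trigPoly_sub_le P w x y (fun j => tent J₁ (j + 1) - tent J₁ j)
    (tent J₂) (2 * J₁) (2 * J₂)
  have m2 := abs_sum_normSq_trigPoly_sub_le P w x y (tent J₁)
    (fun j => tent J₂ (j + 1) - tent J₂ j) (2 * J₁) (2 * J₂)
  simp only [norm_trigPoly_tent_sub, sum_tent_sub_sq] at m1 m2
  set a := ∑ j ∈ Finset.range (2 * J₁), tent J₁ j ^ 2 with ha
  set b := ∑ j ∈ Finset.range (2 * J₂), tent J₂ j ^ 2 with hb
  have hE0 : 0 ≤ E := Finset.sum_nonneg fun _ _ => norm_nonneg _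
  have hpt : ∑ p ∈ P, w p * (‖u (x p)‖ ^ 2 * ‖v (y p)‖ ^ 2) ≤
      (∑ p ∈ P, w p * ((‖ee (x p) - 1‖ * ‖u (x p)‖) ^ 2 * ‖v (y p)‖ ^ 2)) / (16 * δ₁ ^ 2) +
      (∑ p ∈ P, w p * (‖u (x p)‖ ^ 2 * (‖ee (y p) - 1‖ * ‖v (y p)‖) ^ 2)) / (16 * δ₂ ^ 2) := by
    rw [Finset.sum_div, Finset.sum_div, ← Finset.sum_add_distrib]
    refine Finset.sum_le_sum fun p hp => ?_
    have hwp := hw p hp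
    have hcp := hcon p hp
    have ex := four_mul_nint_le_norm (x p)
    have ey := four_mul_nint_le_norm (y p)
    have hone : 1 ≤ ‖ee (x p) - 1‖ ^ 2 / (16 * δ₁ ^ 2) + ‖ee (y p) - 1‖ ^ 2 / (16 * δ₂ ^ 2) := by
      rcases lt_or_ge (nint (x p)) δ₁ with h | h
      · have h := hcp h
        have : 1 ≤ ‖ee (y p) - 1‖ ^ 2 / (16 * δ₂ ^ 2) := by
          rw [le_div_iff₀ (by positivity)]
          nlinarith
        have : 0 ≤ ‖ee (x p) - 1‖ ^ 2 / (16 * δ₁ ^ 2) := by positivity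
        linarith
      · have : 1 ≤ ‖ee (x p) - 1‖ ^ 2 / (16 * δ₁ ^ 2) := by
          rw [le_div_iff₀ (by positivity)]
          nlinarith
        have : 0 ≤ ‖ee (y p) - 1‖ ^ 2 / (16 * δ₂ ^ 2) := by positivity
        linarith
    calc w p * (‖u (x p)‖ ^ 2 * ‖v (y p)‖ ^ 2) =
        w p * (‖u (x p)‖ ^ 2 * ‖v (y p)‖ ^ 2) * 1 := by ring
      _ ≤ w p * (‖u (x p)‖ ^ 2 * ‖v (y p)‖ ^ 2) *
          (‖ee (x p) - 1‖ ^ 2 / (16 * δ₁ ^ 2) + ‖ee (y p) - 1‖ ^ 2 / (16 * δ₂ ^ 2)) := by gcongr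
      _ = _ := by ring
  have b0 : a * b * (W - E) ≤ ∑ p ∈ P, w p * (‖u (x p)‖ ^ 2 * ‖v (y p)‖ ^ 2) := by
    have := (abs_le.1 m0).1
    linarith
  have hWE : 0 ≤ W + E := by
    have : 0 ≤ W := Finset.sum_nonneg hw
    linarith
  have b1 : (∑ p ∈ P, w p * ((‖ee (x p) - 1‖ * ‖u (x p)‖) ^ 2 * ‖v (y p)‖ ^ 2)) / (16 * δ₁ ^ 2) ≤
      a * b * (W + E) / 4 := by
    rw [div_le_iff₀ (by positivity)]
    have h1 := (abs_le.1 m1).2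
    calc _ ≤ 2 * (J₁ : ℝ) * b * (W + E) := by linarith
      _ ≤ 4 * δ₁ ^ 2 * a * b * (W + E) := by gcongr
      _ = _ := by ring
  have b2 : (∑ p ∈ P, w p * (‖u (x p)‖ ^ 2 * (‖ee (y p) - 1‖ * ‖v (y p)‖) ^ 2)) / (16 * δ₂ ^ 2) ≤
      a * b * (W + E) / 4 := by
    rw [div_le_iff₀ (by positivity)]
    have h1 := (abs_le.1 m2).2
    calc _ ≤ 2 * (J₂ : ℝ) * a * (W + E) := by linarith
      _ ≤ 4 * δ₂ ^ 2 * b * a * (W + E) := by gcongr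
      _ = _ := by ring
  have hab : 0 < a * b := mul_pos ha0 hb0
  have : a * b * (W - 3 * E) ≤ 0 := by linarith
  nlinarith

theorem eq_floor_rpow {γ : ℝ} (hγ : 0 < γ) {p m : ℕ} (h1 : (p : ℝ) ^ γ ≤ m)
    (h2 : (m : ℝ) < ((p : ℝ) + 1) ^ γ) : p = ⌊(m : ℝ) ^ (1 / γ)⌋₊ := by
  symm
  rw [Nat.floor_eq_iff (by positivity), one_div]
  constructor
  · rwa [Real.le_rpow_inv_iff_of_pos (by positivity) (by positivity) hγ]
  · rwa [Real.rpow_inv_lt_iff_of_pos (by positivity) (by positivity) hγ]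

theorem exists_eq_floor_rpow {γ δ : ℝ} (hγ : 0 < γ) {p : ℕ} (hp : 0 < p)
    (hδ : 2 * δ ≤ ((p : ℝ) + 1) ^ γ - (p : ℝ) ^ γ) (h : nint ((p : ℝ) ^ γ + δ) < δ) :
    ∃ n : ℕ, 0 < n ∧ p = ⌊(n : ℝ) ^ (1 / γ)⌋₊ := by
  rw [nint, abs_lt] at h
  set m := round ((p : ℝ) ^ γ + δ) with hm
  have hp' : (0 : ℝ) < (p : ℝ) ^ γ := by positivity
  have hm0 : (0 : ℝ) < m := by linarith
  have hm0' : 0 < m := by exact_mod_cast hm0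
  lift m to ℕ using hm0'.le with m'
  simp only [Int.cast_natCast] at h hm0
  refine ⟨m', by exact_mod_cast hm0, eq_floor_rpow hγ ?_ ?_⟩ <;> linarith

theorem sum_Icc_int (g : ℤ → ℝ) (n : ℕ) :
    ∑ k ∈ Finset.Icc (-n : ℤ) n, g k =
      g 0 + ∑ k ∈ Finset.Icc 1 n, g k + ∑ k ∈ Finset.Icc 1 n, g (-k) := by
  induction n with
  | zero => simp
  | succ n ih =>
    rw [Finset.sum_Icc_succ_top (by omega), Finset.sum_Icc_succ_top (by omega)]
    have hsub : Finset.Icc (-(n + 1 : ℕ) : ℤ) (n + 1 : ℕ) =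
        insert ((n + 1 : ℕ) : ℤ) (insert (-(n + 1 : ℕ) : ℤ) (Finset.Icc (-n : ℤ) n)) := by
      ext k
      simp only [Finset.mem_insert, Finset.mem_Icc]
      push_cast
      omega
    rw [hsub, Finset.sum_insert, Finset.sum_insert, ih]
    · ring
    · simp only [Finset.mem_Icc]; push_cast; omega
    · simp only [Finset.mem_insert, Finset.mem_Icc]; push_cast; omega

theorem sum_puncturedBox_le (F : ℤ × ℤ → ℝ) (hF : ∀ κ, 0 ≤ F κ) (n m : ℕ) (U V : ℝ) (hU : 0 ≤ U)
    (hV : 0 ≤ V) (h1 : ∀ l ∈ Finset.Ioo (-m : ℤ) m, ∑ k ∈ Finset.Icc 1 n, F ((k : ℕ), l) ≤ U)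
    (h2 : ∀ l ∈ Finset.Ioo (-m : ℤ) m, ∑ k ∈ Finset.Icc 1 n, F (-(k : ℕ), l) ≤ U)
    (h3 : ∀ l ∈ Finset.Ioo (-m : ℤ) m, l ≠ 0 → F (0, l) ≤ V) :
    ∑ κ ∈ puncturedBox n m, F κ ≤ 2 * m * (2 * U + V) := by
  have hG : ∑ κ ∈ puncturedBox n m, F κ ≤
      ∑ κ ∈ Finset.Icc (-n : ℤ) n ×ˢ Finset.Ioo (-m : ℤ) m, if κ = 0 then 0 else F κ := by
    rw [← Finset.sum_congr rfl (s₁ := puncturedBox n m)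
      (f := fun κ => if κ = 0 then 0 else F κ)]
    · refine Finset.sum_le_sum_of_subset_of_nonneg ?_ fun κ _ _ => ?_
      · exact (Finset.erase_subset _ _).trans
          (Finset.product_subset_product_left Finset.Ioo_subset_Icc_self)
      · split_ifs
        · exact le_rfl
        · exact hF κ
    · intro κ hκ
      exact if_neg (Finset.ne_of_mem_erase hκ)
  refine hG.trans ?_
  rw [Finset.sum_product_right]
  have hrow : ∀ l ∈ Finset.Ioo (-m : ℤ) m,
      ∑ k ∈ Finset.Icc (-n : ℤ) n, (if (k, l) = 0 then 0 else F (k, l)) ≤ 2 * U + V := by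
    intro l hl
    rw [sum_Icc_int]
    have e0 : (if ((0 : ℤ), l) = 0 then 0 else F (0, l)) ≤ V := by
      split_ifs with h
      · exact hV
      · exact h3 l hl fun h0 => h (by rw [h0]; rfl)
    have e1 : ∑ k ∈ Finset.Icc 1 n, (if (((k : ℕ) : ℤ), l) = 0 then 0 else F ((k : ℕ), l)) ≤ U := by
      refine (Finset.sum_le_sum fun k _ => ?_).trans (h1 l hl)
      split_ifs
      · exact hF _
      · exact le_rfl
    have e2 : ∑ k ∈ Finset.Icc 1 n, (if (-((k : ℕ) : ℤ), l) = 0 then 0 else F (-(k : ℕ), l)) ≤ U := by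
      refine (Finset.sum_le_sum fun k _ => ?_).trans (h2 l hl)
      split_ifs
      · exact hF _
      · exact le_rfl
    linarith
  refine (Finset.sum_le_sum hrow).trans ?_
  rw [Finset.sum_const, Int.card_Ioo, nsmul_eq_mul]
  refine mul_le_mul_of_nonneg_right ?_ (by positivity)
  have : ((m : ℤ) - -m - 1).toNat ≤ 2 * m := by omega
  exact_mod_cast this

theorem conj_phase (γ τ l : ℝ) (n : ℕ) :
    (starRingEnd ℂ) (phase γ τ l n) = phase γ (-τ) (-l) n := by
  rw [phase, phase, ← ee_neg]; congr 1; ring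

theorem norm_sum_vonMangoldt_phase_neg (γ τ l : ℝ) (s : Finset ℕ) :
    ‖∑ n ∈ s, (ArithmeticFunction.vonMangoldt n : ℂ) * phase γ (-τ) l n‖ =
      ‖∑ n ∈ s, (ArithmeticFunction.vonMangoldt n : ℂ) * phase γ τ (-l) n‖ := by
  rw [← Complex.norm_conj, map_sum]
  congr 1
  refine Finset.sum_congr rfl fun n _ => ?_
  rw [map_mul, Complex.conj_ofReal, conj_phase, neg_neg]

namespace IsScale

variable {α A C : ℝ} {a : ℤ} {q r : ℕ}

/-- The contribution of the higher prime powers. -/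
theorem sum_not_prime_le (h : IsScale α A C a q r) :
    ∑ n ∈ Finset.Ioc (r ^ 14) (4 * r ^ 14) with ¬ n.Prime, ArithmeticFunction.vonMangoldt n ≤
      4 * (A * r ^ 7) := by
  have hr := h.cast_pos
  have hr1 : 1 ≤ r := by have := h.eighteen_le; omega
  have hN : 1 ≤ r ^ 14 := Nat.one_le_pow _ _ hr1
  have hx : (1 : ℝ) ≤ ((4 * r ^ 14 : ℕ) : ℝ) := by exact_mod_cast (by omega : 1 ≤ 4 * r ^ 14)
  have h1 := Chebyshev.psi_sub_theta_eq_sum_not_prime ((4 * r ^ 14 : ℕ) : ℝ)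
  rw [Nat.floor_natCast] at h1
  have h2 := Chebyshev.psi_sub_theta_le hx
  have h3 : √((4 * r ^ 14 : ℕ) : ℝ) = 2 * r ^ 7 := by
    rw [Real.sqrt_eq_iff_mul_self_eq (by positivity) (by positivity)]
    push_cast; ring
  have h4 : Real.log ((4 * r ^ 14 : ℕ) : ℝ) ≤ A := by
    have := h.log_le_of_le (x := ((4 * r ^ 14 : ℕ) : ℝ)) (by linarith)
      (by exact_mod_cast h.four_mul_pow_le)
    linarith
  have h5 : ∑ n ∈ Finset.Ioc (r ^ 14) (4 * r ^ 14) with ¬ n.Prime, ArithmeticFunction.vonMangoldt n ≤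
      ∑ n ∈ Finset.Ioc 0 (4 * r ^ 14) with ¬ n.Prime, ArithmeticFunction.vonMangoldt n :=
    Finset.sum_le_sum_of_subset_of_nonneg
      (Finset.filter_subset_filter _ (Finset.Ioc_subset_Ioc_left (Nat.zero_le _)))
      fun _ _ _ => ArithmeticFunction.vonMangoldt_nonneg
  rw [h3] at h2
  calc _ ≤ _ := h5
    _ ≤ 2 * (2 * r ^ 7) * Real.log ((4 * r ^ 14 : ℕ) : ℝ) := by rw [← h1]; exact h2
    _ ≤ 2 * (2 * r ^ 7) * A := by gcongr
    _ = _ := by ring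

theorem le_sum_log (h : IsScale α A C a q r) (hA : 20 * A ≤ r) :
    ((r ^ 14 : ℕ) : ℝ) ≤ ∑ p ∈ Finset.Ioc (r ^ 14) (4 * r ^ 14) with p.Prime, Real.log p := by
  have hr := h.cast_pos
  have h18 := h.eighteen_le
  have hr1 : 1 ≤ r := by omega
  have hr1' : (1 : ℝ) ≤ r := by exact_mod_cast hr1
  have hA1 := h.one_le_A
  have hN : 1 ≤ r ^ 14 := Nat.one_le_pow _ _ hr1
  have h1 := Chebyshev.theta_ge (4 * r ^ 14)
  have h2 := Chebyshev.theta_le_log4_mul_x (x := ((r ^ 14 : ℕ) : ℝ)) (by positivity)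
  have h3 : √((4 * r ^ 14 : ℕ) : ℝ) = 2 * r ^ 7 := by
    rw [Real.sqrt_eq_iff_mul_self_eq (by positivity) (by positivity)]
    push_cast; ring
  have hle : 4 * r ^ 14 + 1 ≤ r ^ 15 := by
    rw [pow_succ' r 14]
    nlinarith
  have h4 : Real.log (((4 * r ^ 14 : ℕ) : ℝ) + 1) ≤ A := by
    have := h.log_le_of_le (x := ((4 * r ^ 14 : ℕ) : ℝ) + 1) (by positivity)
      (by exact_mod_cast hle)
    linarith
  have h5 : Real.log ((4 * r ^ 14 : ℕ) : ℝ) ≤ A :=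
    (Real.log_le_log (by exact_mod_cast (by omega : 0 < 4 * r ^ 14)) (by linarith)).trans h4
  have h6 : Chebyshev.theta ((4 * r ^ 14 : ℕ) : ℝ) = Chebyshev.theta ((r ^ 14 : ℕ) : ℝ) +
      ∑ p ∈ Finset.Ioc (r ^ 14) (4 * r ^ 14) with p.Prime, Real.log p := by
    rw [Chebyshev.theta, Chebyshev.theta, Nat.floor_natCast, Nat.floor_natCast, Finset.sum_filter,
      Finset.sum_filter, Finset.sum_filter]
    exact (Finset.sum_Ioc_consecutive _ (Nat.zero_le _) (by omega)).symm
  have hlog2 := Real.log_two_gt_d9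
  have hlog4 : Real.log 4 = 2 * Real.log 2 := by
    rw [show (4 : ℝ) = 2 ^ 2 by norm_num, Real.log_pow]; norm_num
  rw [h3] at h1
  rw [hlog4] at h2
  have h7 : 2 * (2 * (r : ℝ) ^ 7) * Real.log ((4 * r ^ 14 : ℕ) : ℝ) ≤ 2 * (2 * (r : ℝ) ^ 7) * A := by
    gcongr
  have h8 : A ≤ r ^ 7 * A := le_mul_of_one_le_left (by linarith) (one_le_pow₀ hr1')
  have h9 : 20 * (r ^ 7 * A) ≤ (r : ℝ) ^ 14 := by
    calc 20 * ((r : ℝ) ^ 7 * A) = (r : ℝ) ^ 7 * (20 * A) := by ring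
      _ ≤ (r : ℝ) ^ 7 * r := by gcongr
      _ = (r : ℝ) ^ 8 := by ring
      _ ≤ (r : ℝ) ^ 14 := pow_le_pow_right₀ hr1' (by norm_num)
  have h10 : (0.69 : ℝ) * r ^ 14 ≤ Real.log 2 * r ^ 14 := by gcongr; linarith
  push_cast at *
  linarith

theorem norm_sum_log_le (h : IsScale α A C a q r) (γ β δ : ℝ) (κ : ℤ × ℤ) :
    ‖∑ p ∈ Finset.Ioc (r ^ 14) (4 * r ^ 14) with p.Prime,
        ((Real.log p : ℝ) : ℂ) * ee (κ.1 * (α * (p : ℝ) ^ 2 + β) + κ.2 * ((p : ℝ) ^ γ + δ))‖ ≤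
      ‖∑ n ∈ Finset.Ioc (r ^ 14) (4 * r ^ 14),
        (ArithmeticFunction.vonMangoldt n : ℂ) * phase γ (κ.1 * α) κ.2 n‖ + 4 * (A * r ^ 7) := by
  have h1 : ∑ p ∈ Finset.Ioc (r ^ 14) (4 * r ^ 14) with p.Prime,
        ((Real.log p : ℝ) : ℂ) * ee (κ.1 * (α * (p : ℝ) ^ 2 + β) + κ.2 * ((p : ℝ) ^ γ + δ)) =
      ee (κ.1 * β + κ.2 * δ) * ∑ p ∈ Finset.Ioc (r ^ 14) (4 * r ^ 14) with p.Prime,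
        (ArithmeticFunction.vonMangoldt p : ℂ) * phase γ (κ.1 * α) κ.2 p := by
    rw [Finset.mul_sum]
    refine Finset.sum_congr rfl fun p hp => ?_
    rw [ArithmeticFunction.vonMangoldt_apply_prime (Finset.mem_filter.1 hp).2, phase,
      mul_left_comm, ← ee_add]
    congr 2
    ring
  have h2 := Finset.sum_filter_add_sum_filter_not (Finset.Ioc (r ^ 14) (4 * r ^ 14)) Nat.Prime
    (fun n => (ArithmeticFunction.vonMangoldt n : ℂ) * phase γ (κ.1 * α) κ.2 n)
  rw [h1, norm_mul, norm_ee, one_mul, eq_sub_of_add_eq h2]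
  refine (norm_sub_le _ _).trans (add_le_add_right ((norm_sum_le _ _).trans ?_) _)
  refine le_trans (le_of_eq (Finset.sum_congr rfl fun n _ => ?_)) h.sum_not_prime_le
  rw [norm_mul, norm_phase, mul_one, Complex.norm_real,
    Real.norm_of_nonneg ArithmeticFunction.vonMangoldt_nonneg]

end IsScale

namespace IsScale

variable {α A : ℝ} {a : ℤ} {q r : ℕ}

theorem sum_puncturedBox_norm_le (h : IsScale α A 130 a q r) {γ : ℝ} (hγ : 13 / 14 < γ)
    (hγ1 : γ < 1) (β δ : ℝ) {J₁ J₂ : ℕ} (hJ₁ : 1 ≤ J₁) (hJr : 2 * J₁ ≤ r)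
    (hJ₂ : (J₂ : ℝ) ≤ 65 * ((r ^ 14 : ℕ) : ℝ) ^ (1 - γ)) :
    ∑ κ ∈ puncturedBox (2 * J₁) (2 * J₂),
      ‖∑ p ∈ Finset.Ioc (r ^ 14) (4 * r ^ 14) with p.Prime,
        ((Real.log p : ℝ) : ℂ) * ee (κ.1 * (α * (p : ℝ) ^ 2 + β) + κ.2 * ((p : ℝ) ^ γ + δ))‖ ≤
      5 * 10 ^ 9 * (25 / √(γ * (1 - γ)) * A ^ 5 * J₁ * ((r ^ 14 : ℕ) : ℝ) ^ (1 - γ) * r ^ 13) := by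
  have hr := h.cast_pos
  have hA := h.one_le_A
  have h18 := h.eighteen_le
  have hr1 : (1 : ℝ) ≤ r := by exact_mod_cast (by norm_num : 1 ≤ 18).trans h18
  have hγ0 : 0 < γ := by linarith
  set M := ((r ^ 14 : ℕ) : ℝ) ^ (1 - γ) with hM
  have hM0 : 0 ≤ M := by positivity
  set c := 25 / √(γ * (1 - γ)) with hc
  have hg0 : 0 < γ * (1 - γ) := by apply mul_pos <;> linarith
  have hc1 : 1 ≤ c := by
    rw [hc, le_div_iff₀ (Real.sqrt_pos.2 hg0), one_mul, Real.sqrt_le_iff]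
    constructor
    · norm_num
    · nlinarith
  have hJ1' : (1 : ℝ) ≤ J₁ := by exact_mod_cast hJ₁
  set G : ℤ × ℤ → ℝ := fun κ => ‖∑ n ∈ Finset.Ioc (r ^ 14) (4 * r ^ 14),
        (ArithmeticFunction.vonMangoldt n : ℂ) * phase γ (κ.1 * α) κ.2 n‖ with hG
  have hl : ∀ l ∈ Finset.Ioo (-(2 * J₂ : ℕ) : ℤ) (2 * J₂ : ℕ), |(l : ℝ)| ≤ 130 * M := by
    intro l hl
    rw [Finset.mem_Ioo] at hl
    have : |l| ≤ 2 * J₂ := abs_le.2 ⟨by push_cast at hl; omega, by push_cast at hl; omega⟩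
    have h2 : |(l : ℝ)| ≤ 2 * J₂ := by exact_mod_cast this
    linarith
  have hbox := sum_puncturedBox_le G (fun _ => norm_nonneg _) (2 * J₁) (2 * J₂)
    (3 * 10 ^ 4 * (130 * A ^ 5 * (2 * J₁ : ℕ) * r ^ 13)) (200 * (c * 130 * A ^ 3 * r ^ 13))
    (by positivity) (by positivity)
    (fun l hl' => by
      simpa [hG] using h.sum_norm_sum_vonMangoldt_le hγ0 hγ1 (hl l hl') (by omega) hJr)
    (fun l hl' => by
      have h1 : ∀ k : ℕ, G (-(k : ℤ), l) = ‖∑ n ∈ Finset.Ioc (r ^ 14) (4 * r ^ 14),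
          (ArithmeticFunction.vonMangoldt n : ℂ) * phase γ (k * α) (-l) n‖ := by
        intro k
        rw [← norm_sum_vonMangoldt_phase_neg, hG]
        simp
      rw [Finset.sum_congr rfl fun k _ => h1 k]
      exact h.sum_norm_sum_vonMangoldt_le hγ0 hγ1 (by rw [abs_neg]; exact hl l hl') (by omega) hJr)
    (fun l hl' hl0 => by
      have h1 : (1 : ℝ) ≤ |(l : ℝ)| := by exact_mod_cast Int.one_le_abs hl0
      simpa [hG] using h.norm_sum_vonMangoldt_rpow_le hγ hγ1 h1 (hl l hl'))
  have hcard : ((puncturedBox (2 * J₁) (2 * J₂)).card : ℝ) ≤ 4 * J₁ * (4 * J₂) := by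
    have h1 : (puncturedBox (2 * J₁) (2 * J₂)).card ≤ (4 * J₁) * (4 * J₂) := by
      refine (Finset.card_le_card (Finset.erase_subset _ _)).trans ?_
      rw [Finset.card_product, Int.card_Ioo, Int.card_Ioo]
      exact Nat.mul_le_mul (by omega) (by omega)
    exact_mod_cast h1
  have hpow : (r : ℝ) ^ 7 ≤ r ^ 13 := pow_le_pow_right₀ hr1 (by norm_num)
  have hA1 : A ≤ A ^ 5 := le_self_pow₀ hA (by norm_num)
  have hA3 : A ^ 3 ≤ A ^ 5 := pow_le_pow_right₀ hA (by norm_num)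
  calc _ ≤ ∑ κ ∈ puncturedBox (2 * J₁) (2 * J₂), (G κ + 4 * (A * r ^ 7)) :=
        Finset.sum_le_sum fun κ _ => h.norm_sum_log_le γ β δ κ
    _ = ∑ κ ∈ puncturedBox (2 * J₁) (2 * J₂), G κ +
        (puncturedBox (2 * J₁) (2 * J₂)).card * (4 * (A * r ^ 7)) := by
        rw [Finset.sum_add_distrib, Finset.sum_const, nsmul_eq_mul]
    _ ≤ 2 * (2 * J₂ : ℕ) * (2 * (3 * 10 ^ 4 * (130 * A ^ 5 * (2 * J₁ : ℕ) * r ^ 13)) +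
          200 * (c * 130 * A ^ 3 * r ^ 13)) + 4 * J₁ * (4 * J₂) * (4 * (A * r ^ 7)) := by gcongr
    _ = J₂ * (62400000 * (1 * (A ^ 5 * J₁ * r ^ 13)) + 104000 * (c * (A ^ 3 * 1 * r ^ 13)) +
          64 * (1 * (A * J₁ * r ^ 7))) := by push_cast; ring
    _ ≤ (65 * M) * (62400000 * (c * (A ^ 5 * J₁ * r ^ 13)) + 104000 * (c * (A ^ 5 * J₁ * r ^ 13)) +
          64 * (c * (A ^ 5 * J₁ * r ^ 13))) := by gcongr
    _ = 4062764160 * (c * A ^ 5 * J₁ * M * r ^ 13) := by ring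
    _ ≤ _ := by gcongr; norm_num

theorem exists_prime (h : IsScale α A 130 a q r) {γ : ℝ} (hγ : 13 / 14 < γ)
    (hγ1 : γ < 1) (β : ℝ) {J : ℕ} (hJ : 1 ≤ J) (hJr : 2 * J ≤ r)
    (hbig : 2 * 10 ^ 10 * (25 / √(γ * (1 - γ)) * A ^ 5 * J * ((r ^ 14 : ℕ) : ℝ) ^ (1 - γ)) ≤ r) :
    ∃ p : ℕ, p.Prime ∧ r ^ 14 < p ∧ p ≤ 4 * r ^ 14 ∧
      (∃ n : ℕ, 0 < n ∧ p = ⌊(n : ℝ) ^ (1 / γ)⌋₊) ∧ nint (α * (p : ℝ) ^ 2 + β) < 2 / J := by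
  have hr := h.cast_pos
  have hA := h.one_le_A
  have h18 := h.eighteen_le
  have hr1 : (1 : ℝ) ≤ r := by exact_mod_cast (by norm_num : 1 ≤ 18).trans h18
  have hγ0 : 0 < γ := by linarith
  have hJ' : (1 : ℝ) ≤ J := by exact_mod_cast hJ
  set N := ((r ^ 14 : ℕ) : ℝ) with hN
  have hN' : N = (r : ℝ) ^ 14 := by rw [hN]; push_cast; rfl
  have hN1 : 1 ≤ N := by rw [hN']; exact one_le_pow₀ hr1
  have hN0 : 0 < N := by linarith
  have hM1 : 1 ≤ N ^ (1 - γ) := Real.one_le_rpow hN1 (by linarith)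
  have hinv : N ^ (1 - γ) * N ^ (γ - 1) = 1 := by
    rw [← Real.rpow_add hN0, show 1 - γ + (γ - 1) = 0 by ring, Real.rpow_zero]
  set c := 25 / √(γ * (1 - γ)) with hc
  have hg0 : 0 < γ * (1 - γ) := by apply mul_pos <;> linarith
  have hc1 : 1 ≤ c := by
    rw [hc, le_div_iff₀ (Real.sqrt_pos.2 hg0), one_mul, Real.sqrt_le_iff]
    constructor
    · norm_num
    · nlinarith
  set J₂ := ⌈64 * N ^ (1 - γ)⌉₊ with hJ2
  have hJ2l : 64 * N ^ (1 - γ) ≤ J₂ := Nat.le_ceil _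
  have hJ2u : (J₂ : ℝ) ≤ 65 * N ^ (1 - γ) := by
    have := (Nat.ceil_lt_add_one (by positivity : 0 ≤ 64 * N ^ (1 - γ))).le
    linarith
  have hA20 : 20 * A ≤ r := by
    refine le_trans ?_ hbig
    have hA1 : A ≤ A ^ 5 := le_self_pow₀ hA (by norm_num)
    calc 20 * A = 20 * (1 * A * 1 * 1) := by ring
      _ ≤ 2 * 10 ^ 10 * (c * A ^ 5 * J * N ^ (1 - γ)) := by gcongr; norm_num
  have hE := h.sum_puncturedBox_norm_le hγ hγ1 β (N ^ (γ - 1) / 32) hJ hJr hJ2u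
  have hW := h.le_sum_log hA20
  obtain ⟨p, hp, hp1, hp2⟩ := exists_nint_lt
    ((Finset.Ioc (r ^ 14) (4 * r ^ 14)).filter Nat.Prime) (fun p => Real.log p)
    (fun p => α * (p : ℝ) ^ 2 + β) (fun p => (p : ℝ) ^ γ + N ^ (γ - 1) / 32)
    (fun p _ => Real.log_natCast_nonneg p) J J₂ (2 / J) (N ^ (γ - 1) / 32) (by positivity)
    (by positivity) (by field_simp; norm_num)
    (by
      have h1 : 2 ≤ J₂ * (N ^ (γ - 1) / 32) := by
        calc (2 : ℝ) = 64 * (N ^ (1 - γ) * N ^ (γ - 1)) / 32 := by rw [hinv]; norm_num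
          _ = (64 * N ^ (1 - γ)) * (N ^ (γ - 1) / 32) := by ring
          _ ≤ _ := by gcongr
      rw [← mul_pow]
      nlinarith)
    (by
      refine lt_of_lt_of_le ?_ hW
      refine (mul_le_mul_of_nonneg_left hE (by norm_num)).trans_lt ?_
      have h0 : 0 < c * A ^ 5 * J * N ^ (1 - γ) := by positivity
      calc 3 * (5 * 10 ^ 9 * (c * A ^ 5 * J * N ^ (1 - γ) * (r : ℝ) ^ 13)) =
          3 * (5 * 10 ^ 9 * (c * A ^ 5 * J * N ^ (1 - γ))) * (r : ℝ) ^ 13 := by ring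
        _ < r * (r : ℝ) ^ 13 := by gcongr; linarith
        _ = N := by rw [hN']; ring)
  obtain ⟨hpI, hpp⟩ := Finset.mem_filter.1 hp
  obtain ⟨hpl, hpu⟩ := Finset.mem_Ioc.1 hpI
  refine ⟨p, hpp, hpl, hpu, exists_eq_floor_rpow hγ0 hpp.pos ?_ hp2, hp1⟩
  have hp0 : (0 : ℝ) < p := by exact_mod_cast hpp.pos
  have hpu' : (p : ℝ) ≤ 4 * N := by rw [hN]; exact_mod_cast hpu
  obtain ⟨ξ, hξ1, hξ2, hξ⟩ := exists_rpow_diff (γ := γ) hp0 one_pos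
  rw [hξ]
  have h8 : ((8 : ℝ) * N) ^ (γ - 1) ≤ ξ ^ (γ - 1) :=
    Real.rpow_le_rpow_of_nonpos (hp0.trans hξ1) (by linarith) (by linarith)
  have h9 : (1 / 8 : ℝ) ≤ 8 ^ (γ - 1) := by
    calc (1 / 8 : ℝ) = 8 ^ (-1 : ℝ) := by rw [Real.rpow_neg_one]; norm_num
      _ ≤ 8 ^ (γ - 1) := Real.rpow_le_rpow_of_exponent_le (by norm_num) (by linarith)
  rw [Real.mul_rpow (by norm_num) hN0.le] at h8
  calc 2 * (N ^ (γ - 1) / 32) = 1 * (1 / 2 * (1 / 8 * N ^ (γ - 1))) := by ring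
    _ ≤ 1 * (γ * (8 ^ (γ - 1) * N ^ (γ - 1))) := by gcongr; linarith
    _ ≤ 1 * (γ * ξ ^ (γ - 1)) := by gcongr

end IsScale

theorem exists_large_den_approx {α : ℝ} (hα : Irrational α) (D : ℕ) :
    ∃ x : ℚ, D ≤ x.den ∧ |α - x| < 1 / (x.den : ℝ) ^ 2 := by
  by_contra! hcon
  refine Real.infinite_rat_abs_sub_lt_one_div_den_sq_of_irrational hα ?_
  set B : ℕ := ⌈(|α| + 1) * D⌉₊ with hB
  refine ((Finset.Icc (-B : ℤ) B ×ˢ Finset.Icc 1 D).image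
    fun z : ℤ × ℕ => (z.1 : ℚ) / (z.2 : ℚ)).finite_toSet.subset ?_
  intro x hx
  have hx : |α - x| < 1 / (x.den : ℝ) ^ 2 := hx
  have hD : x.den < D := by
    by_contra! h
    exact absurd hx (not_lt.2 (hcon x h))
  have hd1 : (1 : ℝ) ≤ x.den := by exact_mod_cast x.den_pos
  have hdD : (x.den : ℝ) ≤ D := by exact_mod_cast hD.le
  have h1 : |α - x| < 1 := hx.trans_le ((div_le_one (by positivity)).2 (one_le_pow₀ hd1))
  have h2 : |(x : ℝ)| ≤ |α| + 1 := by
    have h3 := abs_sub_abs_le_abs_sub (x : ℝ) α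
    rw [abs_sub_comm] at h3
    linarith
  have h3 : (x : ℝ) * x.den = x.num := by exact_mod_cast Rat.mul_den_eq_num x
  have h4 : |(x.num : ℝ)| ≤ B := by
    rw [← h3, abs_mul, abs_of_nonneg (by positivity : (0 : ℝ) ≤ x.den)]
    calc |(x : ℝ)| * x.den ≤ (|α| + 1) * D := by gcongr
      _ ≤ B := Nat.le_ceil _
  have h5 : |x.num| ≤ B := by exact_mod_cast h4
  refine Finset.mem_coe.2 (Finset.mem_image.2 ⟨(x.num, x.den), ?_, Rat.num_div_den x⟩)
  rw [Finset.mem_product, Finset.mem_Icc, Finset.mem_Icc]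
  exact ⟨abs_le.1 h5, x.den_pos, hD.le⟩

theorem exists_pow_eight_le {R q : ℕ} (hR : 1 ≤ R) (hq : R ^ 8 ≤ q) :
    ∃ r : ℕ, R ≤ r ∧ r ^ 8 ≤ q ∧ q ≤ 256 * r ^ 8 := by
  set r := Nat.findGreatest (fun r => r ^ 8 ≤ q) q with hr
  have hRq : R ≤ q := (Nat.le_self_pow (by norm_num) R).trans hq
  have h1 : R ≤ r := Nat.le_findGreatest hRq hq
  have h2 : r ^ 8 ≤ q := Nat.findGreatest_spec (P := fun r => r ^ 8 ≤ q) hRq hq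
  refine ⟨r, h1, h2, ?_⟩
  have h3 : q < (r + 1) ^ 8 := by
    by_contra! h
    have := Nat.le_findGreatest (P := fun r => r ^ 8 ≤ q)
      ((Nat.le_self_pow (by norm_num) (r + 1)).trans h) h
    omega
  calc q ≤ (r + 1) ^ 8 := h3.le
    _ ≤ (2 * r) ^ 8 := Nat.pow_le_pow_left (by omega) 8
    _ = 256 * r ^ 8 := by ring

theorem eventually_le_rpow (x : ℝ) {s : ℝ} (hs : 0 < s) :
    ∀ᶠ r : ℕ in Filter.atTop, x ≤ (r : ℝ) ^ s :=
  ((tendsto_rpow_atTop hs).comp tendsto_natCast_atTop_atTop).eventually_ge_atTop x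

theorem eventually_log_le_rpow {s : ℝ} (hs : 0 < s) :
    ∀ᶠ r : ℕ in Filter.atTop, 1 + Real.log ((r : ℝ) ^ 15) ≤ (r : ℝ) ^ s := by
  have h1 := ((isLittleO_log_rpow_atTop hs).bound (by norm_num : (0 : ℝ) < 1 / 30))
  have h2 := tendsto_natCast_atTop_atTop (R := ℝ) |>.eventually h1
  filter_upwards [h2, eventually_le_rpow 2 hs] with r h3 h4
  rw [Real.norm_eq_abs, Real.norm_of_nonneg (by positivity)] at h3
  have h5 := le_abs_self (Real.log (r : ℝ))
  rw [Real.log_pow]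
  push_cast
  linarith

/-- All the size conditions at scale `r` hold once `r` is large. -/
theorem eventually_scale {γ θ : ℝ} (hθ : θ = (14 * γ - 13) / 29) (hγ : 13 / 14 < γ) (hγ1 : γ < 1)
    {D : ℝ} (hD : 1 ≤ D) (c : ℝ) (hc : 0 ≤ c) :
    ∀ᶠ r : ℕ in Filter.atTop, 32 * 130 ≤ (r : ℝ) ∧ 1 + Real.log ((r : ℝ) ^ 15) ≤ D * (r : ℝ) ^ θ ∧
      2 * ⌈(r : ℝ) ^ (20 * θ)⌉₊ ≤ r ∧
      2 * 10 ^ 10 * (c * (D * (r : ℝ) ^ θ) ^ 5 * (⌈(r : ℝ) ^ (20 * θ)⌉₊ : ℕ) *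
        ((r ^ 14 : ℕ) : ℝ) ^ (1 - γ)) ≤ r ∧ 8 < (r : ℝ) ^ (6 * θ) := by
  have hθ0 : 0 < θ := by rw [hθ]; linarith
  have hθ1 : 29 * θ < 1 := by rw [hθ]; linarith
  filter_upwards [eventually_log_le_rpow hθ0, eventually_le_rpow 4 (s := 1 - 20 * θ) (by linarith),
    eventually_le_rpow (2 * 10 ^ 10 * (c * D ^ 5 * 2)) (s := 4 * θ) (by linarith),
    eventually_le_rpow 9 (s := 6 * θ) (by linarith), Filter.eventually_ge_atTop (32 * 130)]
    with r h1 h2 h3 h4 h5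
  have hr : (32 * 130 : ℝ) ≤ r := by exact_mod_cast h5
  have hr1 : (1 : ℝ) ≤ r := by linarith
  have hr0 : (0 : ℝ) < r := by linarith
  have hJ1 : 1 ≤ (r : ℝ) ^ (20 * θ) := Real.one_le_rpow hr1 (by linarith)
  have hJ : (⌈(r : ℝ) ^ (20 * θ)⌉₊ : ℝ) ≤ 2 * (r : ℝ) ^ (20 * θ) := by
    have := (Nat.ceil_lt_add_one (by positivity : 0 ≤ (r : ℝ) ^ (20 * θ))).le
    linarith
  refine ⟨hr, h1.trans (le_mul_of_one_le_left (by positivity) hD), ?_, ?_, by linarith⟩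
  · have : 2 * (⌈(r : ℝ) ^ (20 * θ)⌉₊ : ℝ) ≤ r := by
      calc 2 * (⌈(r : ℝ) ^ (20 * θ)⌉₊ : ℝ) ≤ 4 * (r : ℝ) ^ (20 * θ) := by linarith
        _ ≤ (r : ℝ) ^ (1 - 20 * θ) * (r : ℝ) ^ (20 * θ) := by gcongr
        _ = r := by rw [← Real.rpow_add hr0, sub_add_cancel, Real.rpow_one]
    exact_mod_cast this
  · have e1 : ((r ^ 14 : ℕ) : ℝ) ^ (1 - γ) = (r : ℝ) ^ (1 - 29 * θ) := by
      push_cast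
      rw [← Real.rpow_natCast, ← Real.rpow_mul hr0.le]
      congr 1
      rw [hθ]; push_cast; ring
    have e2 : ((r : ℝ) ^ θ) ^ 5 = (r : ℝ) ^ (5 * θ) := by
      rw [← Real.rpow_natCast, ← Real.rpow_mul hr0.le]
      congr 1
      push_cast; ring
    rw [e1, mul_pow, e2]
    calc 2 * 10 ^ 10 * (c * (D ^ 5 * (r : ℝ) ^ (5 * θ)) * (⌈(r : ℝ) ^ (20 * θ)⌉₊ : ℕ) *
          (r : ℝ) ^ (1 - 29 * θ)) ≤
        2 * 10 ^ 10 * (c * (D ^ 5 * (r : ℝ) ^ (5 * θ)) * (2 * (r : ℝ) ^ (20 * θ)) *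
          (r : ℝ) ^ (1 - 29 * θ)) := by gcongr
      _ = 2 * 10 ^ 10 * (c * D ^ 5 * 2) *
          ((r : ℝ) ^ (5 * θ) * (r : ℝ) ^ (20 * θ) * (r : ℝ) ^ (1 - 29 * θ)) := by ring
      _ ≤ (r : ℝ) ^ (4 * θ) *
          ((r : ℝ) ^ (5 * θ) * (r : ℝ) ^ (20 * θ) * (r : ℝ) ^ (1 - 29 * θ)) := by gcongr
      _ = r := by
        rw [← Real.rpow_add hr0, ← Real.rpow_add hr0, ← Real.rpow_add hr0,
          show 4 * θ + (5 * θ + 20 * θ + (1 - 29 * θ)) = 1 by ring, Real.rpow_one]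

theorem two_div_ceil_lt {r p : ℕ} {θ e : ℝ} (hθ0 : 0 < θ) (hθ1 : θ < 1) (hp : 1 ≤ p)
    (hpr : p ≤ 4 * r ^ 14) (hr : 8 < (r : ℝ) ^ (6 * θ)) (he : -θ ≤ e) :
    2 / (⌈(r : ℝ) ^ (20 * θ)⌉₊ : ℝ) < (p : ℝ) ^ e := by
  have hr0 : 0 < r := by
    rcases Nat.eq_zero_or_pos r with rfl | h
    · omega
    · exact h
  have hr0' : (0 : ℝ) < r := by exact_mod_cast hr0
  have hp1 : (1 : ℝ) ≤ p := by exact_mod_cast hp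
  have hpr' : (p : ℝ) ≤ 4 * (r : ℝ) ^ 14 := by exact_mod_cast hpr
  have h4 : (4 : ℝ) ^ θ ≤ 4 := by
    calc (4 : ℝ) ^ θ ≤ 4 ^ (1 : ℝ) := Real.rpow_le_rpow_of_exponent_le (by norm_num) hθ1.le
      _ = 4 := Real.rpow_one _
  have h14 : ((r : ℝ) ^ 14) ^ θ = (r : ℝ) ^ (14 * θ) := by
    rw [← Real.rpow_natCast, ← Real.rpow_mul hr0'.le]; push_cast; rfl
  have hpθ : (p : ℝ) ^ θ ≤ 4 * (r : ℝ) ^ (14 * θ) := by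
    calc (p : ℝ) ^ θ ≤ (4 * (r : ℝ) ^ 14) ^ θ := by gcongr
      _ = 4 ^ θ * (r : ℝ) ^ (14 * θ) := by rw [Real.mul_rpow (by norm_num) (by positivity), h14]
      _ ≤ _ := by gcongr
  have hsplit : (r : ℝ) ^ (20 * θ) = (r : ℝ) ^ (6 * θ) * (r : ℝ) ^ (14 * θ) := by
    rw [← Real.rpow_add hr0']; congr 1; ring
  have h20 : 0 < (r : ℝ) ^ (14 * θ) := by positivity
  calc 2 / (⌈(r : ℝ) ^ (20 * θ)⌉₊ : ℝ) ≤ 2 / (r : ℝ) ^ (20 * θ) := by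
        gcongr
        exact Nat.le_ceil _
    _ < 2 / (8 * (r : ℝ) ^ (14 * θ)) := by
        rw [hsplit]
        gcongr
    _ = (4 * (r : ℝ) ^ (14 * θ))⁻¹ := by field_simp; norm_num
    _ ≤ ((p : ℝ) ^ θ)⁻¹ := by gcongr
    _ = (p : ℝ) ^ (-θ) := (Real.rpow_neg (by positivity) _).symm
    _ ≤ (p : ℝ) ^ e := Real.rpow_le_rpow_of_exponent_le hp1 he

theorem alpha_p_sq_mod_one_PS_primes (γ α β ε : ℝ)
    (hγ1 : 13 / 14 < γ) (hγ2 : γ < 1) (hα : Irrational α) (hε : 0 < ε) :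
    {p : ℕ | p.Prime ∧ (∃ n : ℕ, 0 < n ∧ p = ⌊(n : ℝ) ^ (1 / γ)⌋₊) ∧
      nint (α * (p : ℝ) ^ 2 + β) < (p : ℝ) ^ ((13 - 14 * γ) / 29 + ε)}.Infinite := by
  refine Set.infinite_of_forall_exists_gt fun P => ?_
  set θ : ℝ := (14 * γ - 13) / 29 with hθ
  have hθ0 : 0 < θ := by rw [hθ]; linarith
  have hθ1 : θ < 1 := by rw [hθ]; linarith
  obtain ⟨D, hD0, hD⟩ := exists_card_divisors_le (ε := θ / 15) (by linarith)
  obtain ⟨R, hR⟩ := Filter.eventually_atTop.1 (eventually_scale hθ hγ1 hγ2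
    (by linarith : 1 ≤ D + 1) (25 / √(γ * (1 - γ))) (by positivity))
  obtain ⟨x, hx1, hx2⟩ := exists_large_den_approx hα ((R + P + 1) ^ 8)
  obtain ⟨r, hr1, hr2, hr3⟩ := exists_pow_eight_le (by omega) hx1
  obtain ⟨h1, h2, h3, h4, h5⟩ := hR r (by omega)
  have hr0 : (0 : ℝ) < r := by linarith
  have hscale : IsScale α ((D + 1) * (r : ℝ) ^ θ) 130 x.num x.den r :=
    { coprime := by
        rw [Int.isCoprime_iff_gcd_eq_one]
        exact x.reduced
      approx := by
        have : (x : ℝ) = x.num / x.den := by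
          exact_mod_cast congrArg (fun y : ℚ => (y : ℝ)) (Rat.num_div_den x).symm
        rw [← this]
        exact hx2.le
      le_den := hr2
      den_le := hr3
      one_le := by norm_num
      le_scale := h1
      log_le := h2
      card_divisors_le := fun j hj hjr => by
        have hjr' : (j : ℝ) ≤ (r : ℝ) ^ 15 := by exact_mod_cast hjr
        calc (j.divisors.card : ℝ) ≤ D * (j : ℝ) ^ (θ / 15) := hD j hj.ne'
          _ ≤ D * ((r : ℝ) ^ 15) ^ (θ / 15) := by gcongr
          _ = D * (r : ℝ) ^ θ := by
            rw [← Real.rpow_natCast, ← Real.rpow_mul hr0.le]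
            congr 2
            push_cast; ring
          _ ≤ (D + 1) * (r : ℝ) ^ θ := by gcongr; linarith }
  obtain ⟨p, hp, hpl, hpu, hpn, hpb⟩ := hscale.exists_prime hγ1 hγ2 β
    (Nat.ceil_pos.2 (by positivity)) h3 h4
  refine ⟨p, ⟨hp, hpn, hpb.trans (two_div_ceil_lt hθ0 hθ1 hp.one_lt.le hpu h5 ?_)⟩, ?_⟩
  · rw [hθ]; linarith
  · have : r ≤ r ^ 14 := Nat.le_self_pow (by norm_num) r
    omega
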